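/- Let N ≥ 1 be an integer, q ∈ (1, ∞), q' = q/(q−1), ρ₊ > 0, ρ₋ > 0, and let ρ : ℝ^N → ℝ be given by ρ(x) = ρ₊ if x_N > 0 and ρ(x) = ρ₋ if x_N ≤ 0. Call a pair (φ, V) a p-pair (1 < p < ∞) if φ : ℝ^N → ℝ is locally integrable, V : ℝ^N → ℝ^N is p-integrable, and ∫_{ℝ^N} φ(x) ∂_j ψ(x) dx = −∫_{ℝ^N} V_j(x) ψ(x) dx for every smooth compactly supported ψ : ℝ^N → ℝ and every j = 1, …, N (i.e. V is the distributional gradient of φ). Then there exists a constant C = C(N, q, ρ₊, ρ₋) > 0 such that for every q-integrable f : ℝ^N → ℝ^N there exists a q-pair (u, U) with ‖U‖_{L^q(ℝ^N)} ≤ C ‖f‖_{L^q(ℝ^N)} and ∫_{ℝ^N} ρ(x)^{−1} U(x) · V(x) dx = ∫_{ℝ^N} f(x) · V(x) dx for every q'-pair (φ, V). -/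

import Mathlib

open Real MeasureTheory
open scoped RealInnerProductSpace ENNReal

/-- A `p`-pair `(φ, V)`: `φ` is locally integrable, `V` is `p`-integrable, and `V` is the
distributional gradient of `φ`. -/
def IsGradPair (N : ℕ) (p : ℝ) (φ : EuclideanSpace ℝ (Fin N) → ℝ)
    (V : EuclideanSpace ℝ (Fin N) → EuclideanSpace ℝ (Fin N)) : Prop :=
  LocallyIntegrable φ volume ∧
  MemLp V (ENNReal.ofReal p) volume ∧
  ∀ ψ : EuclideanSpace ℝ (Fin N) → ℝ, ContDiff ℝ (⊤ : ℕ∞) ψ → HasCompactSupport ψ →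
    ∀ j : Fin N,
      ∫ x, φ x * fderiv ℝ ψ x (EuclideanSpace.single j 1) = -∫ x, V x j * ψ x

section TestFunctions

set_option linter.unusedSectionVars false

variable {E : Type*} [NormedAddCommGroup E] [InnerProductSpace ℝ E] [FiniteDimensional ℝ E]

/-- Smooth compactly supported real-valued functions. -/
structure IsTest (ψ : E → ℝ) : Prop where
  contDiff : ContDiff ℝ (⊤ : ℕ∞) ψ
  hasCompactSupport : HasCompactSupport ψ

/-- The derivative of `ψ` in the direction `v`. -/
noncomputable def dirDeriv (v : E) (ψ : E → ℝ) : E → ℝ := fun x => fderiv ℝ ψ x v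

/-- The Laplacian, as a sum of second derivatives along an orthonormal basis. -/
noncomputable def lap (ψ : E → ℝ) : E → ℝ := fun x =>
  ∑ i, dirDeriv (stdOrthonormalBasis ℝ E i) (dirDeriv (stdOrthonormalBasis ℝ E i) ψ) x

lemma IsTest.dirDeriv {ψ : E → ℝ} (h : IsTest ψ) (v : E) : IsTest (dirDeriv v ψ) where
  contDiff := (h.contDiff.fderiv_right (by simp)).clm_apply contDiff_const
  hasCompactSupport := h.hasCompactSupport.fderiv_apply ℝ v

lemma IsTest.continuous {ψ : E → ℝ} (h : IsTest ψ) : Continuous ψ := h.contDiff.continuous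

lemma IsTest.differentiable {ψ : E → ℝ} (h : IsTest ψ) : Differentiable ℝ ψ :=
  h.contDiff.differentiable (by simp)

lemma IsTest.add {ψ χ : E → ℝ} (h : IsTest ψ) (h' : IsTest χ) : IsTest (ψ + χ) :=
  ⟨h.contDiff.add h'.contDiff, h.hasCompactSupport.add h'.hasCompactSupport⟩

lemma IsTest.const_smul {ψ : E → ℝ} (h : IsTest ψ) (c : ℝ) : IsTest (c • ψ) :=
  ⟨h.contDiff.const_smul c, h.hasCompactSupport.smul_left⟩

lemma lap_eq (ψ : E → ℝ) : lap ψ = ∑ i,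
    dirDeriv (stdOrthonormalBasis ℝ E i) (dirDeriv (stdOrthonormalBasis ℝ E i) ψ) := by
  ext x; simp [lap]

lemma IsTest.sum {ι : Type*} (s : Finset ι) {f : ι → E → ℝ} (h : ∀ i ∈ s, IsTest (f i)) :
    IsTest (∑ i ∈ s, f i) := by
  classical
  induction s using Finset.induction_on with
  | empty =>
    exact ⟨contDiff_const, HasCompactSupport.zero⟩
  | insert a s ha ih =>
    rw [Finset.sum_insert ha]
    exact (h _ (by simp)).add (ih fun i hi => h i (by simp [hi]))

lemma IsTest.lap {ψ : E → ℝ} (h : IsTest ψ) : IsTest (lap ψ) := by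
  rw [lap_eq]; exact IsTest.sum _ fun i _ => (h.dirDeriv _).dirDeriv _

lemma IsTest.continuous_gradient {ψ : E → ℝ} (h : IsTest ψ) : Continuous (gradient ψ) := by
  have : Continuous (fderiv ℝ ψ) := h.contDiff.continuous_fderiv (by simp)
  exact (InnerProductSpace.toDual ℝ E).symm.continuous.comp this

lemma IsTest.hasCompactSupport_gradient {ψ : E → ℝ} (h : IsTest ψ) :
    HasCompactSupport (gradient ψ) :=
  (h.hasCompactSupport.fderiv ℝ).comp_left (g := (InnerProductSpace.toDual ℝ E).symm) (map_zero _)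

lemma IsTest.dirDeriv_comm {ψ : E → ℝ} (h : IsTest ψ) (v w : E) :
    _root_.dirDeriv v (_root_.dirDeriv w ψ) = _root_.dirDeriv w (_root_.dirDeriv v ψ) := by
  have hs (x : E) : IsSymmSndFDerivAt ℝ ψ x :=
    h.contDiff.contDiffAt.isSymmSndFDerivAt (n := (⊤ : ℕ∞)) (by
      rw [minSmoothness_of_isRCLikeNormedField]; exact WithTop.coe_le_coe.2 (le_top (a := (2 : ℕ∞))))
  have hd : Differentiable ℝ (fderiv ℝ ψ) :=
    (h.contDiff.fderiv_right (m := 1) (by norm_cast)).differentiable (by simp)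
  have key (a b x : E) : _root_.dirDeriv a (_root_.dirDeriv b ψ) x = fderiv ℝ (fderiv ℝ ψ) x a b := by
    unfold _root_.dirDeriv
    rw [fderiv_clm_apply (hd x) (differentiableAt_const b)]
    simp
  ext x
  rw [key, key]
  exact hs x v w

lemma inner_gradient_eq (ψ : E → ℝ) (x v : E) : ⟪gradient ψ x, v⟫ = dirDeriv v ψ x :=
  inner_gradient_left

lemma sum_inner_basis (x y : E) :
    ⟪x, y⟫ = ∑ i, ⟪x, stdOrthonormalBasis ℝ E i⟫ * ⟪y, stdOrthonormalBasis ℝ E i⟫ := by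
  rw [← (stdOrthonormalBasis ℝ E).sum_inner_mul_inner x y]
  simp_rw [real_inner_comm y]

lemma gradient_add' {ψ χ : E → ℝ} (h : IsTest ψ) (h' : IsTest χ) :
    gradient (ψ + χ) = gradient ψ + gradient χ := by
  ext1 x
  simp [gradient, fderiv_add (h.differentiable x) (h'.differentiable x)]

lemma gradient_const_smul' {ψ : E → ℝ} (h : IsTest ψ) (c : ℝ) :
    gradient (c • ψ) = c • gradient ψ := by
  ext1 x
  simp [gradient, fderiv_const_smul (h.differentiable x) c]

lemma tsupport_dirDeriv_subset (v : E) (ψ : E → ℝ) : tsupport (dirDeriv v ψ) ⊆ tsupport ψ :=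
  (tsupport_fderiv_apply_subset ℝ v)

variable [MeasurableSpace E] [BorelSpace E]

lemma IsTest.memLp_gradient {ψ : E → ℝ} (h : IsTest ψ) (p : ℝ≥0∞) :
    MemLp (gradient ψ) p volume :=
  h.continuous_gradient.memLp_of_hasCompactSupport h.hasCompactSupport_gradient

lemma IsTest.integrable_mul {ψ χ : E → ℝ} (h : IsTest ψ) (h' : IsTest χ) :
    Integrable (fun x => ψ x * χ x) volume :=
  (h.continuous.mul h'.continuous).integrable_of_hasCompactSupport h.hasCompactSupport.mul_right

lemma IsTest.integral_mul_dirDeriv {ψ χ : E → ℝ} (h : IsTest ψ) (h' : IsTest χ) (v : E) :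
    ∫ x, ψ x * _root_.dirDeriv v χ x = -∫ x, _root_.dirDeriv v ψ x * χ x :=
  integral_mul_fderiv_eq_neg_fderiv_mul_of_integrable
    ((h.dirDeriv v).integrable_mul h') (h.integrable_mul (h'.dirDeriv v)) (h.integrable_mul h')
    (fun x _ => h.differentiable x) (fun x _ => h'.differentiable x)

/-- `V` is the distributional gradient of `φ`. -/
def WeakGrad (φ : E → ℝ) (V : E → E) : Prop :=
  ∀ ψ : E → ℝ, IsTest ψ → ∀ v : E, ∫ x, φ x * dirDeriv v ψ x = -∫ x, ⟪V x, v⟫ * ψ x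

/-- A weak form of the identity `∇ (div V) = Δ V` which characterises curl-free fields. -/
def WeakCurlFree (V : E → E) : Prop :=
  ∀ ψ : E → ℝ, IsTest ψ → ∀ v : E, ∫ x, ⟪V x, v⟫ * lap ψ x = ∫ x, ⟪V x, gradient (dirDeriv v ψ) x⟫

lemma IsTest.weakGrad {ψ : E → ℝ} (h : IsTest ψ) : WeakGrad ψ (gradient ψ) := by
  intro χ hχ v
  simp_rw [inner_gradient_eq]
  exact h.integral_mul_dirDeriv hχ v

lemma integrable_inner_const_mul {V : E → E} (hV : LocallyIntegrable V volume)
    {ψ : E → ℝ} (hψ : Continuous ψ) (hc : HasCompactSupport ψ) (v : E) :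
    Integrable (fun x => ⟪V x, v⟫ * ψ x) volume := by
  have : Integrable (fun x => ψ x • V x) volume := hV.integrable_smul_left_of_hasCompactSupport hψ hc
  refine (this.inner_const v).congr (.of_forall fun x => ?_)
  simp [inner_smul_left, mul_comm]

lemma WeakGrad.weakCurlFree {φ : E → ℝ} {V : E → E} (hφ : LocallyIntegrable φ volume)
    (hV : LocallyIntegrable V volume) (h : WeakGrad φ V) : WeakCurlFree V := by
  intro ψ hψ v
  set b := stdOrthonormalBasis ℝ E with hb
  have h1 : ∫ x, ⟪V x, v⟫ * lap ψ x = -∫ x, φ x * dirDeriv v (lap ψ) x := by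
    rw [h _ hψ.lap v]; simp
  have h2 : ∀ x, ⟪V x, gradient (dirDeriv v ψ) x⟫
      = ∑ i, ⟪V x, b i⟫ * dirDeriv (b i) (dirDeriv v ψ) x := by
    intro x; rw [sum_inner_basis]; simp_rw [inner_gradient_eq]; rfl
  have hint (i) : Integrable (fun x => ⟪V x, b i⟫ * dirDeriv (b i) (dirDeriv v ψ) x) volume :=
    integrable_inner_const_mul hV ((hψ.dirDeriv v).dirDeriv _).continuous
      ((hψ.dirDeriv v).dirDeriv _).hasCompactSupport _
  have h3 : dirDeriv v (lap ψ) = ∑ i, dirDeriv (b i) (dirDeriv (b i) (dirDeriv v ψ)) := by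
    ext x
    have : dirDeriv v (lap ψ) x = ∑ i, dirDeriv v (dirDeriv (b i) (dirDeriv (b i) ψ)) x := by
      unfold dirDeriv
      rw [lap_eq]
      rw [fderiv_sum]
      · rw [sum_apply]; rfl
      · intro i _; exact ((hψ.dirDeriv _).dirDeriv _).differentiable x
    rw [this, Finset.sum_apply]
    congr 1 with i
    rw [(hψ.dirDeriv (b i)).dirDeriv_comm v (b i), hψ.dirDeriv_comm v (b i)]
  rw [h1, integral_congr_ae (.of_forall h2), integral_finsetSum _ fun i _ => hint i, h3]
  have h4 (i) : ∫ x, ⟪V x, b i⟫ * dirDeriv (b i) (dirDeriv v ψ) x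
      = -∫ x, φ x * dirDeriv (b i) (dirDeriv (b i) (dirDeriv v ψ)) x := by
    rw [h _ ((hψ.dirDeriv v).dirDeriv _)]; simp
  simp_rw [h4]
  rw [Finset.sum_neg_distrib, ← integral_finsetSum]
  · simp [Finset.mul_sum]
  · intro i _
    have ht := ((hψ.dirDeriv v).dirDeriv (b i)).dirDeriv (b i)
    refine (hφ.integrable_smul_left_of_hasCompactSupport ht.continuous ht.hasCompactSupport).congr
      (.of_forall fun x => ?_)
    simp [mul_comm]

/-- The smooth compactly supported gradient fields, as a subspace of `L²`. -/
def testGradients (E : Type*) [NormedAddCommGroup E] [InnerProductSpace ℝ E]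
    [FiniteDimensional ℝ E] [MeasurableSpace E] [BorelSpace E] :
    Submodule ℝ (Lp E 2 (volume : Measure E)) where
  carrier := {F | ∃ ψ : E → ℝ, IsTest ψ ∧ F =ᵐ[volume] gradient ψ}
  zero_mem' := by
    refine ⟨0, ⟨contDiff_const, HasCompactSupport.zero⟩, ?_⟩
    filter_upwards [Lp.coeFn_zero E 2 (volume : Measure E)] with x hx
    rw [hx]; simp [gradient, Pi.zero_def]
  add_mem' := by
    rintro F G ⟨ψ, hψ, hF⟩ ⟨χ, hχ, hG⟩
    refine ⟨ψ + χ, hψ.add hχ, ?_⟩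
    rw [gradient_add' hψ hχ]
    exact (Lp.coeFn_add F G).trans (hF.add hG)
  smul_mem' := by
    rintro c F ⟨ψ, hψ, hF⟩
    refine ⟨c • ψ, hψ.const_smul c, ?_⟩
    rw [gradient_const_smul' hψ]
    exact (Lp.coeFn_smul c F).trans (hF.const_smul c)

instance : CompleteSpace (testGradients E).topologicalClosure :=
  (testGradients E).isClosed_topologicalClosure.completeSpace_coe

/-- The orthogonal projection of `L²` vector fields onto the closure of the smooth gradients. -/
noncomputable def gradProj (E : Type*) [NormedAddCommGroup E] [InnerProductSpace ℝ E]
    [FiniteDimensional ℝ E] [MeasurableSpace E] [BorelSpace E] :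
    Lp E 2 (volume : Measure E) →L[ℝ] Lp E 2 (volume : Measure E) :=
  (testGradients E).topologicalClosure.starProjection

lemma norm_gradProj_le (f : Lp E 2 (volume : Measure E)) : ‖gradProj E f‖ ≤ ‖f‖ :=
  Submodule.norm_starProjection_apply_le _ f

lemma gradProj_mem (f : Lp E 2 (volume : Measure E)) :
    gradProj E f ∈ (testGradients E).topologicalClosure :=
  Submodule.starProjection_apply_mem _ f

lemma inner_gradProj_comm (f g : Lp E 2 (volume : Measure E)) :
    ⟪gradProj E f, g⟫ = ⟪f, gradProj E g⟫ :=
  Submodule.inner_starProjection_left_eq_right _ f g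

lemma inner_gradProj_of_mem (f : Lp E 2 (volume : Measure E)) {g : Lp E 2 (volume : Measure E)}
    (hg : g ∈ (testGradients E).topologicalClosure) : ⟪gradProj E f, g⟫ = ⟪f, g⟫ := by
  rw [inner_gradProj_comm]
  congr 1
  exact Submodule.starProjection_eq_self_iff.2 hg

lemma inner_eq_integral_of_ae {f g : Lp E 2 (volume : Measure E)} {g' : E → E} (h : g =ᵐ[volume] g') :
    ⟪f, g⟫ = ∫ x, ⟪f x, g' x⟫ := by
  rw [L2.inner_def]
  refine integral_congr_ae ?_
  filter_upwards [h] with x hx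
  rw [hx]

lemma integral_gradProj_inner_gradient (f : Lp E 2 (volume : Measure E)) {ψ : E → ℝ} (hψ : IsTest ψ) :
    ∫ x, ⟪gradProj E f x, gradient ψ x⟫ = ∫ x, ⟪f x, gradient ψ x⟫ := by
  have hm := hψ.memLp_gradient 2
  have h1 : hm.toLp ∈ (testGradients E).topologicalClosure :=
    (testGradients E).le_topologicalClosure ⟨ψ, hψ, hm.coeFn_toLp⟩
  rw [← inner_eq_integral_of_ae hm.coeFn_toLp, inner_gradProj_of_mem f h1,
    inner_eq_integral_of_ae hm.coeFn_toLp]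

lemma weakCurlFree_of_mem {F : Lp E 2 (volume : Measure E)}
    (hF : F ∈ (testGradients E).topologicalClosure) : WeakCurlFree F := by
  intro ψ hψ v
  have hm1 : MemLp (fun x => lap ψ x • v) 2 (volume : Measure E) :=
    (hψ.lap.continuous.smul continuous_const).memLp_of_hasCompactSupport
      hψ.lap.hasCompactSupport.smul_right
  have hm2 := (hψ.dirDeriv v).memLp_gradient 2
  have key (G : Lp E 2 (volume : Measure E)) : ⟪hm1.toLp - hm2.toLp, G⟫
      = (∫ x, ⟪G x, v⟫ * lap ψ x) - ∫ x, ⟪G x, gradient (dirDeriv v ψ) x⟫ := by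
    rw [inner_sub_left, real_inner_comm, inner_eq_integral_of_ae hm1.coeFn_toLp,
      real_inner_comm, inner_eq_integral_of_ae hm2.coeFn_toLp]
    simp [inner_smul_right, mul_comm]
  have h0 : ⟪hm1.toLp - hm2.toLp, F⟫ = 0 := by
    have hcl : IsClosed {G : Lp E 2 (volume : Measure E) | ⟪hm1.toLp - hm2.toLp, G⟫ = 0} :=
      isClosed_eq (by fun_prop) continuous_const
    refine closure_minimal ?_ hcl hF
    rintro G ⟨χ, hχ, hG⟩
    have := hχ.weakGrad.weakCurlFree hχ.continuous.locallyIntegrable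
      hχ.continuous_gradient.locallyIntegrable ψ hψ v
    simp only [Set.mem_ofPred_eq]
    rw [key, sub_eq_zero]
    convert this using 1
    · refine integral_congr_ae ?_
      filter_upwards [hG] with x hx
      rw [hx]
    · refine integral_congr_ae ?_
      filter_upwards [hG] with x hx
      rw [hx]
  rw [key, sub_eq_zero] at h0
  exact h0

end TestFunctions

section MeanValue

variable {E : Type*} [NormedAddCommGroup E] [InnerProductSpace ℝ E] [FiniteDimensional ℝ E]

set_option linter.unusedSectionVars false

/-- A radial smooth potential supported in the closed unit ball. -/
noncomputable def radialPotential (x : E) : ℝ := expNegInvGlue (1 - ‖x‖ ^ 2)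

/-- The radial bump function with `∇ (radialPotential) x = - radialBump x • x`. -/
noncomputable def radialBump (x : E) : ℝ :=
  2 * ((1 - ‖x‖ ^ 2)⁻¹ ^ 2 * expNegInvGlue (1 - ‖x‖ ^ 2))

lemma contDiff_radialPotential : ContDiff ℝ (⊤ : ℕ∞) (radialPotential : E → ℝ) :=
  expNegInvGlue.contDiff.comp (contDiff_const.sub (contDiff_norm_sq ℝ))

lemma contDiff_radialBump : ContDiff ℝ (⊤ : ℕ∞) (radialBump : E → ℝ) := by
  have h := (expNegInvGlue.contDiff_polynomial_eval_inv_mul (n := (⊤ : ℕ∞)) (Polynomial.X ^ 2)).comp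
    (contDiff_const.sub (contDiff_norm_sq ℝ) : ContDiff ℝ (⊤ : ℕ∞) fun x : E => 1 - ‖x‖ ^ 2)
  simp only [Polynomial.eval_pow, Polynomial.eval_X] at h
  exact contDiff_const.mul h

lemma radialPotential_eq_zero {x : E} (h : 1 ≤ ‖x‖) : radialPotential x = 0 :=
  expNegInvGlue.zero_of_nonpos (by nlinarith)

lemma radialBump_eq_zero {x : E} (h : 1 ≤ ‖x‖) : radialBump x = 0 := by
  rw [radialBump, expNegInvGlue.zero_of_nonpos (by nlinarith)]; simp

lemma radialBump_nonneg (x : E) : 0 ≤ radialBump x := by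
  have := expNegInvGlue.nonneg (1 - ‖x‖ ^ 2)
  unfold radialBump; positivity

lemma isTest_of_zero_outside {ψ : E → ℝ} (h : ContDiff ℝ (⊤ : ℕ∞) ψ) {x : E} {r : ℝ}
    (h0 : ∀ y, y ∉ Metric.closedBall x r → ψ y = 0) : IsTest ψ :=
  ⟨h, HasCompactSupport.intro (isCompact_closedBall x r) h0⟩

lemma isTest_radialBump : IsTest (radialBump : E → ℝ) :=
  isTest_of_zero_outside (x := 0) (r := 1) contDiff_radialBump fun y hy =>
    radialBump_eq_zero (by simp at hy; exact hy.le)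

lemma isTest_radialPotential : IsTest (radialPotential : E → ℝ) :=
  isTest_of_zero_outside (x := 0) (r := 1) contDiff_radialPotential fun y hy =>
    radialPotential_eq_zero (by simp at hy; exact hy.le)

lemma dirDeriv_radialPotential (v : E) :
    dirDeriv v radialPotential = fun x : E => -(radialBump x * ⟪x, v⟫) := by
  ext x
  have h1 := expNegInvGlue.hasDerivAt_polynomial_eval_inv_mul 1 (1 - ‖x‖ ^ 2)
  simp only [Polynomial.eval_one, one_mul, Polynomial.derivative_one, sub_zero, mul_one,
    Polynomial.eval_pow, Polynomial.eval_X] at h1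
  have h2 : HasFDerivAt (fun x : E => 1 - ‖x‖ ^ 2) (-(2 • innerSL ℝ x)) x :=
    (hasStrictFDerivAt_norm_sq x).hasFDerivAt.const_sub 1
  have h3 := h1.comp_hasFDerivAt x h2
  have h4 : HasFDerivAt radialPotential _ x := h3
  rw [dirDeriv, h4.fderiv]
  simp [radialBump]
  ring

lemma lap_radialPotential (x : E) : lap radialPotential x =
    -(Module.finrank ℝ E * radialBump x + fderiv ℝ radialBump x x) := by
  set b := stdOrthonormalBasis ℝ E with hb
  have h1 (i) : dirDeriv (b i) (dirDeriv (b i) radialPotential) x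
      = -(radialBump x + ⟪b i, x⟫ * fderiv ℝ radialBump x (b i)) := by
    rw [dirDeriv_radialPotential (b i)]
    have hd : HasFDerivAt (fun x : E => -(radialBump x * ⟪x, b i⟫))
        (-(radialBump x • (innerSL ℝ (b i)) + ⟪x, b i⟫ • fderiv ℝ radialBump x)) x := by
      have h2 : HasFDerivAt (fun x : E => ⟪x, b i⟫) (innerSL ℝ (b i)) x := by
        simp_rw [fun y => real_inner_comm (b i) y]
        exact (innerSL ℝ (b i)).hasFDerivAt
      exact ((isTest_radialBump.differentiable x).hasFDerivAt.mul h2).neg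
    rw [dirDeriv, hd.fderiv]
    simp [real_inner_comm]
  have h2 : fderiv ℝ radialBump x x = ∑ i, ⟪b i, x⟫ * fderiv ℝ radialBump x (b i) := by
    conv_lhs => arg 2; rw [← b.sum_repr' x]
    simp
  rw [lap, h2]
  simp_rw [← hb, h1, Finset.sum_neg_distrib, Finset.sum_add_distrib]
  simp

lemma dirDeriv_comp_scale (g : E → ℝ) (v x : E) (c : ℝ) :
    dirDeriv v (fun y => g (c • (y - x))) = fun y => c * dirDeriv v g (c • (y - x)) := by
  ext y
  have : (fun y => g (c • (y - x))) = fun y => (fun z => g (c • z)) (y - x) := rfl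
  rw [dirDeriv, this, fderiv_comp_sub (f := fun z => g (c • z)), dirDeriv]
  have := congrArg (· v) (fderiv_comp_smul (𝕜 := ℝ) (f := g) (x := y - x) c)
  simpa using this

lemma dirDeriv_const_mul {g : E → ℝ} (v : E) (c : ℝ) :
    dirDeriv v (fun y => c * g y) = fun y => c * dirDeriv v g y := by
  ext y
  have := congrFun (fderiv_const_smul_field (𝕜 := ℝ) (f := g) c) y
  have h2 := congrArg (fun L : E →L[ℝ] ℝ => L v) this
  exact h2

lemma lap_comp_scale (g : E → ℝ) (x : E) (c : ℝ) :
    lap (fun y => g (c • (y - x))) = fun y => c ^ 2 * lap g (c • (y - x)) := by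
  ext y
  simp only [lap, dirDeriv_comp_scale, dirDeriv_const_mul, Finset.mul_sum]
  congr 1 with i
  ring

/-- The radial bump function, centred at `x` and rescaled to radius `s`. -/
noncomputable def scaledBump (s : ℝ) (x y : E) : ℝ :=
  (s ^ Module.finrank ℝ E)⁻¹ * radialBump (s⁻¹ • (y - x))

lemma hasDerivAt_scaledBump (x y : E) {s : ℝ} (hs : 0 < s) :
    HasDerivAt (fun s => scaledBump s x y)
      (s * (s ^ Module.finrank ℝ E)⁻¹ * lap (fun y => radialPotential (s⁻¹ • (y - x))) y) s := by
  set n := Module.finrank ℝ E with hn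
  have h1 : HasDerivAt (fun s : ℝ => s⁻¹ • (y - x)) ((-(s ^ 2)⁻¹) • (y - x)) s :=
    (hasDerivAt_inv hs.ne').smul_const (y - x)
  have h2 : HasDerivAt (fun s : ℝ => radialBump (s⁻¹ • (y - x)))
      (fderiv ℝ radialBump (s⁻¹ • (y - x)) ((-(s ^ 2)⁻¹) • (y - x))) s :=
    (isTest_radialBump.differentiable _).hasFDerivAt.comp_hasDerivAt s h1
  have h3 : HasDerivAt (fun s : ℝ => (s ^ n)⁻¹) (-(n * s ^ (n - 1)) / (s ^ n) ^ 2) s :=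
    (hasDerivAt_pow n s).inv (by positivity)
  have h4 := h3.mul h2
  refine h4.congr_deriv ?_
  rw [lap_comp_scale]
  simp only [lap_radialPotential, map_smul, smul_eq_mul, ← hn]
  rcases Nat.eq_zero_or_pos n with h0 | h0
  · simp only [h0]; field_simp; simp
  · obtain ⟨k, hk⟩ := Nat.exists_eq_add_of_lt h0
    have hk : n = k + 1 := by omega
    rw [hk]
    simp only [Nat.add_sub_cancel, Nat.cast_add, Nat.cast_one]
    field_simp
    ring

variable [MeasurableSpace E] [BorelSpace E]

lemma isTest_scaledPotential (x : E) {s : ℝ} (hs : 0 < s) :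
    IsTest (fun y => radialPotential (s⁻¹ • (y - x))) :=
  isTest_of_zero_outside (x := x) (r := s)
    (contDiff_radialPotential.comp ((contDiff_id.sub contDiff_const).const_smul _)) fun y hy => by
    refine radialPotential_eq_zero ?_
    rw [norm_smul, norm_inv, Real.norm_of_nonneg hs.le, ← div_eq_inv_mul, one_le_div hs]
    simp [dist_eq_norm] at hy; exact hy.le

lemma scaledBump_eq_zero {x y : E} {s : ℝ} (hs : 0 < s) (hy : y ∉ Metric.closedBall x s) :
    scaledBump s x y = 0 := by
  rw [scaledBump, radialBump_eq_zero, mul_zero]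
  rw [norm_smul, norm_inv, Real.norm_of_nonneg hs.le, ← div_eq_inv_mul, one_le_div hs]
  simp [dist_eq_norm] at hy; exact hy.le

lemma isTest_scaledBump (x : E) {s : ℝ} (hs : 0 < s) : IsTest (scaledBump s x) :=
  isTest_of_zero_outside (x := x) (r := s)
    (contDiff_const.mul
      (contDiff_radialBump.comp ((contDiff_id.sub contDiff_const).const_smul _)))
    fun _ hy => scaledBump_eq_zero hs hy

lemma integral_radialBump_pos : 0 < ∫ x : E, radialBump x := by
  refine isTest_radialBump.continuous.integral_pos_of_hasCompactSupport_nonneg_nonzero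
    isTest_radialBump.hasCompactSupport radialBump_nonneg (x := 0) ?_
  have := expNegInvGlue.pos_of_pos one_pos
  simp [radialBump, this.ne']

lemma integral_scaledBump (x : E) {s : ℝ} (hs : 0 < s) :
    ∫ y, scaledBump s x y = ∫ y : E, radialBump y := by
  unfold scaledBump
  rw [integral_const_mul, integral_sub_right_eq_self (fun y => radialBump (s⁻¹ • y)) x,
    Measure.integral_comp_inv_smul]
  rw [abs_of_nonneg (by positivity), smul_eq_mul, inv_mul_cancel_left₀ (by positivity)]

lemma exists_radialBump_le : ∃ M : ℝ, 0 < M ∧ ∀ x : E, radialBump x ≤ M := by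
  obtain ⟨M, hM⟩ := isTest_radialBump (E := E) |>.continuous.bounded_above_of_compact_support
    isTest_radialBump.hasCompactSupport
  exact ⟨max M 1, by positivity, fun x => (le_abs_self _).trans ((hM x).trans (le_max_left _ _))⟩

lemma hasDerivAt_integral_scaledBump {h : E → E} (hh : LocallyIntegrable h volume) (x : E) {s : ℝ}
    (hs : 0 < s) :
    HasDerivAt (fun s => ∫ y, scaledBump s x y • h y)
      (∫ y, (s * (s ^ Module.finrank ℝ E)⁻¹ *
        lap (fun y => radialPotential (s⁻¹ • (y - x))) y) • h y) s := by
  set n := Module.finrank ℝ E with hn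
  obtain ⟨M, hM⟩ := isTest_radialPotential (E := E) |>.lap.continuous.bounded_above_of_compact_support
    isTest_radialPotential.lap.hasCompactSupport
  have hM0 : 0 ≤ M := (norm_nonneg _).trans (hM 0)
  have hpos : ∀ t ∈ Metric.ball s (s / 2), s / 2 < t ∧ t < 2 * s := by
    intro t ht
    rw [Metric.mem_ball, Real.dist_eq, abs_lt] at ht
    constructor <;> linarith
  have hint (t : ℝ) (ht : 0 < t) : Integrable (fun y => scaledBump t x y • h y) volume :=
    hh.integrable_smul_left_of_hasCompactSupport (isTest_scaledBump x ht).continuous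
      (isTest_scaledBump x ht).hasCompactSupport
  have hI : IntegrableOn h (Metric.closedBall x (2 * s)) volume :=
    hh.integrableOn_isCompact (isCompact_closedBall _ _)
  refine (hasDerivAt_integral_of_dominated_loc_of_deriv_le (s := Metric.ball s (s / 2))
    (F' := fun s y => (s * (s ^ Module.finrank ℝ E)⁻¹ *
        lap (fun y => radialPotential (s⁻¹ • (y - x))) y) • h y)
    (bound := fun y => (2 * s * ((s / 2) ^ n)⁻¹ * ((s / 2)⁻¹ ^ 2 * M)) *
      (Metric.closedBall x (2 * s)).indicator (fun y => ‖h y‖) y)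
    (Metric.ball_mem_nhds s (by positivity)) ?_ (hint s hs) ?_ ?_ ?_ ?_).2
  · filter_upwards [lt_mem_nhds hs] with t ht using (hint t ht).aestronglyMeasurable
  · have ht := (isTest_scaledPotential x hs).lap
    simp_rw [mul_smul]
    exact (((hh.integrable_smul_left_of_hasCompactSupport ht.continuous
      ht.hasCompactSupport).smul (s ^ n)⁻¹).smul s).aestronglyMeasurable
  · refine .of_forall fun y t ht => ?_
    obtain ⟨ht1, ht2⟩ := hpos t ht
    have ht0 : 0 < t := by linarith
    rw [lap_comp_scale]
    by_cases hy : y ∈ Metric.closedBall x (2 * s)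
    · rw [Set.indicator_of_mem hy, norm_smul]
      gcongr
      rw [norm_mul, norm_mul, norm_mul, norm_inv, norm_pow, norm_pow, norm_inv,
        Real.norm_of_nonneg ht0.le]
      have := hM (t⁻¹ • (y - x))
      gcongr
    · have : lap radialPotential (t⁻¹ • (y - x)) = 0 := by
        refine image_eq_zero_of_notMem_tsupport fun hmem => hy ?_
        have h1 : tsupport (lap (radialPotential : E → ℝ)) ⊆ Metric.closedBall 0 1 := by
          have h2 : tsupport (radialPotential : E → ℝ) ⊆ Metric.closedBall 0 1 :=
            closure_minimal (fun z hz => by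
              by_contra hz'
              exact hz (radialPotential_eq_zero (by simp at hz'; exact hz'.le)))
              Metric.isClosed_closedBall
          refine closure_minimal (fun z hz => ?_) Metric.isClosed_closedBall
          by_contra hz'
          refine hz ?_
          rw [lap]
          refine Finset.sum_eq_zero fun i _ => image_eq_zero_of_notMem_tsupport fun h3 => hz' ?_
          exact h2 (tsupport_dirDeriv_subset _ _ (tsupport_dirDeriv_subset _ _ h3))
        have h2 := h1 hmem
        rw [mem_closedBall_zero_iff, norm_smul, norm_inv, Real.norm_of_nonneg ht0.le,
          ← div_eq_inv_mul, div_le_one ht0] at h2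
        rw [Metric.mem_closedBall, dist_eq_norm]
        linarith
      simp only [this]
      simp [Set.indicator_of_notMem hy]
  · exact (((integrable_indicator_iff Metric.isClosed_closedBall.measurableSet).2 hI).norm.congr
      (.of_forall fun y => norm_indicator_eq_indicator_norm _ _)).const_mul _
  · refine .of_forall fun y t ht => ?_
    have ht0 : 0 < t := by linarith [(hpos t ht).1]
    exact (hasDerivAt_scaledBump x y ht0).smul_const _

/-- Mean value property: weakly harmonic functions agree almost everywhere with their
averages against the rescaled radial bump. -/
lemma ae_smul_eq_integral_scaledBump {h : E → E} (hh : LocallyIntegrable h volume) {Ω : Set E}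
    (hharm : ∀ ψ : E → ℝ, IsTest ψ → tsupport ψ ⊆ Ω → ∫ y, lap ψ y • h y = 0) :
    ∀ᵐ x, ∀ s : ℝ, 0 < s → Metric.closedBall x s ⊆ Ω →
      (∫ y : E, radialBump y) • h x = ∫ y, scaledBump s x y • h y := by
  set n := Module.finrank ℝ E with hn
  obtain ⟨M, hM0, hM⟩ := exists_radialBump_le (E := E)
  filter_upwards [IsUnifLocDoublingMeasure.ae_tendsto_average_norm_sub volume hh 1] with x hx s hs hsΩ
  have hint (t : ℝ) (ht : 0 < t) : Integrable (fun y => scaledBump t x y • h y) volume :=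
    hh.integrable_smul_left_of_hasCompactSupport (isTest_scaledBump x ht).continuous
      (isTest_scaledBump x ht).hasCompactSupport
  have hconst : ∀ t ∈ Set.Ioc 0 s, ∫ y, scaledBump t x y • h y = ∫ y, scaledBump s x y • h y := by
    intro t ht
    refine (constant_of_has_deriv_right_zero
      (f := fun s => ∫ y, scaledBump s x y • h y) (a := t) (b := s) ?_ ?_ s ⟨ht.2, le_rfl⟩).symm
    · intro r hr
      exact (hasDerivAt_integral_scaledBump hh x (ht.1.trans_le hr.1)).continuousAt.continuousWithinAt
    · intro r hr
      have hr0 : 0 < r := ht.1.trans_le hr.1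
      have := hasDerivAt_integral_scaledBump hh x hr0
      simp_rw [mul_smul, integral_smul] at this
      rw [hharm _ (isTest_scaledPotential x hr0), smul_zero, smul_zero] at this
      · exact this.hasDerivWithinAt
      · refine (closure_minimal (fun z hz => ?_) Metric.isClosed_closedBall).trans
          ((Metric.closedBall_subset_closedBall hr.2.le).trans hsΩ)
        by_contra hz'
        refine hz (radialPotential_eq_zero ?_)
        rw [norm_smul, norm_inv, Real.norm_of_nonneg hr0.le, ← div_eq_inv_mul, one_le_div hr0]
        simp [dist_eq_norm] at hz'; exact hz'.le
  have hlim : Filter.Tendsto (fun t => ∫ y, scaledBump t x y • h y) (nhdsWithin 0 (Set.Ioi 0))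
      (nhds ((∫ y : E, radialBump y) • h x)) := by
    have hav := hx (l := nhdsWithin (0 : ℝ) (Set.Ioi 0)) (fun _ => x) id Filter.tendsto_id
      (by filter_upwards [self_mem_nhdsWithin] with t (ht : 0 < t)
          simpa using ht.le)
    rw [tendsto_iff_norm_sub_tendsto_zero]
    refine squeeze_zero' (.of_forall fun _ => norm_nonneg _) ?_
      (by simpa using hav.const_mul (M * volume.real (Metric.closedBall (0 : E) 1)))
    filter_upwards [self_mem_nhdsWithin] with t (ht : 0 < t)
    have hI2 : Integrable (fun y => scaledBump t x y • h x) volume :=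
      ((isTest_scaledBump x ht).continuous.integrable_of_hasCompactSupport
        (isTest_scaledBump x ht).hasCompactSupport).smul_const _
    have hIb : IntegrableOn (fun y => ‖h y - h x‖) (Metric.closedBall x t) volume :=
      ((hh.integrableOn_isCompact (isCompact_closedBall _ _)).sub
        (integrableOn_const (isCompact_closedBall x t).measure_lt_top.ne)).norm
    have hvol : volume.real (Metric.closedBall x t)
        = t ^ n * volume.real (Metric.closedBall (0 : E) 1) := by
      rw [measureReal_def, Measure.addHaar_closedBall' _ _ ht.le, ENNReal.toReal_mul,
        ENNReal.toReal_ofReal (by positivity), measureReal_def]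
    have hωpos : 0 < volume.real (Metric.closedBall (0 : E) 1) :=
      ENNReal.toReal_pos (Metric.measure_closedBall_pos _ _ one_pos).ne'
        (isCompact_closedBall _ _).measure_lt_top.ne
    rw [← integral_scaledBump x ht, ← integral_smul_const, ← integral_sub (hint t ht) hI2]
    simp_rw [← smul_sub]
    calc ‖∫ y, scaledBump t x y • (h y - h x)‖
        ≤ ∫ y, (Metric.closedBall x t).indicator (fun y => ((t ^ n)⁻¹ * M) * ‖h y - h x‖) y := by
          refine norm_integral_le_of_norm_le ?_ (.of_forall fun y => ?_)
          · exact (integrable_indicator_iff Metric.isClosed_closedBall.measurableSet).2 (hIb.const_mul _)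
          · by_cases hy : y ∈ Metric.closedBall x t
            · rw [Set.indicator_of_mem hy, norm_smul]
              gcongr
              rw [scaledBump, norm_mul, Real.norm_of_nonneg (by positivity),
                Real.norm_of_nonneg (radialBump_nonneg _)]
              gcongr
              exact hM _
            · rw [scaledBump_eq_zero ht hy]
              simp [Set.indicator_of_notMem hy]
      _ = _ := by
          rw [integral_indicator Metric.isClosed_closedBall.measurableSet, integral_const_mul,
            setAverage_eq, smul_eq_mul, hvol]
          field_simp
  refine tendsto_nhds_unique hlim ?_
  refine tendsto_const_nhds.congr' ?_
  filter_upwards [Ioc_mem_nhdsGT hs] with t ht using (hconst t ht).symm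

/-- Weakly harmonic functions are bounded by their `L¹` averages over balls. -/
lemma exists_ae_enorm_mul_le_lintegral (E : Type*) [NormedAddCommGroup E] [InnerProductSpace ℝ E]
    [FiniteDimensional ℝ E] [MeasurableSpace E] [BorelSpace E] :
    ∃ C : NNReal, ∀ h : E → E, LocallyIntegrable h volume → ∀ Ω : Set E,
      (∀ ψ : E → ℝ, IsTest ψ → tsupport ψ ⊆ Ω → ∫ y, lap ψ y • h y = 0) →
      ∀ᵐ x, ∀ s : ℝ, 0 < s → Metric.closedBall x s ⊆ Ω →
        ‖h x‖ₑ * volume (Metric.closedBall x s) ≤ C * ∫⁻ y in Metric.closedBall x s, ‖h y‖ₑ := by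
  obtain ⟨M, hM0, hM⟩ := exists_radialBump_le (E := E)
  set m := ∫ y : E, radialBump y with hm
  have hmpos : 0 < m := integral_radialBump_pos
  set ω := volume.real (Metric.closedBall (0 : E) 1)
  refine ⟨(m⁻¹ * M * ω).toNNReal, fun h hh Ω hharm => ?_⟩
  filter_upwards [ae_smul_eq_integral_scaledBump hh hharm] with x hx s hs hsΩ
  have h1 := hx s hs hsΩ
  have h2 : ‖h x‖ₑ ≤ ENNReal.ofReal (m⁻¹ * ((s ^ Module.finrank ℝ E)⁻¹ * M)) *
      ∫⁻ y in Metric.closedBall x s, ‖h y‖ₑ := by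
    have h3 : h x = m⁻¹ • ∫ y, scaledBump s x y • h y := by
      rw [← h1, smul_smul, inv_mul_cancel₀ hmpos.ne', one_smul]
    rw [h3, enorm_smul, ENNReal.ofReal_mul (by positivity), mul_assoc,
      Real.enorm_of_nonneg (by positivity)]
    gcongr
    refine (enorm_integral_le_lintegral_enorm _).trans ?_
    rw [← lintegral_const_mul' _ _ ENNReal.ofReal_ne_top,
      ← lintegral_indicator Metric.isClosed_closedBall.measurableSet]
    refine lintegral_mono fun y => ?_
    by_cases hy : y ∈ Metric.closedBall x s
    · rw [Set.indicator_of_mem hy, enorm_smul]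
      gcongr
      rw [Real.enorm_eq_ofReal_abs]
      refine ENNReal.ofReal_le_ofReal ?_
      rw [scaledBump, abs_mul, abs_of_nonneg (by positivity), abs_of_nonneg (radialBump_nonneg _)]
      gcongr
      exact hM _
    · rw [scaledBump_eq_zero hs hy]; simp
  have h4 : volume (Metric.closedBall x s) = ENNReal.ofReal (s ^ Module.finrank ℝ E * ω) := by
    rw [Measure.addHaar_closedBall' _ _ hs.le, ENNReal.ofReal_mul (by positivity)]
    congr 1
    exact (ENNReal.ofReal_toReal (isCompact_closedBall _ _).measure_lt_top.ne).symm
  calc ‖h x‖ₑ * volume (Metric.closedBall x s)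
      ≤ (ENNReal.ofReal (m⁻¹ * ((s ^ Module.finrank ℝ E)⁻¹ * M)) *
      ∫⁻ y in Metric.closedBall x s, ‖h y‖ₑ) * ENNReal.ofReal (s ^ Module.finrank ℝ E * ω) := by
        rw [h4]; gcongr
    _ = ENNReal.ofReal (m⁻¹ * M * ω) * ∫⁻ y in Metric.closedBall x s, ‖h y‖ₑ := by
        rw [mul_right_comm, ← ENNReal.ofReal_mul (by positivity)]
        congr 2
        field_simp

end MeanValue

section LocalEstimate

variable {E : Type*} [NormedAddCommGroup E] [InnerProductSpace ℝ E] [FiniteDimensional ℝ E]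
  [MeasurableSpace E] [BorelSpace E]

lemma lintegral_enorm_sq (F : Lp E 2 (volume : Measure E)) : ∫⁻ x, ‖F x‖ₑ ^ 2 = ‖F‖ₑ ^ 2 := by
  have := eLpNorm_nnreal_pow_eq_lintegral (μ := volume) (f := F) (p := 2) (by norm_num)
  rw [Lp.enorm_def]
  simpa using this.symm

lemma lintegral_enorm_sq_gradProj_le (f : Lp E 2 (volume : Measure E)) :
    ∫⁻ x, ‖gradProj E f x‖ₑ ^ 2 ≤ ∫⁻ x, ‖f x‖ₑ ^ 2 := by
  rw [lintegral_enorm_sq, lintegral_enorm_sq]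
  gcongr
  rw [← ofReal_norm, ← ofReal_norm]
  exact ENNReal.ofReal_le_ofReal (norm_gradProj_le f)

lemma Lp.locallyIntegrable_two (f : Lp E 2 (volume : Measure E)) : LocallyIntegrable f volume :=
  (Lp.memLp f).locallyIntegrable (by norm_num)

lemma WeakCurlFree.integral_lap_smul_eq_zero {h : E → E} (hh : LocallyIntegrable h volume)
    (hc : WeakCurlFree h) {ψ : E → ℝ} (hψ : IsTest ψ)
    (h0 : ∀ v, ∫ y, ⟪h y, gradient (dirDeriv v ψ) y⟫ = 0) : ∫ y, lap ψ y • h y = 0 := by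
  refine ext_inner_left ℝ fun v => ?_
  rw [inner_zero_right, ← integral_inner (hh.integrable_smul_left_of_hasCompactSupport
    hψ.lap.continuous hψ.lap.hasCompactSupport)]
  rw [← h0 v, ← hc ψ hψ v]
  refine integral_congr_ae (.of_forall fun y => ?_)
  simp only [inner_smul_right, real_inner_comm v]
  ring

lemma integral_lap_smul_gradProj {f : Lp E 2 (volume : Measure E)} {Ω : Set E}
    (hf : ∀ᵐ x, x ∈ Ω → f x = 0) {ψ : E → ℝ} (hψ : IsTest ψ) (hs : tsupport ψ ⊆ Ω) :
    ∫ y, lap ψ y • gradProj E f y = 0 := by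
  refine (weakCurlFree_of_mem (gradProj_mem f)).integral_lap_smul_eq_zero
    (Lp.locallyIntegrable_two _) hψ fun v => ?_
  rw [integral_gradProj_inner_gradient f (hψ.dirDeriv v)]
  refine integral_eq_zero_of_ae ?_
  filter_upwards [hf] with y hy
  by_cases hyΩ : y ∈ Ω
  · simp [hy hyΩ]
  · have : fderiv ℝ (dirDeriv v ψ) y = 0 := by
      refine image_eq_zero_of_notMem_tsupport fun h => hyΩ (hs ?_)
      exact tsupport_dirDeriv_subset v ψ (tsupport_fderiv_subset ℝ h)
    simp [gradient, this]

lemma sq_setLIntegral_le {α : Type*} [MeasurableSpace α] {μ : Measure α} {u : α → ℝ≥0∞} {s : Set α}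
    (hu : AEMeasurable u (μ.restrict s)) :
    (∫⁻ x in s, u x ∂μ) ^ 2 ≤ μ s * ∫⁻ x in s, u x ^ 2 ∂μ := by
  have h := ENNReal.lintegral_mul_le_Lp_mul_Lq (μ.restrict s) Real.HolderConjugate.two_two
    (f := fun _ => 1) (g := u) aemeasurable_const hu
  simp only [Pi.mul_apply, one_mul, lintegral_const, Measure.restrict_apply,
    MeasurableSet.univ, Set.univ_inter, ENNReal.rpow_two, one_pow] at h
  calc _ ≤ (μ s ^ (1 / (2 : ℝ)) * (∫⁻ x in s, u x ^ 2 ∂μ) ^ (1 / (2 : ℝ))) ^ 2 := by gcongr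
    _ = _ := by
      rw [mul_pow, ← ENNReal.rpow_two, ← ENNReal.rpow_two, ← ENNReal.rpow_mul, ← ENNReal.rpow_mul]
      norm_num

lemma volume_closedBall_mul (x : E) {a r : ℝ} (ha : 0 ≤ a) (hr : 0 ≤ r) :
    volume (Metric.closedBall x (a * r)) =
      ENNReal.ofReal (a ^ Module.finrank ℝ E) * volume (Metric.closedBall x r) := by
  rw [Measure.addHaar_closedBall_mul _ _ ha hr, ← Measure.addHaar_closedBall_center volume x]

lemma volume_closedBall_ne_zero (x : E) {r : ℝ} (hr : 0 < r) :
    volume (Metric.closedBall x r) ≠ 0 :=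
  (Metric.measure_closedBall_pos _ _ hr).ne'

lemma volume_closedBall_ne_top (x : E) (r : ℝ) : volume (Metric.closedBall x r) ≠ ∞ :=
  (isCompact_closedBall _ _).measure_lt_top.ne

/-- Interior estimate: where the datum vanishes the projection is controlled pointwise by its
quadratic mean on a larger ball. -/
lemma exists_interior_estimate (E : Type*) [NormedAddCommGroup E] [InnerProductSpace ℝ E]
    [FiniteDimensional ℝ E] [MeasurableSpace E] [BorelSpace E] :
    ∃ C : NNReal, ∀ (f : Lp E 2 (volume : Measure E)) (x₀ : E) (R : ℝ), 0 < R →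
      (∀ᵐ x, x ∈ Metric.closedBall x₀ R → f x = 0) →
      ∀ᵐ x, x ∈ Metric.closedBall x₀ (R / 2) →
        ‖gradProj E f x‖ₑ ^ 2 * volume (Metric.closedBall x₀ R) ≤
          C * ∫⁻ y in Metric.closedBall x₀ R, ‖gradProj E f y‖ₑ ^ 2 := by
  obtain ⟨C, hC⟩ := exists_ae_enorm_mul_le_lintegral E
  refine ⟨C ^ 2 * (2 ^ Module.finrank ℝ E : NNReal), fun f x₀ R hR hf => ?_⟩
  filter_upwards [hC (gradProj E f) (Lp.locallyIntegrable_two _) (Metric.closedBall x₀ R)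
    fun ψ hψ hs => integral_lap_smul_gradProj hf hψ hs] with x hx hxR
  have hsub : Metric.closedBall x (R / 2) ⊆ Metric.closedBall x₀ R :=
    Metric.closedBall_subset_closedBall' (by rw [Metric.mem_closedBall] at hxR; linarith)
  have h1 := hx (R / 2) (by positivity) hsub
  set B := Metric.closedBall x (R / 2) with hB
  have hB0 : volume B ≠ 0 := volume_closedBall_ne_zero _ (by positivity)
  have hBt : volume B ≠ ∞ := volume_closedBall_ne_top _ _
  have hvol : volume (Metric.closedBall x₀ R) = 2 ^ Module.finrank ℝ E * volume B := by
    rw [hB, Measure.addHaar_closedBall_center volume x,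
      ← Measure.addHaar_closedBall_center volume x₀]
    have := volume_closedBall_mul x₀ (a := 2) (r := R / 2) (by norm_num) (by positivity)
    rw [mul_div_cancel₀ _ (by norm_num)] at this
    rw [this, ENNReal.ofReal_pow (by norm_num)]
    simp
  have h2 : ‖gradProj E f x‖ₑ ^ 2 * volume B ≤
      C ^ 2 * ∫⁻ y in Metric.closedBall x₀ R, ‖gradProj E f y‖ₑ ^ 2 := by
    have h3 : (‖gradProj E f x‖ₑ ^ 2 * volume B) * volume B ≤
        (C ^ 2 * ∫⁻ y in Metric.closedBall x₀ R, ‖gradProj E f y‖ₑ ^ 2) * volume B := by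
      calc (‖gradProj E f x‖ₑ ^ 2 * volume B) * volume B
          = (‖gradProj E f x‖ₑ * volume B) ^ 2 := by ring
        _ ≤ (C * ∫⁻ y in B, ‖gradProj E f y‖ₑ) ^ 2 := by gcongr
        _ = C ^ 2 * (∫⁻ y in B, ‖gradProj E f y‖ₑ) ^ 2 := by ring
        _ ≤ C ^ 2 * (volume B * ∫⁻ y in B, ‖gradProj E f y‖ₑ ^ 2) := by
          gcongr
          exact sq_setLIntegral_le (Lp.aestronglyMeasurable _).enorm.restrict
        _ ≤ C ^ 2 * (volume B * ∫⁻ y in Metric.closedBall x₀ R, ‖gradProj E f y‖ₑ ^ 2) := by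
          gcongr
        _ = _ := by ring
    rwa [ENNReal.mul_le_mul_iff_left hB0 hBt] at h3
  rw [hvol]
  calc _ = 2 ^ Module.finrank ℝ E * (‖gradProj E f x‖ₑ ^ 2 * volume B) := by ring
    _ ≤ 2 ^ Module.finrank ℝ E *
        (C ^ 2 * ∫⁻ y in Metric.closedBall x₀ R, ‖gradProj E f y‖ₑ ^ 2) := by gcongr
    _ = _ := by push_cast; ring

lemma enorm_add_sq_le {F : Type*} [NormedAddCommGroup F] (a b : F) :
    ‖a + b‖ₑ ^ 2 ≤ 2 * ‖a‖ₑ ^ 2 + 2 * ‖b‖ₑ ^ 2 := by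
  calc ‖a + b‖ₑ ^ 2 ≤ (‖a‖ₑ + ‖b‖ₑ) ^ 2 := by gcongr; exact enorm_add_le a b
    _ ≤ _ := by
      simp only [enorm_eq_nnnorm]
      norm_cast
      have := sq_nonneg (‖a‖ - ‖b‖)
      rw [← NNReal.coe_le_coe]
      push_cast
      nlinarith

/-- On a ball where the means of `|P f|²` and `|f|²` are at most `t` and `γ t`, the part of
`|P f|²` exceeding a large multiple of `t` has small mass. -/
lemma exists_local_estimate (E : Type*) [NormedAddCommGroup E] [InnerProductSpace ℝ E]
    [FiniteDimensional ℝ E] [MeasurableSpace E] [BorelSpace E] :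
    ∃ A : NNReal, 1 ≤ A ∧ ∀ (f : Lp E 2 (volume : Measure E)) (x₀ : E) (R : ℝ), 0 < R →
      ∀ γ t : ℝ≥0∞, γ ≤ 1 → t ≠ ∞ →
      ∫⁻ y in Metric.closedBall x₀ R, ‖gradProj E f y‖ₑ ^ 2 ≤ t * volume (Metric.closedBall x₀ R) →
      ∫⁻ y in Metric.closedBall x₀ R, ‖f y‖ₑ ^ 2 ≤ γ * t * volume (Metric.closedBall x₀ R) →
      ∫⁻ y in Metric.closedBall x₀ (R / 2) ∩ {y | A * t < ‖gradProj E f y‖ₑ ^ 2},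
        ‖gradProj E f y‖ₑ ^ 2 ≤ 4 * γ * t * volume (Metric.closedBall x₀ R) := by
  obtain ⟨C, hC⟩ := exists_interior_estimate E
  refine ⟨16 * C + 1, by simp, fun f x₀ R hR γ t hγ ht hg hk => ?_⟩
  set B := Metric.closedBall x₀ R with hB
  have hBm : MeasurableSet B := Metric.isClosed_closedBall.measurableSet
  have hB0 : volume B ≠ 0 := volume_closedBall_ne_zero _ (by positivity)
  have hBt : volume B ≠ ∞ := volume_closedBall_ne_top _ _
  have hm1 : MemLp (B.indicator f) 2 volume := (Lp.memLp f).indicator hBm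
  set f1 : Lp E 2 (volume : Measure E) := hm1.toLp with hf1
  have hf1e : ∀ᵐ y, f1 y = B.indicator f y := hm1.coeFn_toLp
  have hf2 : ∀ᵐ x, x ∈ B → (f - f1) x = 0 := by
    filter_upwards [hf1e, Lp.coeFn_sub f f1] with y hy hy2 hyB
    rw [hy2, Pi.sub_apply, hy, Set.indicator_of_mem hyB, sub_self]
  have hPsub : ∀ᵐ y, gradProj E (f - f1) y = gradProj E f y - gradProj E f1 y := by
    rw [map_sub]
    filter_upwards [Lp.coeFn_sub (gradProj E f) (gradProj E f1)] with y hy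
    rw [hy, Pi.sub_apply]
  have hP1 : ∫⁻ y, ‖gradProj E f1 y‖ₑ ^ 2 ≤ γ * t * volume B := by
    refine (lintegral_enorm_sq_gradProj_le f1).trans (le_trans (le_of_eq ?_) hk)
    rw [← lintegral_indicator hBm]
    refine lintegral_congr_ae ?_
    filter_upwards [hf1e] with y hy
    rw [hy]
    by_cases hyB : y ∈ B <;> simp [hyB]
  have hP2 : ∫⁻ y in B, ‖gradProj E (f - f1) y‖ₑ ^ 2 ≤ 4 * t * volume B := by
    calc ∫⁻ y in B, ‖gradProj E (f - f1) y‖ₑ ^ 2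
        ≤ ∫⁻ y in B, (2 * ‖gradProj E f y‖ₑ ^ 2 + 2 * ‖gradProj E f1 y‖ₑ ^ 2) := by
          refine lintegral_mono_ae (ae_restrict_of_ae ?_)
          filter_upwards [hPsub] with y hy
          rw [hy, sub_eq_add_neg]
          refine (enorm_add_sq_le _ _).trans ?_
          rw [enorm_neg]
      _ = 2 * (∫⁻ y in B, ‖gradProj E f y‖ₑ ^ 2) + 2 * ∫⁻ y in B, ‖gradProj E f1 y‖ₑ ^ 2 := by
          rw [lintegral_add_left', lintegral_const_mul' _ _ (by simp),
            lintegral_const_mul' _ _ (by simp)]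
          exact (((Lp.aestronglyMeasurable _).enorm.pow_const 2).const_mul 2).restrict
      _ ≤ 2 * (t * volume B) + 2 * (1 * t * volume B) := by
          gcongr
          refine (setLIntegral_le_lintegral _ _).trans (hP1.trans ?_)
          gcongr
      _ = _ := by ring
  have hpt : ∀ᵐ y, y ∈ Metric.closedBall x₀ (R / 2) → ‖gradProj E (f - f1) y‖ₑ ^ 2 ≤ 4 * C * t := by
    filter_upwards [hC (f - f1) x₀ R hR hf2] with y hy hyB
    have h1 := (hy hyB).trans (mul_le_mul_right hP2 (C : ℝ≥0∞))
    have h2 : ‖gradProj E (f - f1) y‖ₑ ^ 2 * volume B ≤ (4 * C * t) * volume B :=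
      h1.trans (le_of_eq (by ring))
    rwa [ENNReal.mul_le_mul_iff_left hB0 hBt] at h2
  have hpt2 : ∀ᵐ y, y ∈ Metric.closedBall x₀ (R / 2) ∩
      {y | ((16 * C + 1 : NNReal) : ℝ≥0∞) * t < ‖gradProj E f y‖ₑ ^ 2} →
      ‖gradProj E f y‖ₑ ^ 2 ≤ 4 * ‖gradProj E f1 y‖ₑ ^ 2 := by
    filter_upwards [hpt, hPsub] with y hy hys hyB
    have h1 := hy hyB.1
    have h2 : 16 * C * t ≤ ‖gradProj E f y‖ₑ ^ 2 := by
      refine le_trans ?_ (le_of_lt hyB.2)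
      gcongr
      push_cast
      exact le_self_add
    have h3 : ‖gradProj E f y‖ₑ ^ 2 ≤
        2 * ‖gradProj E (f - f1) y‖ₑ ^ 2 + 2 * ‖gradProj E f1 y‖ₑ ^ 2 := by
      refine le_trans (le_of_eq ?_) (enorm_add_sq_le _ _)
      rw [hys, sub_add_cancel]
    have hfin : ‖gradProj E f y‖ₑ ^ 2 ≠ ∞ := by simp
    refine ENNReal.le_of_add_le_add_right hfin ?_
    calc ‖gradProj E f y‖ₑ ^ 2 + ‖gradProj E f y‖ₑ ^ 2 = 2 * ‖gradProj E f y‖ₑ ^ 2 := by ring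
      _ ≤ 2 * (2 * (4 * C * t) + 2 * ‖gradProj E f1 y‖ₑ ^ 2) := by
        gcongr
        refine h3.trans ?_
        gcongr
      _ = 4 * ‖gradProj E f1 y‖ₑ ^ 2 + 16 * C * t := by ring
      _ ≤ _ := by gcongr
  have hS : NullMeasurableSet (Metric.closedBall x₀ (R / 2) ∩
      {y | ((16 * C + 1 : NNReal) : ℝ≥0∞) * t < ‖gradProj E f y‖ₑ ^ 2}) volume :=
    Metric.isClosed_closedBall.measurableSet.nullMeasurableSet.inter
      (nullMeasurableSet_lt aemeasurable_const ((Lp.aestronglyMeasurable _).enorm.pow_const 2))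
  calc _ ≤ ∫⁻ y in Metric.closedBall x₀ (R / 2) ∩
      {y | ((16 * C + 1 : NNReal) : ℝ≥0∞) * t < ‖gradProj E f y‖ₑ ^ 2},
        4 * ‖gradProj E f1 y‖ₑ ^ 2 := by
        exact lintegral_mono_ae ((ae_restrict_iff'₀ hS).2 hpt2)
    _ ≤ ∫⁻ y, 4 * ‖gradProj E f1 y‖ₑ ^ 2 := setLIntegral_le_lintegral _ _
    _ = 4 * ∫⁻ y, ‖gradProj E f1 y‖ₑ ^ 2 := lintegral_const_mul' _ _ (by simp)
    _ ≤ 4 * (γ * t * volume B) := by gcongr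
    _ = _ := by ring

end LocalEstimate

section GoodLambda

variable {E : Type*} [NormedAddCommGroup E] [InnerProductSpace ℝ E] [FiniteDimensional ℝ E]
  [MeasurableSpace E] [BorelSpace E]

lemma exists_radius_bound [Nontrivial E] {K : ℝ≥0∞} (hK : K ≠ ∞) :
    ∃ R₀ : ℝ, ∀ (x : E) (r : ℝ), volume (Metric.closedBall x r) < K → r ≤ R₀ := by
  have hv0 : volume (Metric.ball (0 : E) 1) ≠ 0 := (Metric.measure_ball_pos _ _ one_pos).ne'
  have hvt : volume (Metric.ball (0 : E) 1) ≠ ∞ := measure_ball_lt_top.ne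
  refine ⟨max 1 (K / volume (Metric.ball (0 : E) 1)).toReal, fun x r h => ?_⟩
  by_contra! hr
  have h1 : 1 < r := (le_max_left _ _).trans_lt hr
  have h2 : (K / volume (Metric.ball (0 : E) 1)).toReal < r := (le_max_right _ _).trans_lt hr
  have h3 : K / volume (Metric.ball (0 : E) 1) ≤ ENNReal.ofReal r := by
    rw [← ENNReal.ofReal_toReal (ENNReal.div_ne_top hK hv0)]
    exact ENNReal.ofReal_le_ofReal h2.le
  rw [Measure.addHaar_closedBall _ _ (by linarith)] at h
  refine absurd h (not_lt.2 ?_)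
  calc K = K / volume (Metric.ball (0 : E) 1) * volume (Metric.ball (0 : E) 1) :=
        (ENNReal.div_mul_cancel hv0 hvt).symm
    _ ≤ ENNReal.ofReal (r ^ Module.finrank ℝ E) * volume (Metric.ball (0 : E) 1) := by
        gcongr
        refine h3.trans (ENNReal.ofReal_le_ofReal ?_)
        exact le_self_pow₀ h1.le Module.finrank_pos.ne'

lemma ae_exists_stopping_radius [Nontrivial E] {F : E → ℝ≥0∞} (hF : AEMeasurable F volume)
    (hFi : ∫⁻ x, F x ≠ ∞) {l : ℝ≥0∞} (hl : l ≠ 0) :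
    ∃ R₀ : ℝ, ∀ᵐ x, l < F x → ∃ r, 0 < r ∧ r ≤ R₀ ∧
      l * volume (Metric.closedBall x r) < ∫⁻ y in Metric.closedBall x r, F y ∧
      ∀ R, 2 * r ≤ R →
        ∫⁻ y in Metric.closedBall x R, F y ≤ l * volume (Metric.closedBall x R) := by
  obtain ⟨R₀, hR₀⟩ := exists_radius_bound (E := E) (ENNReal.div_ne_top hFi hl)
  refine ⟨R₀, ?_⟩
  filter_upwards [(Besicovitch.vitaliFamily (volume : Measure E)).ae_tendsto_lintegral_div hF hFi]
    with x hx hlx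
  have hlt : l ≠ ∞ := hlx.ne_top
  have hx2 := hx.comp (Besicovitch.tendsto_filterAt volume x)
  set S : Set ℝ := {r | 0 < r ∧
    l * volume (Metric.closedBall x r) < ∫⁻ y in Metric.closedBall x r, F y} with hS
  have hne : S.Nonempty := by
    have h1 := hx2.eventually (lt_mem_nhds hlx)
    obtain ⟨r, hr, hr0⟩ := (h1.and self_mem_nhdsWithin).exists
    refine ⟨r, hr0, ?_⟩
    rwa [Function.comp_apply, ENNReal.lt_div_iff_mul_lt
      (.inl (volume_closedBall_ne_zero x hr0)) (.inl (volume_closedBall_ne_top x r))] at hr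
  have hbd : ∀ r ∈ S, r ≤ R₀ := by
    intro r hr
    refine hR₀ x r ?_
    rw [ENNReal.lt_div_iff_mul_lt (.inl hl) (.inl hlt), mul_comm]
    exact hr.2.trans_le (setLIntegral_le_lintegral _ _)
  have hpos : 0 < sSup S := by
    obtain ⟨r, hr⟩ := hne
    exact hr.1.trans_le (le_csSup ⟨R₀, hbd⟩ hr)
  obtain ⟨r, hr, hr2⟩ := exists_lt_of_lt_csSup hne (half_lt_self hpos)
  refine ⟨r, hr.1, hbd r hr, hr.2, fun R hR => ?_⟩
  by_contra! hcon
  have : R ≤ sSup S := le_csSup ⟨R₀, hbd⟩ ⟨by linarith [hr.1], hcon⟩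
  linarith

/-- Good-λ estimate: an estimate on balls where the mean of `F` is small integrates to an
estimate of the superlevel sets. -/
lemma setLIntegral_le_of_local_estimate [Nontrivial E] {g F : E → ℝ≥0∞} (hF : Measurable F)
    (hFi : ∫⁻ x, F x ≠ ∞) (hgF : g ≤ F) {l a δ : ℝ≥0∞} (hl : l ≠ 0) (hlt : l ≠ ∞) (ha : 1 ≤ a)
    (H : ∀ (x₀ : E) (R : ℝ), 0 < R →
      ∫⁻ y in Metric.closedBall x₀ R, F y ≤ l * volume (Metric.closedBall x₀ R) →
      ∫⁻ y in Metric.closedBall x₀ (R / 2) ∩ {y | a * l < g y}, g y ≤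
        δ * l * volume (Metric.closedBall x₀ R)) :
    ∫⁻ y in {y | a * l < g y}, g y ≤
      2 * 20 ^ Module.finrank ℝ E * δ * ∫⁻ y in {y | l / 2 < F y}, F y := by
  obtain ⟨R₀, hR₀⟩ := ae_exists_stopping_radius hF.aemeasurable hFi hl
  set T : Set E := {x | ∃ r, 0 < r ∧ r ≤ R₀ ∧
      l * volume (Metric.closedBall x r) < ∫⁻ y in Metric.closedBall x r, F y ∧
      ∀ R, 2 * r ≤ R →
        ∫⁻ y in Metric.closedBall x R, F y ≤ l * volume (Metric.closedBall x R)} with hT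
  have hex : ∀ x : E, ∃ r, x ∈ T → 0 < r ∧ r ≤ R₀ ∧
      l * volume (Metric.closedBall x r) < ∫⁻ y in Metric.closedBall x r, F y ∧
      ∀ R, 2 * r ≤ R →
        ∫⁻ y in Metric.closedBall x R, F y ≤ l * volume (Metric.closedBall x R) := by
    intro x
    by_cases hx : x ∈ T
    · obtain ⟨r, hr⟩ := hx
      exact ⟨r, fun _ => hr⟩
    · exact ⟨0, fun h => absurd h hx⟩
  choose r hr using hex
  obtain ⟨u, huT, hud, hcov⟩ := Vitali.exists_disjoint_subfamily_covering_enlargement_closedBall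
    T (fun x => x) r R₀ (fun x hx => (hr x hx).2.1) 5 (by norm_num)
  have huc : u.Countable := hud.countable_of_nonempty_interior fun x hx =>
    ⟨x, Metric.ball_subset_interior_closedBall (Metric.mem_ball_self (hr x (huT hx)).1)⟩
  have : Countable u := huc.to_subtype
  have hball : ∀ x ∈ u, ∫⁻ y in Metric.closedBall x (5 * r x) ∩ {y | a * l < g y}, g y ≤
      2 * 20 ^ Module.finrank ℝ E * δ *
        ∫⁻ y in Metric.closedBall x (r x) ∩ {y | l / 2 < F y}, F y := by
    intro x hx
    obtain ⟨h0, -, h1, h2⟩ := hr x (huT hx)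
    have h3 := H x (20 * r x) (by positivity) (h2 _ (by linarith))
    have h4 : l * volume (Metric.closedBall x (r x)) ≤
        2 * ∫⁻ y in Metric.closedBall x (r x) ∩ {y | l / 2 < F y}, F y := by
      have hm : MeasurableSet {y | l / 2 < F y} := measurableSet_lt measurable_const hF
      have h5 : ∫⁻ y in Metric.closedBall x (r x), F y ≤
          (∫⁻ y in Metric.closedBall x (r x) ∩ {y | l / 2 < F y}, F y) +
            l / 2 * volume (Metric.closedBall x (r x)) := by
        rw [← lintegral_inter_add_sdiff F (Metric.closedBall x (r x)) hm]
        gcongr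
        calc ∫⁻ y in Metric.closedBall x (r x) \ {y | l / 2 < F y}, F y
            ≤ ∫⁻ y in Metric.closedBall x (r x) \ {y | l / 2 < F y}, l / 2 :=
              setLIntegral_mono measurable_const fun y hy => not_lt.1 hy.2
          _ = l / 2 * volume (Metric.closedBall x (r x) \ {y | l / 2 < F y}) := by simp
          _ ≤ _ := by gcongr; exact Set.sdiff_subset
      have hfin : l * volume (Metric.closedBall x (r x)) ≠ ∞ :=
        ENNReal.mul_ne_top hlt (volume_closedBall_ne_top _ _)
      refine ENNReal.le_of_add_le_add_right hfin ?_
      calc l * volume (Metric.closedBall x (r x)) + l * volume (Metric.closedBall x (r x))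
          = 2 * (l * volume (Metric.closedBall x (r x))) := by ring
        _ ≤ 2 * ((∫⁻ y in Metric.closedBall x (r x) ∩ {y | l / 2 < F y}, F y) +
            l / 2 * volume (Metric.closedBall x (r x))) := by gcongr; exact h1.le.trans h5
        _ = 2 * (∫⁻ y in Metric.closedBall x (r x) ∩ {y | l / 2 < F y}, F y) +
            2 * (l / 2) * volume (Metric.closedBall x (r x)) := by ring
        _ = _ := by rw [ENNReal.mul_div_cancel (by norm_num) (by norm_num)]
    calc ∫⁻ y in Metric.closedBall x (5 * r x) ∩ {y | a * l < g y}, g y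
        ≤ ∫⁻ y in Metric.closedBall x (20 * r x / 2) ∩ {y | a * l < g y}, g y := by
          refine lintegral_mono_set (Set.inter_subset_inter_left _ ?_)
          exact Metric.closedBall_subset_closedBall (by linarith)
      _ ≤ δ * l * volume (Metric.closedBall x (20 * r x)) := h3
      _ = 20 ^ Module.finrank ℝ E * δ * (l * volume (Metric.closedBall x (r x))) := by
          rw [volume_closedBall_mul x (by norm_num) h0.le, ENNReal.ofReal_pow (by norm_num)]
          simp only [ENNReal.ofReal_ofNat]
          ring
      _ ≤ 20 ^ Module.finrank ℝ E * δ *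
          (2 * ∫⁻ y in Metric.closedBall x (r x) ∩ {y | l / 2 < F y}, F y) := by gcongr
      _ = _ := by ring
  calc ∫⁻ y in {y | a * l < g y}, g y
      ≤ ∫⁻ y in ⋃ x : u, Metric.closedBall (x : E) (5 * r x) ∩ {y | a * l < g y}, g y := by
        refine lintegral_mono' (Measure.restrict_mono' ?_ le_rfl) le_rfl
        filter_upwards [hR₀] with x hx hxg
        have hxg' : a * l < g x := hxg
        have hlx : l < F x := by
          refine lt_of_le_of_lt ?_ (hxg'.trans_le (hgF x))
          exact le_mul_of_one_le_left' ha
        obtain ⟨b, hb, hsub⟩ := hcov x (hx hlx)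
        refine Set.mem_iUnion.2 ⟨⟨b, hb⟩, hsub ?_, hxg⟩
        exact Metric.mem_closedBall_self (hr x (hx hlx)).1.le
    _ ≤ ∑' x : u, ∫⁻ y in Metric.closedBall (x : E) (5 * r x) ∩ {y | a * l < g y}, g y :=
        lintegral_iUnion_le _ _
    _ ≤ ∑' x : u, 2 * 20 ^ Module.finrank ℝ E * δ *
        ∫⁻ y in Metric.closedBall (x : E) (r x) ∩ {y | l / 2 < F y}, F y :=
        ENNReal.tsum_le_tsum fun x => hball x x.2
    _ = 2 * 20 ^ Module.finrank ℝ E * δ *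
        ∑' x : u, ∫⁻ y in Metric.closedBall (x : E) (r x) ∩ {y | l / 2 < F y}, F y :=
        ENNReal.tsum_mul_left
    _ = 2 * 20 ^ Module.finrank ℝ E * δ *
        ∫⁻ y in ⋃ x ∈ u, Metric.closedBall (x : E) (r x) ∩ {y | l / 2 < F y}, F y := by
        rw [lintegral_biUnion huc]
        · exact fun x _ => Metric.isClosed_closedBall.measurableSet.inter
            (measurableSet_lt measurable_const hF)
        · exact hud.mono fun x => Set.inter_subset_left
    _ ≤ _ := by
        gcongr
        exact Set.iUnion₂_subset fun x _ => Set.inter_subset_right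

end GoodLambda

section LargeExponents

lemma lintegral_mul_min_rpow_le {α : Type*} [MeasurableSpace α] {μ : Measure α} {G F : α → NNReal}
    (hG : Measurable G) (hF : Measurable F) {a : NNReal} (ha : a ≠ 0) {c : ℝ≥0∞} (hc : c ≠ ∞)
    (h : ∀ l : NNReal, l ≠ 0 → ∫⁻ x in {x | a * l < G x}, G x ∂μ ≤
      c * ∫⁻ x in {x | l / 2 < F x}, F x ∂μ) {θ : ℝ} (hθ : 0 < θ) (L : NNReal) :
    ∫⁻ x, G x * ((min (G x / a) L ^ θ : NNReal) : ℝ≥0∞) ∂μ ≤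
      c * ∫⁻ x, F x * ((min (2 * F x) L ^ θ : NNReal) : ℝ≥0∞) ∂μ := by
  have key : ∀ (H K : α → NNReal), Measurable H → Measurable K →
      ∫⁻ x, H x * ((K x ^ θ : NNReal) : ℝ≥0∞) ∂μ = ENNReal.ofReal θ *
        ∫⁻ t in Set.Ioi (0 : ℝ), (∫⁻ x in {x | t < K x}, H x ∂μ) * ENNReal.ofReal (t ^ (θ - 1)) := by
    intro H K hH hK
    have h1 := lintegral_rpow_eq_lintegral_meas_lt_mul (μ.withDensity fun x => (H x : ℝ≥0∞))
      (f := fun x => (K x : ℝ)) (.of_forall fun x => (K x).2) hK.coe_nnreal_real.aemeasurable hθ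
    rw [lintegral_withDensity_eq_lintegral_mul _ hH.coe_nnreal_ennreal
      (hK.coe_nnreal_real.pow_const θ).ennreal_ofReal] at h1
    convert h1 using 2
    · ext x
      rw [Pi.mul_apply, ← NNReal.coe_rpow, ENNReal.ofReal_coe_nnreal]
    · refine setLIntegral_congr_fun measurableSet_Ioi fun t _ => ?_
      rw [withDensity_apply _ (measurableSet_lt measurable_const hK.coe_nnreal_real)]
  rw [key _ _ hG ((hG.div_const a).min measurable_const),
    key _ _ hF ((hF.const_mul 2).min measurable_const), mul_left_comm, ← lintegral_const_mul' _ _ hc]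
  refine mul_le_mul_right (setLIntegral_mono' measurableSet_Ioi fun t ht => ?_) _
  rw [← mul_assoc]
  refine mul_le_mul_left ?_ _
  lift t to NNReal using le_of_lt ht
  have ht0 : t ≠ 0 := by
    rintro rfl
    exact absurd ht (by simp)
  simp only [NNReal.coe_lt_coe, lt_min_iff]
  by_cases hL : t < L
  · have h1 := h t ht0
    have e1 : ∀ x, t < G x / a ↔ a * t < G x := fun x => by
      rw [lt_div_iff₀' (pos_iff_ne_zero.2 ha)]
    have e2 : ∀ x, t < 2 * F x ↔ t / 2 < F x := fun x => by
      rw [div_lt_iff₀' (by norm_num)]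
    simpa only [hL, and_true, e1, e2] using h1
  · simp [hL]

/-- A superlevel set estimate with small constant gives a higher integrability estimate. -/
lemma lintegral_rpow_le_of_superlevel {α : Type*} [MeasurableSpace α] {μ : Measure α}
    {G K : α → NNReal} (hG : Measurable G) (hK : Measurable K) (hGi : ∫⁻ x, G x ∂μ ≠ ∞)
    {a c : NNReal} (ha : 1 ≤ a) {θ : ℝ} (hθ : 0 < θ) (hc : c * (2 * (4 * a) ^ θ) ≤ 1 / 2)
    (h : ∀ l : NNReal, l ≠ 0 → ∫⁻ x in {x | a * l < G x}, G x ∂μ ≤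
      c * ∫⁻ x in {x | l / 2 < G x + K x},
        ((G x + K x : NNReal) : ℝ≥0∞) ∂μ) :
    ∫⁻ x, ((G x ^ (1 + θ) : NNReal) : ℝ≥0∞) ∂μ ≤ ((a ^ θ * (2 * (c * (2 * 4 ^ θ))) : NNReal) : ℝ≥0∞) *
      ∫⁻ x, ((K x ^ (1 + θ) : NNReal) : ℝ≥0∞) ∂μ := by
  have ha0 : a ≠ 0 := (zero_lt_one.trans_le ha).ne'
  set Φ : NNReal → ℝ≥0∞ := fun L => ∫⁻ x, G x * ((min (G x / a) L ^ θ : NNReal) : ℝ≥0∞) ∂μ with hΦ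
  have hΦt : ∀ L, Φ L ≠ ∞ := by
    intro L
    refine ne_top_of_le_ne_top (ENNReal.mul_ne_top hGi (ENNReal.coe_ne_top (r := L ^ θ))) ?_
    rw [← lintegral_mul_const' _ _ ENNReal.coe_ne_top]
    refine lintegral_mono fun x => ?_
    gcongr
    exact min_le_right _ _
  have hpt : ∀ (L x), (G x + K x) * min (2 * (G x + K x)) L ^ θ ≤
      (2 * (4 * a) ^ θ) * (G x * min (G x / a) L ^ θ) + (2 * 4 ^ θ) * K x ^ (1 + θ) := by
    intro L x
    rcases le_total (K x) (G x) with hx | hx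
    · refine le_add_right ?_
      calc (G x + K x) * min (2 * (G x + K x)) L ^ θ
          ≤ (2 * G x) * (4 * a * min (G x / a) L) ^ θ := by
            gcongr
            · rw [two_mul]; gcongr
            · rw [mul_min]
              refine min_le_min ?_ ?_
              · calc 2 * (G x + K x) ≤ 2 * (G x + G x) := by gcongr
                  _ = 4 * (a * (G x / a)) := by rw [mul_div_cancel₀ _ ha0]; ring
                  _ = _ := by ring
              · refine le_mul_of_one_le_left' ?_
                calc (1 : NNReal) ≤ 1 * 1 := by simp
                  _ ≤ 4 * a := by gcongr; norm_num
        _ = _ := by rw [NNReal.mul_rpow]; ring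
    · refine le_add_left ?_
      calc (G x + K x) * min (2 * (G x + K x)) L ^ θ
          ≤ (2 * K x) * (4 * K x) ^ θ := by
            gcongr
            · rw [two_mul]; gcongr
            · refine (min_le_left _ _).trans ?_
              calc 2 * (G x + K x) ≤ 2 * (K x + K x) := by gcongr
                _ = _ := by ring
        _ = (2 * 4 ^ θ) * (K x * K x ^ θ) := by rw [NNReal.mul_rpow]; ring
        _ = _ := by
            rw [NNReal.rpow_one_add' (by positivity)]
  have hmain : ∀ L, Φ L ≤ 2 * (c * (2 * 4 ^ θ) : NNReal) * ∫⁻ x, ((K x ^ (1 + θ) : NNReal) : ℝ≥0∞) ∂μ := by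
    intro L
    have h1 : Φ L ≤ (c * (2 * (4 * a) ^ θ) : NNReal) * Φ L +
        (c * (2 * 4 ^ θ) : NNReal) * ∫⁻ x, ((K x ^ (1 + θ) : NNReal) : ℝ≥0∞) ∂μ := by
      refine (lintegral_mul_min_rpow_le hG (hG.add hK) ha0 ENNReal.coe_ne_top h hθ L).trans ?_
      rw [ENNReal.coe_mul, ENNReal.coe_mul c, mul_assoc, mul_assoc, ← mul_add]
      gcongr
      rw [hΦ, ← lintegral_const_mul' _ _ ENNReal.coe_ne_top,
        ← lintegral_const_mul' _ _ ENNReal.coe_ne_top, ← lintegral_add_right]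
      · refine lintegral_mono fun x => ?_
        simp only [Pi.add_apply]
        exact_mod_cast hpt L x
      · exact ((hK.pow_const _).coe_nnreal_ennreal).const_mul _
    have h2 : Φ L ≤ (1 / 2 : NNReal) * Φ L +
        (c * (2 * 4 ^ θ) : NNReal) * ∫⁻ x, ((K x ^ (1 + θ) : NNReal) : ℝ≥0∞) ∂μ := by
      refine h1.trans ?_
      gcongr
    set X := ∫⁻ x, ((K x ^ (1 + θ) : NNReal) : ℝ≥0∞) ∂μ
    refine ENNReal.le_of_add_le_add_right (hΦt L) ?_
    calc Φ L + Φ L = 2 * Φ L := by ring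
      _ ≤ 2 * ((1 / 2 : NNReal) * Φ L + (c * (2 * 4 ^ θ) : NNReal) * X) := by gcongr
      _ = ((2 * (1 / 2) : NNReal) : ℝ≥0∞) * Φ L + 2 * (c * (2 * 4 ^ θ) : NNReal) * X := by
        push_cast; ring
      _ = _ := by
        rw [mul_one_div_cancel (by norm_num)]
        simp [add_comm]
  have hlim : Filter.Tendsto (fun n : ℕ => Φ n) Filter.atTop
      (nhds (∫⁻ x, G x * (((G x / a) ^ θ : NNReal) : ℝ≥0∞) ∂μ)) := by
    refine lintegral_tendsto_of_tendsto_of_monotone (fun n => ?_) (.of_forall fun x n m hnm => ?_)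
      (.of_forall fun x => ?_)
    · exact (hG.coe_nnreal_ennreal.mul
        (((hG.div_const a).min measurable_const).pow_const θ).coe_nnreal_ennreal).aemeasurable
    · dsimp only
      gcongr
    · refine tendsto_const_nhds.congr' ?_
      obtain ⟨n, hn⟩ := exists_nat_ge (G x / a)
      filter_upwards [Filter.eventually_ge_atTop n] with m hm
      rw [min_eq_left]
      exact hn.trans (by exact_mod_cast hm)
  have h3 := le_of_tendsto' hlim fun n => hmain n
  calc ∫⁻ x, ((G x ^ (1 + θ) : NNReal) : ℝ≥0∞) ∂μ
      = (a ^ θ : NNReal) * ∫⁻ x, G x * (((G x / a) ^ θ : NNReal) : ℝ≥0∞) ∂μ := by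
        rw [← lintegral_const_mul' _ _ ENNReal.coe_ne_top]
        refine lintegral_congr fun x => ?_
        rw [NNReal.rpow_one_add' (by positivity)]
        norm_cast
        rw [mul_left_comm, ← NNReal.mul_rpow, mul_div_cancel₀ _ ha0]
    _ ≤ (a ^ θ : NNReal) * (2 * (c * (2 * 4 ^ θ) : NNReal) *
        ∫⁻ x, ((K x ^ (1 + θ) : NNReal) : ℝ≥0∞) ∂μ) := by gcongr
    _ = _ := by
        rw [ENNReal.coe_mul (a ^ θ), ENNReal.coe_mul 2]
        simp only [ENNReal.coe_ofNat]
        ring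

variable {E : Type*} [NormedAddCommGroup E] [InnerProductSpace ℝ E] [FiniteDimensional ℝ E]
  [MeasurableSpace E] [BorelSpace E]

lemma exists_setLIntegral_gradProj_le (E : Type*) [NormedAddCommGroup E] [InnerProductSpace ℝ E]
    [FiniteDimensional ℝ E] [MeasurableSpace E] [BorelSpace E] [Nontrivial E] :
    ∃ a b : NNReal, 1 ≤ a ∧ ∀ γ : NNReal, γ ≠ 0 → γ ≤ 1 → ∀ (f : Lp E 2 (volume : Measure E))
      (l : NNReal), l ≠ 0 →
      ∫⁻ y in {y | a * l < ‖gradProj E f y‖₊ ^ 2}, ((‖gradProj E f y‖₊ ^ 2 : NNReal) : ℝ≥0∞) ≤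
        (b * γ : NNReal) * ∫⁻ y in {y | l / 2 < ‖gradProj E f y‖₊ ^ 2 + ‖f y‖₊ ^ 2 / γ},
          ((‖gradProj E f y‖₊ ^ 2 + ‖f y‖₊ ^ 2 / γ : NNReal) : ℝ≥0∞) := by
  obtain ⟨a, ha, H⟩ := exists_local_estimate E
  refine ⟨a, 2 * 20 ^ Module.finrank ℝ E * 4, ha, fun γ hγ0 hγ1 f l hl => ?_⟩
  have hGm : Measurable fun y => ‖gradProj E f y‖₊ ^ 2 :=
    (Lp.stronglyMeasurable _).measurable.nnnorm.pow_const 2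
  have hKm : Measurable fun y => ‖f y‖₊ ^ 2 :=
    (Lp.stronglyMeasurable _).measurable.nnnorm.pow_const 2
  have hfin : ∀ h : Lp E 2 (volume : Measure E), ∫⁻ y, ((‖h y‖₊ ^ 2 : NNReal) : ℝ≥0∞) ≠ ∞ := by
    intro h
    have := lintegral_enorm_sq h
    simp only [enorm_eq_nnnorm] at this
    push_cast
    rw [this]
    simp
  have hhalf : ∀ r : NNReal, (l : ℝ≥0∞) / 2 < r ↔ l / 2 < r := fun r => by
    rw [← ENNReal.coe_lt_coe, ENNReal.coe_div (by norm_num), ENNReal.coe_ofNat]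
  have := setLIntegral_le_of_local_estimate (E := E) (l := l) (a := a) (δ := 4 * γ)
    (g := fun y => ((‖gradProj E f y‖₊ ^ 2 : NNReal) : ℝ≥0∞))
    (F := fun y => ((‖gradProj E f y‖₊ ^ 2 + ‖f y‖₊ ^ 2 / γ : NNReal) : ℝ≥0∞))
    (hGm.add (hKm.div_const γ)).coe_nnreal_ennreal ?_ ?_ (by simpa using hl) (by simp)
    (by exact_mod_cast ha) ?_
  · convert this using 3
    · norm_cast
    · push_cast
      ring
    · simp only [hhalf]
  · simp only [ENNReal.coe_add, div_eq_mul_inv, ENNReal.coe_mul _ γ⁻¹]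
    rw [lintegral_add_left hGm.coe_nnreal_ennreal, lintegral_mul_const' _ _ ENNReal.coe_ne_top]
    exact ENNReal.add_ne_top.2 ⟨hfin _, ENNReal.mul_ne_top (hfin _) ENNReal.coe_ne_top⟩
  · intro y
    exact ENNReal.coe_le_coe.2 le_self_add
  · intro x₀ R hR hFR
    have h1 := H f x₀ R hR γ l (by exact_mod_cast hγ1) (by simp) ?_ ?_
    · simpa [enorm_eq_nnnorm] using h1
    · refine le_trans ?_ hFR
      refine lintegral_mono fun y => ?_
      rw [enorm_eq_nnnorm]
      refine (ENNReal.coe_le_coe.2 le_self_add).trans' ?_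
      simp
    · calc ∫⁻ y in Metric.closedBall x₀ R, ‖f y‖ₑ ^ 2
          ≤ ∫⁻ y in Metric.closedBall x₀ R,
            γ * ((‖gradProj E f y‖₊ ^ 2 + ‖f y‖₊ ^ 2 / γ : NNReal) : ℝ≥0∞) := by
            refine lintegral_mono fun y => ?_
            rw [enorm_eq_nnnorm]
            rw [← ENNReal.coe_mul, mul_add, mul_div_cancel₀ _ hγ0]
            refine (ENNReal.coe_le_coe.2 le_add_self).trans' ?_
            simp
        _ ≤ γ * (l * volume (Metric.closedBall x₀ R)) := by
            rw [lintegral_const_mul' _ _ ENNReal.coe_ne_top]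
            gcongr
        _ = _ := by ring

lemma eLpNorm_ofReal_eq {α F : Type*} [MeasurableSpace α] [NormedAddCommGroup F] {μ : Measure α}
    (f : α → F) {p : ℝ} (hp : 0 < p) :
    eLpNorm f (ENNReal.ofReal p) μ = (∫⁻ x, ‖f x‖ₑ ^ p ∂μ) ^ (1 / p) := by
  rw [eLpNorm_eq_lintegral_rpow_enorm_toReal (by simpa using hp) ENNReal.ofReal_ne_top,
    ENNReal.toReal_ofReal hp.le]

/-- `L^p` bound of the Helmholtz projection for `p > 2`. -/
lemma exists_eLpNorm_gradProj_le_of_two_lt (E : Type*) [NormedAddCommGroup E]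
    [InnerProductSpace ℝ E] [FiniteDimensional ℝ E] [MeasurableSpace E] [BorelSpace E]
    [Nontrivial E] {p : ℝ} (hp : 2 < p) :
    ∃ C : NNReal, ∀ f : Lp E 2 (volume : Measure E),
      eLpNorm (gradProj E f) (ENNReal.ofReal p) volume ≤
        C * eLpNorm f (ENNReal.ofReal p) volume := by
  obtain ⟨a, b, ha, H⟩ := exists_setLIntegral_gradProj_le E
  set θ := p / 2 - 1 with hθ
  have hθ0 : 0 < θ := by rw [hθ]; linarith
  set D : NNReal := 2 * (4 * a) ^ θ with hD
  set γ : NNReal := 1 / (2 * (b + 1) * (D + 1)) with hγ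
  have hγ0 : γ ≠ 0 := by positivity
  have hγ1 : γ ≤ 1 := by
    rw [hγ]
    refine div_le_one_of_le₀ ?_ (by positivity)
    calc (1 : NNReal) = 1 * 1 * 1 := by simp
      _ ≤ _ := by gcongr <;> simp
  have hγc : b * γ * D ≤ 1 / 2 := by
    have : (b + 1) * γ * (D + 1) = 1 / 2 := by
      rw [hγ]; field_simp
    rw [← this]
    gcongr <;> simp
  set M : NNReal := a ^ θ * (2 * (b * γ * (2 * 4 ^ θ))) with hM
  set M' : NNReal := M * (γ⁻¹) ^ (1 + θ)
  refine ⟨M' ^ (1 / p), fun f => ?_⟩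
  have hGm : Measurable fun y => ‖gradProj E f y‖₊ ^ 2 :=
    (Lp.stronglyMeasurable _).measurable.nnnorm.pow_const 2
  have hKm : Measurable fun y => ‖f y‖₊ ^ 2 :=
    (Lp.stronglyMeasurable _).measurable.nnnorm.pow_const 2
  have hfin : ∫⁻ y, ((‖gradProj E f y‖₊ ^ 2 : NNReal) : ℝ≥0∞) ≠ ∞ := by
    have := lintegral_enorm_sq (gradProj E f)
    simp only [enorm_eq_nnnorm] at this
    push_cast
    rw [this]
    simp
  have h1 := lintegral_rpow_le_of_superlevel hGm (hKm.div_const γ) hfin ha hθ0 hγc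
    (H γ hγ0 hγ1 f)
  have hpow : ∀ z : E, ((‖z‖₊ ^ 2 : NNReal)) ^ (1 + θ) = ‖z‖₊ ^ p := by
    intro z
    rw [← NNReal.rpow_two, ← NNReal.rpow_mul]
    congr 1
    rw [hθ]; ring
  have hcoe : ∀ z : E, ‖z‖ₑ ^ p = ((‖z‖₊ ^ p : NNReal) : ℝ≥0∞) := fun z => by
    rw [enorm_eq_nnnorm, ENNReal.coe_rpow_of_nonneg _ (by linarith)]
  rw [eLpNorm_ofReal_eq _ (by linarith), eLpNorm_ofReal_eq _ (by linarith),
    ENNReal.coe_rpow_of_nonneg _ (by positivity), ← ENNReal.mul_rpow_of_nonneg _ _ (by positivity)]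
  gcongr
  simp only [hcoe]
  calc _ = ∫⁻ y, (((‖gradProj E f y‖₊ ^ 2) ^ (1 + θ) : NNReal) : ℝ≥0∞) := by simp only [hpow]
    _ ≤ _ := h1
    _ = _ := by
      simp only [div_eq_mul_inv, NNReal.mul_rpow, hpow]
      simp only [M', M, ENNReal.coe_mul]
      rw [lintegral_mul_const' _ _ ENNReal.coe_ne_top]
      ring

end LargeExponents

section AllExponents

variable {E : Type*} [NormedAddCommGroup E] [InnerProductSpace ℝ E] [FiniteDimensional ℝ E]
  [MeasurableSpace E] [BorelSpace E]

lemma lintegral_enorm_mul_enorm_le {α F : Type*} [MeasurableSpace α] [NormedAddCommGroup F]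
    {μ : Measure α} {u v : α → F} {p q : ℝ} (hpq : p.HolderConjugate q)
    (hu : AEStronglyMeasurable u μ) (hv : AEStronglyMeasurable v μ) :
    ∫⁻ x, ‖u x‖ₑ * ‖v x‖ₑ ∂μ ≤
      eLpNorm u (ENNReal.ofReal p) μ * eLpNorm v (ENNReal.ofReal q) μ := by
  rw [eLpNorm_ofReal_eq _ hpq.pos, eLpNorm_ofReal_eq _ hpq.symm.pos]
  exact ENNReal.lintegral_mul_le_Lp_mul_Lq μ hpq hu.enorm hv.enorm

lemma enorm_inner_le {F : Type*} [NormedAddCommGroup F] [InnerProductSpace ℝ F] (a b : F) :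
    ‖⟪a, b⟫‖ₑ ≤ ‖a‖ₑ * ‖b‖ₑ := by
  rw [← ofReal_norm, ← ofReal_norm, ← ofReal_norm, ← ENNReal.ofReal_mul (norm_nonneg _)]
  exact ENNReal.ofReal_le_ofReal (norm_inner_le_norm a b)

lemma lintegral_enorm_inner_le {α F : Type*} [MeasurableSpace α] [NormedAddCommGroup F]
    [InnerProductSpace ℝ F] {μ : Measure α} {u v : α → F} {p q : ℝ} (hpq : p.HolderConjugate q)
    (hu : AEStronglyMeasurable u μ) (hv : AEStronglyMeasurable v μ) :
    ∫⁻ x, ‖⟪u x, v x⟫‖ₑ ∂μ ≤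
      eLpNorm u (ENNReal.ofReal p) μ * eLpNorm v (ENNReal.ofReal q) μ :=
  (lintegral_mono fun _ => enorm_inner_le _ _).trans (lintegral_enorm_mul_enorm_le hpq hu hv)

lemma enorm_integral_inner_le {α F : Type*} [MeasurableSpace α] [NormedAddCommGroup F]
    [InnerProductSpace ℝ F] {μ : Measure α} {u v : α → F} {p q : ℝ} (hpq : p.HolderConjugate q)
    (hu : AEStronglyMeasurable u μ) (hv : AEStronglyMeasurable v μ) :
    ‖∫ x, ⟪u x, v x⟫ ∂μ‖ₑ ≤
      eLpNorm u (ENNReal.ofReal p) μ * eLpNorm v (ENNReal.ofReal q) μ :=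
  (enorm_integral_le_lintegral_enorm _).trans (lintegral_enorm_inner_le hpq hu hv)

lemma MeasureTheory.MemLp.integrable_inner_of_holder {α F : Type*} [MeasurableSpace α] [NormedAddCommGroup F]
    [InnerProductSpace ℝ F] {μ : Measure α} {u v : α → F} {p q : ℝ} (hpq : p.HolderConjugate q)
    (hu : MemLp u (ENNReal.ofReal p) μ) (hv : MemLp v (ENNReal.ofReal q) μ) :
    Integrable (fun x => ⟪u x, v x⟫) μ :=
  ⟨hu.1.inner hv.1, (lintegral_enorm_inner_le hpq hu.1 hv.1).trans_lt (ENNReal.mul_lt_top hu.2 hv.2)⟩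

lemma eLpNorm_gradProj_le_of_dual {p q : ℝ} (hq : 1 < q) (hq2 : q < 2) (hpq : q.HolderConjugate p)
    {C : NNReal} (hC : ∀ f : Lp E 2 (volume : Measure E),
      eLpNorm (gradProj E f) (ENNReal.ofReal p) volume ≤
        C * eLpNorm f (ENNReal.ofReal p) volume) (f : Lp E 2 (volume : Measure E)) :
    eLpNorm (gradProj E f) (ENNReal.ofReal q) volume ≤
      C * eLpNorm f (ENNReal.ofReal q) volume := by
  set h := gradProj E f with hh
  set M := C * eLpNorm f (ENNReal.ofReal q) volume with hM
  have hhm : Measurable h := (Lp.stronglyMeasurable _).measurable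
  set S : ℕ → Set E := fun n => {x | 1 / ((n : ℝ) + 1) ≤ ‖h x‖} with hS
  have hSm : ∀ n, MeasurableSet (S n) := fun n => measurableSet_le measurable_const hhm.norm
  have hbound : ∀ n, (∫⁻ x in S n, ‖h x‖ₑ ^ q) ^ (1 / q) ≤ M := by
    intro n
    set g : E → E := (S n).indicator fun x => ‖h x‖ ^ (q - 2) • h x with hg
    have hgm : Measurable g := ((hhm.norm.pow_const _).smul hhm).indicator (hSm n)
    have hg2 : MemLp g 2 volume := by
      refine MemLp.of_le_mul (c := (1 / ((n : ℝ) + 1)) ^ (q - 2)) (Lp.memLp h)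
        hgm.aestronglyMeasurable (.of_forall fun x => ?_)
      by_cases hx : x ∈ S n
      · rw [hg, Set.indicator_of_mem hx, norm_smul, Real.norm_of_nonneg (by positivity)]
        exact mul_le_mul_of_nonneg_right
          (Real.rpow_le_rpow_of_nonpos (by positivity) hx (by linarith)) (norm_nonneg _)
      · rw [hg, Set.indicator_of_notMem hx, norm_zero]
        positivity
    have hpos : ∀ x ∈ S n, 0 < ‖h x‖ := fun x hx => lt_of_lt_of_le (by positivity) hx
    have hinner : ∀ x, ⟪h x, g x⟫ = (S n).indicator (fun x => ‖h x‖ ^ q) x := by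
      intro x
      by_cases hx : x ∈ S n
      · rw [hg, Set.indicator_of_mem hx, Set.indicator_of_mem hx, inner_smul_right,
          real_inner_self_eq_norm_sq, ← Real.rpow_two, ← Real.rpow_add (hpos x hx)]
        congr 1; ring
      · simp [hg, hx]
    have hgp : ∫⁻ x, ‖g x‖ₑ ^ p = ∫⁻ x in S n, ‖h x‖ₑ ^ q := by
      rw [← lintegral_indicator (hSm n)]
      refine lintegral_congr fun x => ?_
      by_cases hx : x ∈ S n
      · rw [hg, Set.indicator_of_mem hx, Set.indicator_of_mem hx, ← ofReal_norm, ← ofReal_norm,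
          norm_smul, Real.norm_of_nonneg (by positivity), ENNReal.ofReal_rpow_of_nonneg
          (by positivity) hpq.symm.nonneg, ENNReal.ofReal_rpow_of_nonneg
          (by positivity) hpq.nonneg, ← Real.rpow_add_one (hpos x hx).ne', ← Real.rpow_mul
          (norm_nonneg _)]
        congr 2
        have := hpq.mul_eq_add
        linarith
      · simp [hg, hx, hpq.symm.pos]
    set I := ∫⁻ x in S n, ‖h x‖ₑ ^ q with hI
    have hIint : Integrable (fun x => ⟪h x, g x⟫) volume :=
      MemLp.integrable_inner_of_holder Real.HolderConjugate.two_two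
        (by simpa using Lp.memLp h) (by simpa using hg2)
    have hIe : I = ‖∫ x, ⟪h x, g x⟫‖ₑ := by
      have h0 : ∀ x, 0 ≤ ⟪h x, g x⟫ := fun x => by
        rw [hinner]; exact Set.indicator_nonneg (fun x _ => by positivity) x
      rw [← ofReal_norm, Real.norm_of_nonneg (integral_nonneg h0),
        ofReal_integral_eq_lintegral_ofReal hIint (.of_forall h0), hI,
        ← lintegral_indicator (hSm n)]
      refine lintegral_congr fun x => ?_
      rw [hinner]
      by_cases hx : x ∈ S n
      · rw [Set.indicator_of_mem hx, Set.indicator_of_mem hx, ← ofReal_norm,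
          ENNReal.ofReal_rpow_of_nonneg (by positivity) hpq.nonneg]
      · simp [hx]
    have hIt : I ≠ ∞ := by rw [hIe]; simp
    set G : Lp E 2 (volume : Measure E) := hg2.toLp with hG
    have hGe : G =ᵐ[volume] g := hg2.coeFn_toLp
    have hmain : I ≤ M * I ^ (1 / p) := by
      calc I = ‖⟪h, G⟫‖ₑ := by
            rw [hIe, L2.inner_def]
            congr 1
            refine integral_congr_ae ?_
            filter_upwards [hGe] with x hx
            rw [hx]
        _ = ‖∫ x, ⟪f x, gradProj E G x⟫‖ₑ := by
            rw [hh, inner_gradProj_comm, L2.inner_def]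
        _ ≤ eLpNorm f (ENNReal.ofReal q) volume *
              eLpNorm (gradProj E G) (ENNReal.ofReal p) volume :=
            enorm_integral_inner_le hpq (Lp.aestronglyMeasurable _) (Lp.aestronglyMeasurable _)
        _ ≤ eLpNorm f (ENNReal.ofReal q) volume * (C * eLpNorm G (ENNReal.ofReal p) volume) := by
            gcongr; exact hC G
        _ = M * I ^ (1 / p) := by
            rw [eLpNorm_congr_ae hGe, eLpNorm_ofReal_eq _ hpq.symm.pos, hgp, hM]
            ring
    by_cases hI0 : I = 0
    · rw [hI0, ENNReal.zero_rpow_of_pos (by have := hpq.pos; positivity)]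
      exact bot_le
    · have hne : I ^ (1 / p) ≠ 0 := (ENNReal.rpow_pos (pos_iff_ne_zero.2 hI0) hIt).ne'
      have hnt : I ^ (1 / p) ≠ ∞ :=
        ENNReal.rpow_ne_top_of_nonneg (by have := hpq.symm.pos; positivity) hIt
      refine (ENNReal.mul_le_mul_iff_left hne hnt).1 ?_
      rw [← ENNReal.rpow_add _ _ hI0 hIt]
      have : 1 / q + 1 / p = 1 := by simpa using hpq.inv_add_inv_eq_one
      rwa [this, ENNReal.rpow_one]
  rw [eLpNorm_ofReal_eq _ hpq.pos]
  have hmono : Monotone S := by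
    intro n m hnm x hx
    refine le_trans ?_ (show 1 / ((n : ℝ) + 1) ≤ ‖h x‖ from hx)
    gcongr
  have hU : ∫⁻ x, ‖h x‖ₑ ^ q = ∫⁻ x in ⋃ n, S n, ‖h x‖ₑ ^ q := by
    rw [← lintegral_indicator (.iUnion hSm)]
    refine lintegral_congr fun x => ?_
    by_cases hx : x ∈ ⋃ n, S n
    · rw [Set.indicator_of_mem hx]
    · rw [Set.indicator_of_notMem hx]
      have : h x = 0 := by
        by_contra hne
        obtain ⟨n, hn⟩ := exists_nat_one_div_lt (norm_pos_iff.2 hne)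
        exact hx (Set.mem_iUnion.2 ⟨n, hn.le⟩)
      simp [this, hpq.pos]
  have hM' : ∀ n, ∫⁻ x in S n, ‖h x‖ₑ ^ q ≤ M ^ q := fun n => by
    have := hbound n
    rwa [one_div, ENNReal.rpow_inv_le_iff hpq.pos] at this
  rw [hU, setLIntegral_iUnion_of_directed _ hmono.directed_le, one_div,
    ENNReal.rpow_inv_le_iff hpq.pos]
  exact iSup_le hM'

/-- `L^q` bound of the Helmholtz projection for `1 < q < ∞`. -/
lemma exists_eLpNorm_gradProj_le (E : Type*) [NormedAddCommGroup E]
    [InnerProductSpace ℝ E] [FiniteDimensional ℝ E] [MeasurableSpace E] [BorelSpace E]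
    [Nontrivial E] {q : ℝ} (hq : 1 < q) :
    ∃ C : NNReal, ∀ f : Lp E 2 (volume : Measure E),
      eLpNorm (gradProj E f) (ENNReal.ofReal q) volume ≤
        C * eLpNorm f (ENNReal.ofReal q) volume := by
  rcases lt_trichotomy q 2 with h | rfl | h
  · have hpq := Real.HolderConjugate.conjExponent hq
    obtain ⟨C, hC⟩ := exists_eLpNorm_gradProj_le_of_two_lt E (p := q.conjExponent) (by
      rw [Real.conjExponent, lt_div_iff₀ (by linarith)]; linarith)
    exact ⟨C, fun f => eLpNorm_gradProj_le_of_dual hq h hpq hC f⟩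
  · refine ⟨1, fun f => ?_⟩
    simp only [ENNReal.ofReal_ofNat, ENNReal.coe_one, one_mul, ← Lp.enorm_def]
    rw [← ofReal_norm, ← ofReal_norm]
    exact ENNReal.ofReal_le_ofReal (norm_gradProj_le f)
  · exact exists_eLpNorm_gradProj_le_of_two_lt E h

end AllExponents

section Potential

set_option linter.unusedSectionVars false

variable {E : Type*} [NormedAddCommGroup E] [InnerProductSpace ℝ E] [FiniteDimensional ℝ E]
  [MeasurableSpace E] [BorelSpace E]

lemma IsTest.enorm_sub_le {χ : E → ℝ} (h : IsTest χ) (x z : E) :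
    ‖χ (x + z) - χ x‖ₑ ≤ ∫⁻ t in Set.Ioc (0 : ℝ) 1, ‖gradient χ (x + t • z)‖ₑ * ‖z‖ₑ := by
  have hd : ∀ t : ℝ, HasDerivAt (fun t : ℝ => χ (x + t • z)) ⟪gradient χ (x + t • z), z⟫ t := by
    intro t
    rw [inner_gradient_eq]
    have h1 : HasDerivAt (fun t : ℝ => x + t • z) z t := by
      simpa using ((hasDerivAt_id t).smul_const z).const_add x
    exact (h.differentiable _).hasFDerivAt.comp_hasDerivAt t h1
  have hc : Continuous fun t : ℝ => ⟪gradient χ (x + t • z), z⟫ :=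
    (h.continuous_gradient.comp (by fun_prop)).inner continuous_const
  have h2 := intervalIntegral.integral_eq_sub_of_hasDerivAt (a := 0) (b := 1) (fun t _ => hd t)
    (hc.intervalIntegrable _ _)
  simp only [one_smul, zero_smul, add_zero] at h2
  rw [← h2, intervalIntegral.integral_of_le zero_le_one]
  exact (enorm_integral_le_lintegral_enorm _).trans (lintegral_mono fun t => enorm_inner_le _ _)

/-- Poincaré's inequality on a ball, normalised on the unit ball. -/
lemma IsTest.lintegral_lintegral_enorm_sub_le {χ : E → ℝ} (h : IsTest χ) {R : ℝ} (hR : 1 ≤ R) :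
    ∫⁻ x in Metric.closedBall 0 R, ∫⁻ y in Metric.closedBall (0 : E) 1, ‖χ y - χ x‖ₑ ≤
      volume (Metric.closedBall (0 : E) (2 * R)) * ENNReal.ofReal (2 * R) *
        ∫⁻ x in Metric.closedBall 0 (3 * R), ‖gradient χ x‖ₑ := by
  calc ∫⁻ x in Metric.closedBall 0 R, ∫⁻ y in Metric.closedBall (0 : E) 1, ‖χ y - χ x‖ₑ
      ≤ ∫⁻ x in Metric.closedBall 0 R, ∫⁻ z in Metric.closedBall (0 : E) (2 * R),
          ‖χ (x + z) - χ x‖ₑ := by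
        refine setLIntegral_mono' Metric.isClosed_closedBall.measurableSet fun x hx => ?_
        rw [← lintegral_indicator Metric.isClosed_closedBall.measurableSet,
          ← lintegral_indicator Metric.isClosed_closedBall.measurableSet,
          ← lintegral_add_left_eq_self _ x]
        refine lintegral_mono fun z => ?_
        by_cases hz : x + z ∈ Metric.closedBall (0 : E) 1
        · have hz2 : z ∈ Metric.closedBall (0 : E) (2 * R) := by
            rw [mem_closedBall_zero_iff] at *
            calc ‖z‖ = ‖(x + z) - x‖ := by simp
              _ ≤ ‖x + z‖ + ‖x‖ := norm_sub_le _ _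
              _ ≤ _ := by linarith
          rw [Set.indicator_of_mem hz, Set.indicator_of_mem hz2]
        · rw [Set.indicator_of_notMem hz]
          exact bot_le
    _ = ∫⁻ z in Metric.closedBall (0 : E) (2 * R), ∫⁻ x in Metric.closedBall 0 R,
          ‖χ (x + z) - χ x‖ₑ := by
        refine lintegral_lintegral_swap ?_
        have := h.continuous
        refine Continuous.aemeasurable ?_
        fun_prop
    _ ≤ ∫⁻ z in Metric.closedBall (0 : E) (2 * R),
          ENNReal.ofReal (2 * R) * ∫⁻ x in Metric.closedBall 0 (3 * R), ‖gradient χ x‖ₑ := by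
        refine setLIntegral_mono' Metric.isClosed_closedBall.measurableSet fun z hz => ?_
        rw [mem_closedBall_zero_iff] at hz
        have hcg := h.continuous_gradient
        calc ∫⁻ x in Metric.closedBall 0 R, ‖χ (x + z) - χ x‖ₑ
            ≤ ∫⁻ x in Metric.closedBall 0 R,
              ∫⁻ t in Set.Ioc (0 : ℝ) 1, ‖gradient χ (x + t • z)‖ₑ * ‖z‖ₑ :=
              lintegral_mono fun x => h.enorm_sub_le x z
          _ = ∫⁻ t in Set.Ioc (0 : ℝ) 1, ∫⁻ x in Metric.closedBall 0 R,
              ‖gradient χ (x + t • z)‖ₑ * ‖z‖ₑ := by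
              refine lintegral_lintegral_swap (Measurable.aemeasurable ?_)
              exact (hcg.comp (by fun_prop : Continuous fun p : E × ℝ => p.1 + p.2 • z)
                ).enorm.measurable.mul_const _
          _ ≤ ∫⁻ t in Set.Ioc (0 : ℝ) 1,
              ENNReal.ofReal (2 * R) * ∫⁻ x in Metric.closedBall 0 (3 * R), ‖gradient χ x‖ₑ := by
              refine setLIntegral_mono' measurableSet_Ioc fun t ht => ?_
              rw [lintegral_mul_const' _ _ (by simp), mul_comm]
              refine mul_le_mul' ?_ ?_
              · rw [← ofReal_norm]
                exact ENNReal.ofReal_le_ofReal hz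
              rw [← lintegral_indicator Metric.isClosed_closedBall.measurableSet,
                ← lintegral_indicator Metric.isClosed_closedBall.measurableSet,
                ← lintegral_add_right_eq_self
                  ((Metric.closedBall 0 (3 * R)).indicator fun x => ‖gradient χ x‖ₑ) (t • z)]
              refine lintegral_mono fun x => ?_
              by_cases hx : x ∈ Metric.closedBall (0 : E) R
              · rw [Set.indicator_of_mem hx, Set.indicator_of_mem]
                rw [mem_closedBall_zero_iff] at *
                refine (norm_add_le _ _).trans ?_
                rw [norm_smul, Real.norm_of_nonneg ht.1.le]
                nlinarith [ht.1, ht.2, norm_nonneg z]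
              · rw [Set.indicator_of_notMem hx]
                exact bot_le
          _ = _ := by simp
    _ = _ := by
        rw [setLIntegral_const]
        ring

lemma tendsto_integral_of_local {F : Type*} [NormedAddCommGroup F] {f : ℕ → E → F} {g : E → F}
    {a : ℕ → E → ℝ} {b : E → ℝ} {K : ℝ≥0∞} (hK : K ≠ ∞) {R : ℝ}
    (ha : ∀ n, Integrable (a n) volume) (hb : Integrable b volume)
    (hle : ∀ n x, ‖a n x - b x‖ₑ ≤ K * ‖f n x - g x‖ₑ)
    (hz : ∀ n x, x ∉ Metric.closedBall 0 R → a n x = b x)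
    (h : Filter.Tendsto (fun n => ∫⁻ x in Metric.closedBall 0 R, ‖f n x - g x‖ₑ)
      Filter.atTop (nhds 0)) :
    Filter.Tendsto (fun n => ∫ x, a n x) Filter.atTop (nhds (∫ x, b x)) := by
  refine tendsto_integral_of_L1 b hb.1 (.of_forall ha) ?_
  have h2 := ENNReal.Tendsto.const_mul (a := K) h (.inr hK)
  rw [mul_zero] at h2
  refine tendsto_of_tendsto_of_tendsto_of_le_of_le tendsto_const_nhds h2 (fun n => bot_le)
    fun n => ?_
  dsimp only
  rw [← lintegral_const_mul' _ _ hK, ← lintegral_indicator Metric.isClosed_closedBall.measurableSet]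
  refine lintegral_mono fun x => ?_
  by_cases hx : x ∈ Metric.closedBall (0 : E) R
  · rw [Set.indicator_of_mem hx]
    exact hle n x
  · rw [Set.indicator_of_notMem hx, hz n x hx]
    simp

lemma WeakGrad.of_tendsto {u : ℕ → E → ℝ} {U : ℕ → E → E} {w : E → ℝ} {W : E → E}
    (hu : ∀ n, LocallyIntegrable (u n) volume) (hU : ∀ n, LocallyIntegrable (U n) volume)
    (hw : LocallyIntegrable w volume) (hW : LocallyIntegrable W volume)
    (h : ∀ n, WeakGrad (u n) (U n))
    (huw : ∀ R, Filter.Tendsto (fun n => ∫⁻ x in Metric.closedBall 0 R, ‖u n x - w x‖ₑ)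
      Filter.atTop (nhds 0))
    (hUW : ∀ R, Filter.Tendsto (fun n => ∫⁻ x in Metric.closedBall 0 R, ‖U n x - W x‖ₑ)
      Filter.atTop (nhds 0)) : WeakGrad w W := by
  intro ψ hψ v
  have hint : ∀ {f : E → ℝ}, LocallyIntegrable f volume →
      Integrable (fun x => f x * dirDeriv v ψ x) volume := fun hf =>
    (hf.integrable_smul_left_of_hasCompactSupport (hψ.dirDeriv v).continuous
      (hψ.dirDeriv v).hasCompactSupport).congr (.of_forall fun x => mul_comm _ _)
  have bound : ∀ χ : E → ℝ, IsTest χ → ∃ K : NNReal, ∀ x, ‖χ x‖ₑ ≤ K := by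
    intro χ hχ
    obtain ⟨K, hK⟩ := hχ.hasCompactSupport.exists_bound_of_continuous hχ.continuous
    refine ⟨K.toNNReal, fun x => ?_⟩
    rw [← ofReal_norm]
    exact ENNReal.ofReal_le_ofReal (hK x)
  have supp : ∀ χ : E → ℝ, IsTest χ → ∃ R, ∀ x, x ∉ Metric.closedBall 0 R → χ x = 0 := by
    intro χ hχ
    obtain ⟨R, hR⟩ := hχ.hasCompactSupport.isCompact.isBounded.subset_closedBall 0
    exact ⟨R, fun x hx => image_eq_zero_of_notMem_tsupport fun h => hx (hR h)⟩
  have h1 : Filter.Tendsto (fun n => ∫ x, u n x * dirDeriv v ψ x) Filter.atTop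
      (nhds (∫ x, w x * dirDeriv v ψ x)) := by
    obtain ⟨K, hK⟩ := bound _ (hψ.dirDeriv v)
    obtain ⟨R, hR⟩ := supp _ (hψ.dirDeriv v)
    refine tendsto_integral_of_local (K := K) ENNReal.coe_ne_top (fun n => hint (hu n)) (hint hw)
      (fun n x => ?_) (fun n x hx => by rw [hR x hx, mul_zero, mul_zero]) (huw R)
    rw [← sub_mul, enorm_mul, mul_comm]
    gcongr
    exact hK x
  have h2 : Filter.Tendsto (fun n => ∫ x, ⟪U n x, v⟫ * ψ x) Filter.atTop
      (nhds (∫ x, ⟪W x, v⟫ * ψ x)) := by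
    obtain ⟨K, hK⟩ := bound _ hψ
    obtain ⟨R, hR⟩ := supp _ hψ
    refine tendsto_integral_of_local (K := K * ‖v‖ₑ) (ENNReal.mul_ne_top ENNReal.coe_ne_top (by simp))
      (fun n => integrable_inner_const_mul (hU n) hψ.continuous hψ.hasCompactSupport v)
      (integrable_inner_const_mul hW hψ.continuous hψ.hasCompactSupport v)
      (fun n x => ?_) (fun n x hx => by rw [hR x hx, mul_zero, mul_zero]) (hUW R)
    rw [← sub_mul, ← inner_sub_left, enorm_mul]
    calc _ ≤ (‖U n x - W x‖ₑ * ‖v‖ₑ) * K := by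
          gcongr
          · exact enorm_inner_le _ _
          · exact hK x
      _ = _ := by ring
  refine tendsto_nhds_unique h1 (h2.neg.congr fun n => ?_)
  rw [h n ψ hψ v]

lemma WeakGrad.sub_const {u : E → ℝ} {U : E → E} (hu : LocallyIntegrable u volume)
    (h : WeakGrad u U) (c : ℝ) : WeakGrad (fun x => u x - c) U := by
  intro ψ hψ v
  have hint : Integrable (fun x => u x * dirDeriv v ψ x) volume :=
    (hu.integrable_smul_left_of_hasCompactSupport (hψ.dirDeriv v).continuous
      (hψ.dirDeriv v).hasCompactSupport).congr (.of_forall fun x => mul_comm _ _)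
  have hint2 : Integrable (dirDeriv v ψ) volume :=
    (hψ.dirDeriv v).continuous.integrable_of_hasCompactSupport (hψ.dirDeriv v).hasCompactSupport
  have h0 : ∫ x, dirDeriv v ψ x = 0 := by
    have := integral_mul_fderiv_eq_neg_fderiv_mul_of_integrable (𝕜 := ℝ) (μ := (volume : Measure E))
      (f := fun _ => (1 : ℝ)) (g := ψ) (v := v) (by simp)
      (by simp only [one_mul]; exact hint2)
      (by simpa using hψ.continuous.integrable_of_hasCompactSupport hψ.hasCompactSupport)
      (fun x _ => differentiableAt_const _) (fun x _ => hψ.differentiable x)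
    simpa [dirDeriv] using this
  rw [← h ψ hψ v]
  simp only [sub_mul]
  rw [integral_sub hint (hint2.const_mul c), integral_const_mul, h0, mul_zero, sub_zero]

lemma exists_local_limit {u : ℕ → E → ℝ} (hu : ∀ n, LocallyIntegrable (u n) volume)
    (hc : ∀ R : ℝ, 1 ≤ R → ∃ b : ℕ → ℝ≥0∞, Filter.Tendsto b Filter.atTop (nhds 0) ∧
      ∀ n m, ∫⁻ x in Metric.closedBall 0 R, ‖u n x - u m x‖ₑ ≤ b n + b m) :
    ∃ w : E → ℝ, LocallyIntegrable w volume ∧ ∀ R, Filter.Tendsto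
      (fun n => ∫⁻ x in Metric.closedBall 0 R, ‖u n x - w x‖ₑ) Filter.atTop (nhds 0) := by
  have hex : ∀ j : ℕ, ∃ v : E → ℝ, StronglyMeasurable v ∧ Filter.Tendsto
      (fun n => ∫⁻ x in Metric.closedBall 0 ((j : ℝ) + 1), ‖u n x - v x‖ₑ)
      Filter.atTop (nhds 0) := by
    intro j
    set μ := volume.restrict (Metric.closedBall (0 : E) ((j : ℝ) + 1)) with hμ
    have hmem : ∀ n, MemLp (u n) 1 μ := fun n =>
      memLp_one_iff_integrable.2 ((hu n).integrableOn_isCompact (isCompact_closedBall _ _))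
    obtain ⟨b, hb0, hb⟩ := hc ((j : ℝ) + 1) (by linarith [j.cast_nonneg (α := ℝ)])
    have hcau : CauchySeq fun n => (hmem n).toLp := by
      refine EMetric.cauchySeq_iff.2 fun ε hε => ?_
      obtain ⟨N, hN⟩ := Filter.eventually_atTop.1
        (hb0.eventually (gt_mem_nhds (ENNReal.half_pos hε.ne')))
      refine ⟨N, fun n hn m hm => ?_⟩
      rw [Lp.edist_toLp_toLp, eLpNorm_one_eq_lintegral_enorm]
      exact (hb n m).trans_lt ((ENNReal.add_lt_add (hN n hn) (hN m hm)).trans_eq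
        (ENNReal.add_halves ε))
    obtain ⟨v, hv⟩ := cauchySeq_tendsto_of_complete hcau
    refine ⟨v, Lp.stronglyMeasurable v, ?_⟩
    have h1 := tendsto_iff_edist_tendsto_0.1 hv
    refine h1.congr fun n => ?_
    rw [Lp.edist_def, eLpNorm_one_eq_lintegral_enorm]
    refine lintegral_congr_ae ?_
    filter_upwards [(hmem n).coeFn_toLp] with x hx
    rw [Pi.sub_apply, hx]
  choose v hvm hv using hex
  set w : E → ℝ := fun x => v ⌈‖x‖⌉₊ x with hw
  have hwm : Measurable w := by
    have h1 : Measurable fun p : E × ℕ => v p.2 p.1 :=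
      measurable_from_prod_countable_left fun j => (hvm j).measurable
    exact h1.comp (measurable_id.prodMk (Nat.measurable_ceil.comp measurable_norm))
  have hlim : ∀ R, Filter.Tendsto
      (fun n => ∫⁻ x in Metric.closedBall 0 R, ‖u n x - w x‖ₑ) Filter.atTop (nhds 0) := by
    intro R
    have h1 : Filter.Tendsto (fun n => ∑ j ∈ Finset.range (⌈R⌉₊ + 1),
        ∫⁻ x in Metric.closedBall 0 ((j : ℝ) + 1), ‖u n x - v j x‖ₑ) Filter.atTop (nhds 0) := by
      simpa using tendsto_finsetSum (Finset.range (⌈R⌉₊ + 1)) fun j _ => hv j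
    refine tendsto_of_tendsto_of_tendsto_of_le_of_le tendsto_const_nhds h1 (fun n => bot_le)
      fun n => ?_
    dsimp only
    have hBm : ∀ r : ℝ, MeasurableSet (Metric.closedBall (0 : E) r) :=
      fun r => Metric.isClosed_closedBall.measurableSet
    have hun := (hu n).aestronglyMeasurable
    calc _ = ∫⁻ x, (Metric.closedBall 0 R).indicator (fun x => ‖u n x - w x‖ₑ) x :=
          (lintegral_indicator (hBm R) _).symm
      _ ≤ ∫⁻ x, ∑ j ∈ Finset.range (⌈R⌉₊ + 1), (Metric.closedBall 0 ((j : ℝ) + 1)).indicator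
          (fun x => ‖u n x - v j x‖ₑ) x := by
          refine lintegral_mono fun x => ?_
          by_cases hx : x ∈ Metric.closedBall (0 : E) R
          · rw [Set.indicator_of_mem hx]
            rw [mem_closedBall_zero_iff] at hx
            have hmem : ⌈‖x‖⌉₊ ∈ Finset.range (⌈R⌉₊ + 1) :=
              Finset.mem_range.2 (Nat.lt_succ_of_le (Nat.ceil_mono hx))
            refine le_trans ?_ (Finset.single_le_sum (fun _ _ => bot_le) hmem)
            rw [Set.indicator_of_mem]
            rw [mem_closedBall_zero_iff]
            linarith [Nat.le_ceil ‖x‖]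
          · rw [Set.indicator_of_notMem hx]
            exact bot_le
      _ = _ := by
          rw [lintegral_finsetSum']
          · exact Finset.sum_congr rfl fun j _ => lintegral_indicator (hBm _) _
          · exact fun j _ => ((hun.sub (hvm j).aestronglyMeasurable).enorm.indicator (hBm _))
  refine ⟨w, ?_, hlim⟩
  refine locallyIntegrable_iff.2 fun k hk => ?_
  obtain ⟨R, hR⟩ := hk.isBounded.subset_closedBall 0
  refine IntegrableOn.mono_set ?_ hR
  obtain ⟨n, hn⟩ := ((hlim R).eventually (gt_mem_nhds zero_lt_one)).exists
  have h1 : Integrable (fun x => u n x - w x) (volume.restrict (Metric.closedBall 0 R)) :=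
    ⟨((hu n).aestronglyMeasurable.sub hwm.aestronglyMeasurable).restrict,
      hn.trans (by simp)⟩
  refine (((hu n).integrableOn_isCompact (isCompact_closedBall 0 R)).sub h1).congr
    (.of_forall fun x => ?_)
  simp

/-- Limits of smooth gradients in `L¹_loc` are weak gradients. -/
lemma exists_weakGrad_of_tendsto {W : E → E} (hW : LocallyIntegrable W volume) {ψ : ℕ → E → ℝ}
    (hψ : ∀ n, IsTest (ψ n))
    (h : ∀ R, Filter.Tendsto (fun n => ∫⁻ x in Metric.closedBall 0 R, ‖gradient (ψ n) x - W x‖ₑ)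
      Filter.atTop (nhds 0)) : ∃ w, LocallyIntegrable w volume ∧ WeakGrad w W := by
  set B := Metric.closedBall (0 : E) 1 with hB
  set u : ℕ → E → ℝ := fun n x => ψ n x - ⨍ y in B, ψ n y with hu
  have huc : ∀ n, Continuous (u n) := fun n => (hψ n).continuous.sub continuous_const
  have hGi : ∀ n, LocallyIntegrable (gradient (ψ n)) volume := fun n =>
    (hψ n).continuous_gradient.locallyIntegrable
  have hB0 : volume B ≠ 0 := volume_closedBall_ne_zero _ one_pos
  have hBt : volume B ≠ ∞ := volume_closedBall_ne_top _ _
  have hpoin : ∀ (n m : ℕ) (R : ℝ), 1 ≤ R → ∫⁻ x in Metric.closedBall 0 R, ‖u n x - u m x‖ₑ ≤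
      (volume B)⁻¹ * (volume (Metric.closedBall (0 : E) (2 * R)) * ENNReal.ofReal (2 * R)) *
        ∫⁻ x in Metric.closedBall 0 (3 * R), ‖gradient (ψ n) x - gradient (ψ m) x‖ₑ := by
    intro n m R hR
    have hχ : IsTest (ψ n + (-1 : ℝ) • ψ m) := (hψ n).add ((hψ m).const_smul _)
    have hgr : ∀ x, gradient (ψ n + (-1 : ℝ) • ψ m) x = gradient (ψ n) x - gradient (ψ m) x := by
      intro x
      rw [gradient_add' (hψ n) ((hψ m).const_smul _), gradient_const_smul' (hψ m)]
      simp [sub_eq_add_neg]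
    have h1 := hχ.lintegral_lintegral_enorm_sub_le hR
    simp only [hgr] at h1
    refine le_trans ?_ ((mul_le_mul_right h1 (volume B)⁻¹).trans (le_of_eq (by ring)))
    rw [← lintegral_const_mul' _ _ (ENNReal.inv_ne_top.2 hB0)]
    refine lintegral_mono fun x => ?_
    set χ := ψ n + (-1 : ℝ) • ψ m with hχd
    have hi : ∀ k, IntegrableOn (ψ k) B volume := fun k =>
      (hψ k).continuous.locallyIntegrable.integrableOn_isCompact (isCompact_closedBall _ _)
    have hiχ : IntegrableOn χ B volume :=
      hχ.continuous.locallyIntegrable.integrableOn_isCompact (isCompact_closedBall _ _)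
    have hBp : 0 < volume.real B := ENNReal.toReal_pos hB0 hBt
    have hav : u n x - u m x = ⨍ y in B, (χ x - χ y) := by
      have e1 : ⨍ y in B, (χ x - χ y) = χ x - ⨍ y in B, χ y := by
        simp only [setAverage_eq]
        have hic : Integrable (fun _ : E => χ x) (volume.restrict B) := integrableOn_const hBt
        rw [integral_sub hic hiχ, setIntegral_const, smul_sub, smul_smul,
          inv_mul_cancel₀ hBp.ne', one_smul]
      have e2 : ⨍ y in B, χ y = (⨍ y in B, ψ n y) - ⨍ y in B, ψ m y := by
        simp only [setAverage_eq]
        rw [← smul_sub, ← integral_sub (hi n) (hi m)]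
        simp [hχd, sub_eq_add_neg]
      rw [e1, e2]
      simp [hu, hχd]
      ring
    rw [hav, setAverage_eq, enorm_smul]
    refine mul_le_mul' (le_of_eq ?_) ?_
    · rw [← ofReal_norm, norm_inv, Real.norm_of_nonneg measureReal_nonneg,
        ENNReal.ofReal_inv_of_pos hBp, ofReal_measureReal hBt]
    · refine (enorm_integral_le_lintegral_enorm _).trans (lintegral_mono fun y => ?_)
      rw [← enorm_neg, neg_sub]
  obtain ⟨w, hw, hlim⟩ := exists_local_limit (u := u) (fun n => (huc n).locallyIntegrable) (by
    intro R hR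
    set K := (volume B)⁻¹ * (volume (Metric.closedBall (0 : E) (2 * R)) * ENNReal.ofReal (2 * R))
      with hK
    have hKt : K ≠ ∞ := ENNReal.mul_ne_top (ENNReal.inv_ne_top.2 hB0)
      (ENNReal.mul_ne_top (volume_closedBall_ne_top _ _) ENNReal.ofReal_ne_top)
    refine ⟨fun n => K * ∫⁻ x in Metric.closedBall 0 (3 * R), ‖gradient (ψ n) x - W x‖ₑ, ?_,
      fun n m => (hpoin n m R hR).trans ?_⟩
    · simpa using ENNReal.Tendsto.const_mul (a := K) (h (3 * R)) (.inr hKt)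
    · have hm : AEMeasurable (fun x => ‖gradient (ψ n) x - W x‖ₑ)
          (volume.restrict (Metric.closedBall (0 : E) (3 * R))) :=
        ((hGi n).aestronglyMeasurable.sub hW.aestronglyMeasurable).enorm.restrict
      dsimp only
      rw [← mul_add, ← lintegral_add_left' hm]
      refine mul_le_mul_right (lintegral_mono fun x => ?_) _
      calc ‖gradient (ψ n) x - gradient (ψ m) x‖ₑ
          = ‖(gradient (ψ n) x - W x) - (gradient (ψ m) x - W x)‖ₑ := by simp
        _ ≤ _ := enorm_sub_le)
  exact ⟨w, hw, WeakGrad.of_tendsto (fun n => (huc n).locallyIntegrable) hGi hw hW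
    (fun n => (hψ n).weakGrad.sub_const (hψ n).continuous.locallyIntegrable _) hlim h⟩

end Potential

section WholeSpace

set_option linter.unusedSectionVars false

variable {E : Type*} [NormedAddCommGroup E] [InnerProductSpace ℝ E] [FiniteDimensional ℝ E]
  [MeasurableSpace E] [BorelSpace E]

/-- `φ` is locally integrable with weak gradient `V` in `L^p`. -/
structure IsPair (p : ℝ) (φ : E → ℝ) (V : E → E) : Prop where
  locallyIntegrable : LocallyIntegrable φ volume
  memLp : MemLp V (ENNReal.ofReal p) volume
  weakGrad : WeakGrad φ V

lemma integrable_mul_isTest {φ ψ : E → ℝ} (hφ : LocallyIntegrable φ volume) (hψ : IsTest ψ) :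
    Integrable (fun x => φ x * ψ x) volume :=
  (hφ.integrable_smul_left_of_hasCompactSupport hψ.continuous hψ.hasCompactSupport).congr
    (.of_forall fun _ => mul_comm _ _)

lemma MeasureTheory.MemLp.locallyIntegrable_ofReal {F : Type*} [NormedAddCommGroup F] {V : E → F}
    {p : ℝ} (hp : 1 ≤ p) (hV : MemLp V (ENNReal.ofReal p) volume) : LocallyIntegrable V volume :=
  hV.locallyIntegrable (by simpa using hp)

lemma IsPair.add {p : ℝ} (hp : 1 ≤ p) {φ χ : E → ℝ} {V X : E → E} (h : IsPair p φ V)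
    (h' : IsPair p χ X) : IsPair p (fun x => φ x + χ x) (fun x => V x + X x) where
  locallyIntegrable := h.locallyIntegrable.add h'.locallyIntegrable
  memLp := h.memLp.add h'.memLp
  weakGrad ψ hψ v := by
    simp only [add_mul, inner_add_left]
    rw [integral_add (integrable_mul_isTest h.locallyIntegrable (hψ.dirDeriv v))
        (integrable_mul_isTest h'.locallyIntegrable (hψ.dirDeriv v)),
      integral_add (integrable_inner_const_mul (h.memLp.locallyIntegrable_ofReal hp)
        hψ.continuous hψ.hasCompactSupport v)
        (integrable_inner_const_mul (h'.memLp.locallyIntegrable_ofReal hp)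
        hψ.continuous hψ.hasCompactSupport v), h.weakGrad ψ hψ v, h'.weakGrad ψ hψ v]
    ring

lemma IsPair.const_smul {p : ℝ} {φ : E → ℝ} {V : E → E} (h : IsPair p φ V) (c : ℝ) :
    IsPair p (fun x => c * φ x) (fun x => c • V x) where
  locallyIntegrable := h.locallyIntegrable.smul c
  memLp := h.memLp.const_smul c
  weakGrad ψ hψ v := by
    simp only [mul_assoc, real_inner_smul_left, integral_const_mul]
    rw [h.weakGrad ψ hψ v]
    ring

lemma IsPair.sub {p : ℝ} (hp : 1 ≤ p) {φ χ : E → ℝ} {V X : E → E} (h : IsPair p φ V)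
    (h' : IsPair p χ X) : IsPair p (fun x => φ x - χ x) (fun x => V x - X x) := by
  simpa [sub_eq_add_neg] using h.add hp (h'.const_smul (-1))

lemma tendsto_integral_inner {p q : ℝ} (hpq : p.HolderConjugate q) {u : ℕ → E → E} {u' : E → E}
    {v : ℕ → E → E} {v' : E → E}
    (hu : ∀ n, MemLp (u n) (ENNReal.ofReal p) volume) (hu' : MemLp u' (ENNReal.ofReal p) volume)
    (hv : ∀ n, MemLp (v n) (ENNReal.ofReal q) volume) (hv' : MemLp v' (ENNReal.ofReal q) volume)
    (h1 : Filter.Tendsto (fun n => eLpNorm (u n - u') (ENNReal.ofReal p) volume)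
      Filter.atTop (nhds 0))
    (h2 : Filter.Tendsto (fun n => eLpNorm (v n - v') (ENNReal.ofReal q) volume)
      Filter.atTop (nhds 0)) :
    Filter.Tendsto (fun n => ∫ x, ⟪u n x, v n x⟫) Filter.atTop (nhds (∫ x, ⟪u' x, v' x⟫)) := by
  have hq1 : 1 ≤ ENNReal.ofReal q := by simpa using hpq.symm.lt.le
  have hlim : Filter.Tendsto (fun n => eLpNorm (u n - u') (ENNReal.ofReal p) volume *
      (eLpNorm (v n - v') (ENNReal.ofReal q) volume + eLpNorm v' (ENNReal.ofReal q) volume) +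
      eLpNorm u' (ENNReal.ofReal p) volume * eLpNorm (v n - v') (ENNReal.ofReal q) volume)
      Filter.atTop (nhds 0) := by
    have h3 := ENNReal.Tendsto.mul h1 (.inr (by simpa using hv'.2.ne))
      (h2.add_const (eLpNorm v' (ENNReal.ofReal q) volume)) (.inr (by simp))
    have h4 := ENNReal.Tendsto.const_mul h2 (.inr hu'.2.ne)
    simpa using h3.add h4
  rw [tendsto_iff_edist_tendsto_0]
  refine tendsto_of_tendsto_of_tendsto_of_le_of_le tendsto_const_nhds hlim (fun n => bot_le)
    fun n => ?_
  have e : (∫ x, ⟪u n x, v n x⟫) - ∫ x, ⟪u' x, v' x⟫ =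
      (∫ x, ⟪(u n - u') x, v n x⟫) + ∫ x, ⟪u' x, (v n - v') x⟫ := by
    rw [← integral_sub (MemLp.integrable_inner_of_holder hpq (hu n) (hv n))
      (MemLp.integrable_inner_of_holder hpq hu' hv'),
      ← integral_add (MemLp.integrable_inner_of_holder hpq ((hu n).sub hu') (hv n))
      (MemLp.integrable_inner_of_holder hpq hu' ((hv n).sub hv'))]
    refine integral_congr_ae (.of_forall fun x => ?_)
    simp [inner_sub_left, inner_sub_right]
  dsimp only
  rw [edist_eq_enorm_sub, e]
  refine (enorm_add_le _ _).trans (add_le_add ?_ ?_)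
  · refine (enorm_integral_inner_le hpq ((hu n).sub hu').1 (hv n).1).trans
      (mul_le_mul_right ?_ _)
    have := eLpNorm_add_le ((hv n).sub hv').1 hv'.1 hq1
    simpa using this
  · exact enorm_integral_inner_le hpq hu'.1 ((hv n).sub hv').1

lemma setLIntegral_enorm_le {F : Type*} [NormedAddCommGroup F] {f : E → F} {q : ℝ≥0∞}
    (hq : 1 ≤ q) (hf : AEStronglyMeasurable f volume) (s : Set E) :
    ∫⁻ x in s, ‖f x‖ₑ ≤ eLpNorm f q volume * volume s ^ (1 - 1 / q.toReal) := by
  have := eLpNorm_le_eLpNorm_mul_rpow_measure_univ hq (μ := volume.restrict s) hf.restrict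
  rw [eLpNorm_one_eq_lintegral_enorm, Measure.restrict_apply_univ] at this
  simp only [ENNReal.toReal_one, div_one] at this
  exact this.trans (mul_le_mul_left (eLpNorm_mono_measure _ Measure.restrict_le_self) _)

lemma tendsto_setLIntegral_enorm {F : Type*} [NormedAddCommGroup F] {f : ℕ → E → F} {q : ℝ≥0∞}
    (hq : 1 ≤ q) (hf : ∀ n, AEStronglyMeasurable (f n) volume)
    (h : Filter.Tendsto (fun n => eLpNorm (f n) q volume) Filter.atTop (nhds 0)) (R : ℝ) :
    Filter.Tendsto (fun n => ∫⁻ x in Metric.closedBall 0 R, ‖f n x‖ₑ) Filter.atTop (nhds 0) := by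
  have h1 : 0 ≤ 1 - 1 / q.toReal := by
    rcases eq_or_ne q ∞ with rfl | hq'
    · simp
    · have : 1 ≤ q.toReal := by
        rwa [← ENNReal.toReal_one, ENNReal.toReal_le_toReal ENNReal.one_ne_top hq']
      rw [sub_nonneg, div_le_one (by linarith)]
      exact this
  have h2 := ENNReal.Tendsto.mul_const
    (b := volume (Metric.closedBall (0 : E) R) ^ (1 - 1 / q.toReal)) h
    (.inr (ENNReal.rpow_ne_top_of_nonneg h1 (volume_closedBall_ne_top _ _)))
  rw [zero_mul] at h2
  exact tendsto_of_tendsto_of_tendsto_of_le_of_le tendsto_const_nhds h2 (fun n => bot_le)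
    fun n => setLIntegral_enorm_le hq (hf n) _

/-- Continuous extension of the Helmholtz projection to `L^q`. -/
lemma exists_gradProj_extension (E : Type*) [NormedAddCommGroup E]
    [InnerProductSpace ℝ E] [FiniteDimensional ℝ E] [MeasurableSpace E] [BorelSpace E]
    [Nontrivial E] {q : ℝ} (hq : 1 < q) :
    ∃ C : NNReal, ∀ f : E → E, MemLp f (ENNReal.ofReal q) volume →
      ∃ (F : ℕ → Lp E 2 (volume : Measure E)) (W : E → E), MemLp W (ENNReal.ofReal q) volume ∧
        eLpNorm W (ENNReal.ofReal q) volume ≤ C * eLpNorm f (ENNReal.ofReal q) volume ∧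
        (∀ n, MemLp (F n) (ENNReal.ofReal q) volume) ∧
        (∀ n, MemLp (gradProj E (F n)) (ENNReal.ofReal q) volume) ∧
        Filter.Tendsto (fun n => eLpNorm (F n - f : E → E) (ENNReal.ofReal q) volume)
          Filter.atTop (nhds 0) ∧
        Filter.Tendsto (fun n => eLpNorm (gradProj E (F n) - W : E → E) (ENNReal.ofReal q) volume)
          Filter.atTop (nhds 0) := by
  obtain ⟨C, hC⟩ := exists_eLpNorm_gradProj_le E hq
  have hq1 : 1 ≤ ENNReal.ofReal q := by simpa using hq.le
  have : Fact (1 ≤ ENNReal.ofReal q) := ⟨hq1⟩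
  refine ⟨C, fun f hf => ?_⟩
  have hex : ∀ n : ℕ, ∃ G : Lp E 2 (volume : Measure E), MemLp G (ENNReal.ofReal q) volume ∧
      eLpNorm (G - f : E → E) (ENNReal.ofReal q) volume ≤ ((n : ℝ≥0∞) + 1)⁻¹ := by
    intro n
    obtain ⟨g, hgs, hg, hgc, hgm⟩ := hf.exists_hasCompactSupport_eLpNorm_sub_le
      ENNReal.ofReal_ne_top (ε := ((n : ℝ≥0∞) + 1)⁻¹) (by simp)
    have hg2 : MemLp g 2 (volume : Measure E) := hgc.memLp_of_hasCompactSupport hgs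
    refine ⟨hg2.toLp, hgm.ae_eq hg2.coeFn_toLp.symm, ?_⟩
    rw [eLpNorm_congr_ae (hg2.coeFn_toLp.sub (Filter.EventuallyEq.refl _ f)), eLpNorm_sub_comm]
    exact hg
  choose F hF hFf using hex
  have hinv : Filter.Tendsto (fun n : ℕ => ((n : ℝ≥0∞) + 1)⁻¹) Filter.atTop (nhds 0) := by
    have := (ENNReal.tendsto_inv_nat_nhds_zero).comp (Filter.tendsto_add_atTop_nat 1)
    simpa [Function.comp_def] using this
  have hFlim : Filter.Tendsto (fun n => eLpNorm (F n - f : E → E) (ENNReal.ofReal q) volume)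
      Filter.atTop (nhds 0) :=
    tendsto_of_tendsto_of_tendsto_of_le_of_le tendsto_const_nhds hinv (fun n => bot_le) hFf
  have hP : ∀ n, MemLp (gradProj E (F n)) (ENNReal.ofReal q) volume := fun n =>
    ⟨Lp.aestronglyMeasurable _, (hC _).trans_lt (ENNReal.mul_lt_top ENNReal.coe_lt_top (hF n).2)⟩
  have hdiff : ∀ n m, edist (hP n).toLp (hP m).toLp ≤ C *
      (eLpNorm (F n - f : E → E) (ENNReal.ofReal q) volume +
        eLpNorm (F m - f : E → E) (ENNReal.ofReal q) volume) := by
    intro n m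
    rw [Lp.edist_toLp_toLp]
    have e1 : eLpNorm (gradProj E (F n) - gradProj E (F m) : E → E) (ENNReal.ofReal q) volume =
        eLpNorm (gradProj E (F n - F m)) (ENNReal.ofReal q) volume := by
      rw [map_sub]
      exact eLpNorm_congr_ae (Lp.coeFn_sub _ _).symm
    rw [e1]
    refine (hC _).trans (mul_le_mul_right ?_ _)
    rw [eLpNorm_congr_ae (Lp.coeFn_sub _ _)]
    have := eLpNorm_sub_le ((hF n).sub hf).1 ((hF m).sub hf).1 hq1
    simpa using this
  have hcau : CauchySeq fun n => (hP n).toLp := by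
    refine EMetric.cauchySeq_iff.2 fun ε hε => ?_
    have hlim := ENNReal.Tendsto.const_mul (a := (C : ℝ≥0∞)) hFlim (.inr ENNReal.coe_ne_top)
    rw [mul_zero] at hlim
    obtain ⟨N, hN⟩ := Filter.eventually_atTop.1
      (hlim.eventually (gt_mem_nhds (ENNReal.half_pos hε.ne')))
    refine ⟨N, fun n hn m hm => (hdiff n m).trans_lt ?_⟩
    rw [mul_add]
    exact (ENNReal.add_lt_add (hN n hn) (hN m hm)).trans_eq (ENNReal.add_halves ε)
  obtain ⟨W, hW⟩ := cauchySeq_tendsto_of_complete hcau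
  have hWlim : Filter.Tendsto (fun n => eLpNorm (gradProj E (F n) - W : E → E)
      (ENNReal.ofReal q) volume) Filter.atTop (nhds 0) := by
    refine (tendsto_iff_edist_tendsto_0.1 hW).congr fun n => ?_
    rw [Lp.edist_def]
    exact eLpNorm_congr_ae ((hP n).coeFn_toLp.sub (Filter.EventuallyEq.refl _ _))
  refine ⟨F, W, Lp.memLp W, ?_, hF, hP, hFlim, hWlim⟩
  have hlim : Filter.Tendsto (fun n => C * (eLpNorm (F n - f : E → E) (ENNReal.ofReal q) volume +
      eLpNorm f (ENNReal.ofReal q) volume) +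
      eLpNorm (gradProj E (F n) - W : E → E) (ENNReal.ofReal q) volume) Filter.atTop
      (nhds (C * eLpNorm f (ENNReal.ofReal q) volume)) := by
    have h1 := ENNReal.Tendsto.const_mul (a := (C : ℝ≥0∞))
      (hFlim.add_const (eLpNorm f (ENNReal.ofReal q) volume)) (.inr ENNReal.coe_ne_top)
    simpa using h1.add hWlim
  refine ge_of_tendsto' hlim fun n => ?_
  have h1 := eLpNorm_sub_le (hP n).1 ((hP n).sub (Lp.memLp W)).1 hq1
  rw [sub_sub_cancel] at h1
  refine h1.trans (add_le_add ((hC _).trans (mul_le_mul_right ?_ _)) le_rfl)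
  have := eLpNorm_add_le ((hF n).sub hf).1 hf.1 hq1
  simpa using this

lemma exists_potential_of_tendsto_gradProj {q : ℝ} (hq : 1 < q)
    {F : ℕ → Lp E 2 (volume : Measure E)} {W : E → E} (hW : MemLp W (ENNReal.ofReal q) volume)
    (h : Filter.Tendsto (fun n => eLpNorm (gradProj E (F n) - W : E → E) (ENNReal.ofReal q) volume)
          Filter.atTop (nhds 0)) : ∃ w, IsPair q w W := by
  have hex : ∀ n : ℕ, ∃ ψ : E → ℝ, IsTest ψ ∧
      eLpNorm (gradProj E (F n) - gradient ψ : E → E) 2 volume ≤ ((n : ℝ≥0∞) + 1)⁻¹ := by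
    intro n
    obtain ⟨G, ⟨ψ, hψ, hG⟩, hd⟩ := EMetric.mem_closure_iff.1
      (show gradProj E (F n) ∈ closure (testGradients E : Set (Lp E 2 volume)) from
        gradProj_mem (F n)) ((n : ℝ≥0∞) + 1)⁻¹ (by simp)
    refine ⟨ψ, hψ, ?_⟩
    rw [Lp.edist_def, eLpNorm_congr_ae ((Filter.EventuallyEq.refl _ _).sub hG)] at hd
    exact hd.le
  choose ψ hψ hψF using hex
  have hinv : Filter.Tendsto (fun n : ℕ => ((n : ℝ≥0∞) + 1)⁻¹) Filter.atTop (nhds 0) := by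
    have := (ENNReal.tendsto_inv_nat_nhds_zero).comp (Filter.tendsto_add_atTop_nat 1)
    simpa [Function.comp_def] using this
  have hlim := tendsto_of_tendsto_of_tendsto_of_le_of_le tendsto_const_nhds hinv
    (fun n => bot_le) hψF
  have hWl := hW.locallyIntegrable_ofReal hq.le
  have hm1 : ∀ n, AEStronglyMeasurable (gradProj E (F n) - gradient (ψ n) : E → E) volume :=
    fun n => (Lp.aestronglyMeasurable _).sub (hψ n).continuous_gradient.aestronglyMeasurable
  have hm2 : ∀ n, AEStronglyMeasurable (gradProj E (F n) - W : E → E) volume :=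
    fun n => (Lp.aestronglyMeasurable _).sub hW.1
  obtain ⟨w, hw, hwW⟩ := exists_weakGrad_of_tendsto hWl hψ fun R => by
    have h1 := tendsto_setLIntegral_enorm (by norm_num) hm1 hlim R
    have h2 := tendsto_setLIntegral_enorm (by simpa using hq.le) hm2 h R
    have h3 := h1.add h2
    rw [add_zero] at h3
    refine tendsto_of_tendsto_of_tendsto_of_le_of_le tendsto_const_nhds h3 (fun n => bot_le)
      fun n => ?_
    dsimp only
    rw [← lintegral_add_left' (hm1 n).enorm.restrict]
    refine lintegral_mono fun x => ?_
    calc ‖gradient (ψ n) x - W x‖ₑ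
        = ‖(gradProj E (F n) - W : E → E) x -
            (gradProj E (F n) - gradient (ψ n) : E → E) x‖ₑ := by simp
      _ ≤ _ := by rw [add_comm]; exact enorm_sub_le
  exact ⟨w, hw, hW, hwW⟩

end WholeSpace

section WholeSpaceSolution

set_option linter.unusedSectionVars false

variable {E : Type*} [NormedAddCommGroup E] [InnerProductSpace ℝ E] [FiniteDimensional ℝ E]
  [MeasurableSpace E] [BorelSpace E]

lemma tendsto_volume_closedBall_atTop [Nontrivial E] (x : E) :
    Filter.Tendsto (fun n : ℕ => volume (Metric.closedBall x (n : ℝ))) Filter.atTop (nhds ∞) := by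
  have : NoncompactSpace E := NormedSpace.noncompactSpace ℝ E
  have h := tendsto_measure_iUnion_atTop (μ := (volume : Measure E))
    (s := fun n : ℕ => Metric.closedBall x (n : ℝ))
    (fun n m hnm => Metric.closedBall_subset_closedBall (by exact_mod_cast hnm))
  rwa [Metric.iUnion_closedBall_nat, measure_univ_of_isAddLeftInvariant] at h

/-- A harmonic `L^p` vector field on the whole space vanishes. -/
lemma ae_eq_zero_of_integral_lap_smul [Nontrivial E] {p : ℝ} (hp : 1 ≤ p) {h : E → E}
    (hm : MemLp h (ENNReal.ofReal p) volume)
    (h0 : ∀ ψ : E → ℝ, IsTest ψ → ∫ y, lap ψ y • h y = 0) : h =ᵐ[volume] 0 := by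
  obtain ⟨C, hC⟩ := exists_ae_enorm_mul_le_lintegral E
  have hp0 : 0 < p := by linarith
  filter_upwards [hC h (hm.locallyIntegrable_ofReal hp) Set.univ fun ψ hψ _ => h0 ψ hψ] with x hx
  set M := C * eLpNorm h (ENNReal.ofReal p) volume with hM
  have hMt : M ≠ ∞ := ENNReal.mul_ne_top ENNReal.coe_ne_top hm.2.ne
  by_contra hne
  have hx0 : ‖h x‖ₑ ≠ 0 := by simpa using hne
  have hbound : ∀ n : ℕ, ‖h x‖ₑ * volume (Metric.closedBall x ((n + 1 : ℕ) : ℝ)) ^ (1 / p) ≤ M := by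
    intro n
    set B := volume (Metric.closedBall x ((n + 1 : ℕ) : ℝ)) with hB
    have hn : (0 : ℝ) < ((n + 1 : ℕ) : ℝ) := by positivity
    have hB0 : B ≠ 0 := volume_closedBall_ne_zero x hn
    have hBt : B ≠ ∞ := volume_closedBall_ne_top x _
    have h1 := (hx _ hn (Set.subset_univ _)).trans (mul_le_mul_right
      (setLIntegral_enorm_le (q := ENNReal.ofReal p) (by simpa using hp) hm.1 _) (C : ℝ≥0∞))
    rw [ENNReal.toReal_ofReal hp0.le, ← mul_assoc, ← hM, ← hB] at h1
    have hsplit : B = B ^ (1 / p) * B ^ (1 - 1 / p) := by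
      rw [← ENNReal.rpow_add _ _ hB0 hBt, add_sub_cancel, ENNReal.rpow_one]
    have hle : 0 ≤ 1 - 1 / p := by
      rw [sub_nonneg, div_le_one hp0]; exact hp
    rw [hsplit, ← mul_assoc, ← hsplit] at h1
    exact (ENNReal.mul_le_mul_iff_left (ENNReal.rpow_pos (pos_iff_ne_zero.2 hB0) hBt).ne'
      (ENNReal.rpow_ne_top_of_nonneg hle hBt)).1 h1
  have hlim : Filter.Tendsto (fun n : ℕ => ‖h x‖ₑ *
      volume (Metric.closedBall x ((n + 1 : ℕ) : ℝ)) ^ (1 / p)) Filter.atTop (nhds ∞) := by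
    have h1 := (ENNReal.continuous_rpow_const (y := 1 / p)).continuousAt.tendsto.comp
      ((tendsto_volume_closedBall_atTop x).comp (Filter.tendsto_add_atTop_nat 1))
    have h2 := ENNReal.Tendsto.const_mul (a := ‖h x‖ₑ) h1 (.inr (by simp))
    rw [ENNReal.top_rpow_of_pos (by positivity), ENNReal.mul_top hx0] at h2
    exact h2
  exact hMt (top_le_iff.1 (le_of_tendsto' hlim hbound))

lemma integral_gradProj_inner_gradProj (f g : Lp E 2 (volume : Measure E)) :
    ∫ x, ⟪(gradProj E f - f : E → E) x, gradProj E g x⟫ = 0 := by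
  have h1 : ⟪gradProj E f - f, gradProj E g⟫ = 0 := by
    rw [inner_sub_left, inner_gradProj_of_mem f (gradProj_mem g), sub_self]
  rw [L2.inner_def] at h1
  rw [← h1]
  refine integral_congr_ae ?_
  filter_upwards [Lp.coeFn_sub (gradProj E f) f] with x hx
  rw [hx]

lemma tendsto_eLpNorm_sub_sub {q : ℝ≥0∞} (hq : 1 ≤ q) {u v : ℕ → E → E} {u' v' : E → E}
    (hu : ∀ n, AEStronglyMeasurable (u n) volume) (hv : ∀ n, AEStronglyMeasurable (v n) volume)
    (hu' : AEStronglyMeasurable u' volume) (hv' : AEStronglyMeasurable v' volume)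
    (h1 : Filter.Tendsto (fun n => eLpNorm (u n - u') q volume) Filter.atTop (nhds 0))
    (h2 : Filter.Tendsto (fun n => eLpNorm (v n - v') q volume) Filter.atTop (nhds 0)) :
    Filter.Tendsto (fun n => eLpNorm ((u n - v n) - (u' - v')) q volume)
      Filter.atTop (nhds 0) := by
  have h3 := h1.add h2
  rw [add_zero] at h3
  refine tendsto_of_tendsto_of_tendsto_of_le_of_le tendsto_const_nhds h3 (fun n => bot_le)
    fun n => ?_
  dsimp only
  rw [sub_sub_sub_comm]
  exact eLpNorm_sub_le ((hu n).sub hu') ((hv n).sub hv') hq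

/-- Solvability of the weak Poisson problem with data in divergence form on the whole space. -/
theorem exists_wholeSpace_solution (E : Type*) [NormedAddCommGroup E]
    [InnerProductSpace ℝ E] [FiniteDimensional ℝ E] [MeasurableSpace E] [BorelSpace E]
    [Nontrivial E] {q p : ℝ} (hqp : q.HolderConjugate p) :
    ∃ C : NNReal, ∀ f : E → E, MemLp f (ENNReal.ofReal q) volume →
      ∃ w W, IsPair q w W ∧
        eLpNorm W (ENNReal.ofReal q) volume ≤ C * eLpNorm f (ENNReal.ofReal q) volume ∧
        ∀ φ V, IsPair p φ V → ∫ x, ⟪W x, V x⟫ = ∫ x, ⟪f x, V x⟫ := by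
  have hq := hqp.lt
  have hp := hqp.symm.lt
  have hq1 : 1 ≤ ENNReal.ofReal q := by simpa using hq.le
  have hp1 : 1 ≤ ENNReal.ofReal p := by simpa using hp.le
  obtain ⟨C, hC⟩ := exists_gradProj_extension E hq
  obtain ⟨_, hD⟩ := exists_gradProj_extension E hp
  refine ⟨C, fun f hf => ?_⟩
  obtain ⟨F, W, hWm, hWle, hF, hPF, hFf, hFW⟩ := hC f hf
  obtain ⟨w, hw⟩ := exists_potential_of_tendsto_gradProj hq hWm hFW
  refine ⟨w, W, hw, hWle, fun φ V hV => ?_⟩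
  obtain ⟨G, Y, hYm, -, hG, hPG, hGV, hGY⟩ := hD V hV.memLp
  obtain ⟨y, hy⟩ := exists_potential_of_tendsto_gradProj hp hYm hGY
  have hpair := hV.sub hp.le hy
  have hortho : ∀ χ : E → ℝ, IsTest χ → ∫ x, ⟪V x - Y x, gradient χ x⟫ = 0 := by
    intro χ hχ
    have hlim := tendsto_integral_inner hqp.symm (u := fun n => (G n - gradProj E (G n) : E → E))
      (u' := V - Y) (v := fun _ => gradient χ) (v' := gradient χ)
      (fun n => (hG n).sub (hPG n)) (hV.memLp.sub hYm) (fun _ => hχ.memLp_gradient _)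
      (hχ.memLp_gradient _)
      (tendsto_eLpNorm_sub_sub hp1 (fun n => (hG n).1) (fun n => (hPG n).1) hV.memLp.1 hYm.1
        hGV hGY) (by simp)
    refine tendsto_nhds_unique hlim (tendsto_const_nhds.congr fun n => ?_)
    have h2 := hχ.memLp_gradient 2
    have hint : ∀ H : Lp E 2 (volume : Measure E),
        Integrable (fun x => ⟪H x, gradient χ x⟫) volume := fun H =>
      MemLp.integrable_inner_of_holder Real.HolderConjugate.two_two
        (by simpa using Lp.memLp H) (by simpa using h2)
    simp only [Pi.sub_apply, inner_sub_left]
    rw [integral_sub (hint _) (hint _), integral_gradProj_inner_gradient _ hχ, sub_self]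
  have hzero : (fun x => V x - Y x) =ᵐ[volume] 0 :=
    ae_eq_zero_of_integral_lap_smul hp.le hpair.memLp fun ψ hψ =>
      (hpair.weakGrad.weakCurlFree hpair.locallyIntegrable
        (hpair.memLp.locallyIntegrable_ofReal hp.le)).integral_lap_smul_eq_zero
        (hpair.memLp.locallyIntegrable_ofReal hp.le) hψ fun v => hortho _ (hψ.dirDeriv v)
  have hlim := tendsto_integral_inner hqp (u := fun n => (gradProj E (F n) - F n : E → E))
    (u' := W - f) (v := fun n => gradProj E (G n)) (v' := Y)
    (fun n => (hPF n).sub (hF n)) (hWm.sub hf) hPG hYm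
    (tendsto_eLpNorm_sub_sub hq1 (fun n => (hPF n).1) (fun n => (hF n).1) hWm.1 hf.1 hFW hFf) hGY
  simp only [integral_gradProj_inner_gradProj] at hlim
  have h0 : ∫ x, ⟪(W - f) x, V x⟫ = 0 := by
    rw [tendsto_nhds_unique tendsto_const_nhds hlim]
    refine integral_congr_ae ?_
    filter_upwards [hzero] with x hx
    rw [sub_eq_zero.1 hx]
  simp only [Pi.sub_apply, inner_sub_left] at h0
  rwa [integral_sub (MemLp.integrable_inner_of_holder hqp hWm hV.memLp)
    (MemLp.integrable_inner_of_holder hqp hf hV.memLp), sub_eq_zero] at h0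

end WholeSpaceSolution

section Mirror

set_option linter.unusedSectionVars false

variable {E : Type*} [NormedAddCommGroup E] [InnerProductSpace ℝ E] [FiniteDimensional ℝ E]

/-- The reflection in the hyperplane orthogonal to `n`. -/
noncomputable def mirror (n : E) : E ≃ₗᵢ[ℝ] E := (ℝ ∙ n)ᗮ.reflection

lemma mirror_mirror (n x : E) : mirror n (mirror n x) = x := Submodule.reflection_reflection _ x

lemma mirror_apply {n : E} (hn : ‖n‖ = 1) (x : E) : mirror n x = x - (2 * ⟪n, x⟫) • n := by
  rw [mirror, Submodule.reflection_orthogonal_apply, Submodule.reflection_singleton_apply]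
  simp [hn, mul_smul, two_smul]

lemma mirror_neg {n : E} (hn : ‖n‖ = 1) (x : E) : mirror (-n) x = mirror n x := by
  rw [mirror_apply hn, mirror_apply (by rwa [norm_neg])]
  simp

lemma inner_mirror_left (n x y : E) : ⟪mirror n x, y⟫ = ⟪x, mirror n y⟫ := by
  rw [← (mirror n).inner_map_map x (mirror n y), mirror_mirror]

lemma inner_mirror {n : E} (hn : ‖n‖ = 1) (x : E) : ⟪n, mirror n x⟫ = -⟪n, x⟫ := by
  rw [mirror_apply hn, inner_sub_right, real_inner_smul_right, real_inner_self_eq_norm_sq, hn]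
  ring

lemma norm_sub_mirror {n : E} (hn : ‖n‖ = 1) (x : E) : ‖x - mirror n x‖ = 2 * |⟪n, x⟫| := by
  rw [mirror_apply hn, sub_sub_cancel, norm_smul, hn]
  simp

lemma IsTest.comp_mirror {ψ : E → ℝ} (h : IsTest ψ) (n : E) : IsTest fun x => ψ (mirror n x) where
  contDiff := h.contDiff.comp (mirror n).contDiff
  hasCompactSupport := h.hasCompactSupport.comp_homeomorph (mirror n).toHomeomorph

lemma IsTest.dirDeriv_comp_mirror {ψ : E → ℝ} (h : IsTest ψ) (n v x : E) :
    _root_.dirDeriv v (fun x => ψ (mirror n x)) x = _root_.dirDeriv (mirror n v) ψ (mirror n x) := by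
  have h1 := (h.differentiable (mirror n x)).hasFDerivAt.comp x
    (mirror n).toContinuousLinearEquiv.hasFDerivAt
  have h2 : HasFDerivAt (fun x => ψ (mirror n x)) _ x := h1
  rw [_root_.dirDeriv, h2.fderiv]
  rfl

variable [MeasurableSpace E] [BorelSpace E]

lemma integral_comp_mirror {F : Type*} [NormedAddCommGroup F] [NormedSpace ℝ F] (n : E)
    (g : E → F) : ∫ x, g (mirror n x) = ∫ x, g x :=
  (mirror n).measurePreserving.integral_comp (mirror n).toHomeomorph.measurableEmbedding g

lemma eLpNorm_mirror (n : E) {V : E → E} {p : ℝ≥0∞} (hV : AEStronglyMeasurable V volume) :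
    eLpNorm (fun x => mirror n (V (mirror n x))) p volume = eLpNorm V p volume := by
  rw [← eLpNorm_comp_measurePreserving hV (mirror n).measurePreserving]
  exact eLpNorm_congr_norm_ae (.of_forall fun x => by simp)

lemma LocallyIntegrable.comp_mirror {φ : E → ℝ} (h : LocallyIntegrable φ volume) (n : E) :
    LocallyIntegrable (fun x => φ (mirror n x)) volume := by
  refine locallyIntegrable_iff.2 fun k hk => ?_
  have h1 := h.integrableOn_isCompact (hk.image (mirror n).continuous)
  have h2 := ((mirror n).measurePreserving.integrableOn_comp_preimage
    (mirror n).toHomeomorph.measurableEmbedding).2 h1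
  rwa [Set.preimage_image_eq _ (mirror n).injective] at h2

lemma IsPair.mirror {p : ℝ} {φ : E → ℝ} {V : E → E} (h : IsPair p φ V) (n : E) :
    IsPair p (fun x => φ (mirror n x)) (fun x => _root_.mirror n (V (_root_.mirror n x))) where
  locallyIntegrable := LocallyIntegrable.comp_mirror h.locallyIntegrable n
  memLp := by
    refine ⟨?_, ?_⟩
    · exact (_root_.mirror n).continuous.comp_aestronglyMeasurable
        (h.memLp.1.comp_measurePreserving (_root_.mirror n).measurePreserving)
    · rw [eLpNorm_mirror n h.memLp.1]
      exact h.memLp.2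
  weakGrad ψ hψ v := by
    rw [← integral_comp_mirror n, ← integral_comp_mirror n fun x => ⟪_, v⟫ * ψ x]
    have h1 := h.weakGrad _ (hψ.comp_mirror n) (_root_.mirror n v)
    simp only [hψ.dirDeriv_comp_mirror, mirror_mirror] at h1
    simp only [mirror_mirror, inner_mirror_left, h1]

lemma ae_inner_ne_zero {n : E} (hn : n ≠ 0) : ∀ᵐ x : E, ⟪n, x⟫ ≠ 0 := by
  have h := Measure.addHaar_submodule (volume : Measure E) (ℝ ∙ n)ᗮ (by
    intro h
    rw [Submodule.orthogonal_eq_top_iff, Submodule.span_singleton_eq_bot] at h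
    exact hn h)
  filter_upwards [compl_mem_ae_iff.2 h] with x hx h0
  exact hx (Submodule.mem_orthogonal_singleton_iff_inner_right.2 h0)

/-- A smooth step function with even derivative. -/
noncomputable def smoothStep (t : ℝ) : ℝ := Real.smoothTransition (t + 1 / 2)

lemma contDiff_step : ContDiff ℝ (⊤ : ℕ∞) smoothStep :=
  Real.smoothTransition.contDiff.comp (contDiff_id.add contDiff_const)

lemma step_of_le {t : ℝ} (h : t ≤ -1) : smoothStep t = 0 :=
  Real.smoothTransition.zero_of_nonpos (by linarith)

lemma step_of_ge {t : ℝ} (h : 1 ≤ t) : smoothStep t = 1 :=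
  Real.smoothTransition.one_of_one_le (by linarith)

lemma step_neg (t : ℝ) : smoothStep (-t) = 1 - smoothStep t := by
  have h : (-t + 1 / 2 : ℝ) = 1 - (t + 1 / 2) := by ring
  rw [smoothStep, smoothStep, h, Real.smoothTransition, Real.smoothTransition, sub_sub_cancel]
  have h0 := (Real.smoothTransition.pos_denom (t + 1 / 2)).ne'
  rw [eq_sub_iff_add_eq, add_comm (expNegInvGlue (1 - (t + 1 / 2))), ← add_div, add_comm,
    div_self h0]

lemma deriv_step_neg (t : ℝ) : deriv smoothStep (-t) = deriv smoothStep t := by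
  have h1 : (fun t => smoothStep (-t)) = fun t => 1 - smoothStep t := funext step_neg
  have h2 := congrArg (fun f => deriv f t) h1
  simp only [deriv_comp_neg, deriv_const_sub] at h2
  linarith

lemma deriv_step_of_lt_abs {t : ℝ} (h : 1 < |t|) : deriv smoothStep t = 0 := by
  rcases lt_abs.1 h with h | h
  · have : smoothStep =ᶠ[nhds t] fun _ => 1 := by
      filter_upwards [lt_mem_nhds h] with s hs using step_of_ge hs.le
    rw [this.deriv_eq, deriv_const]
  · have : smoothStep =ᶠ[nhds t] fun _ => 0 := by
      filter_upwards [gt_mem_nhds (show t < -1 by linarith)] with s hs using step_of_le hs.le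
    rw [this.deriv_eq, deriv_const]

lemma exists_abs_deriv_step_le : ∃ M : ℝ, 0 ≤ M ∧ ∀ t, |t * deriv smoothStep t| ≤ M := by
  have hc : Continuous (deriv smoothStep) := contDiff_step.continuous_deriv (by simp)
  have hs : HasCompactSupport (deriv smoothStep) := by
    refine HasCompactSupport.intro (isCompact_Icc (a := -1) (b := 1)) fun t ht => ?_
    refine deriv_step_of_lt_abs ?_
    by_contra! h
    exact ht (abs_le.1 h)
  obtain ⟨M, hM⟩ := (hs.mul_left (f := fun t => t)).exists_bound_of_continuous
    (continuous_id.mul hc)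
  exact ⟨M, (norm_nonneg _).trans (hM 0), hM⟩

lemma abs_step_le_one (t : ℝ) : |smoothStep t| ≤ 1 := by
  rw [smoothStep, abs_of_nonneg (Real.smoothTransition.nonneg _)]
  exact Real.smoothTransition.le_one _

end Mirror

section Gluing

set_option linter.unusedSectionVars false

variable {E : Type*} [NormedAddCommGroup E] [InnerProductSpace ℝ E] [FiniteDimensional ℝ E]

lemma IsTest.mul_step {ψ : E → ℝ} (hψ : IsTest ψ) (n : E) (c : ℝ) :
    IsTest fun x => smoothStep (c * ⟪n, x⟫) * ψ x where
  contDiff := (contDiff_step.comp (contDiff_const.mul (contDiff_const.inner ℝ contDiff_id))).mul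
    hψ.contDiff
  hasCompactSupport := hψ.hasCompactSupport.mul_left

lemma IsTest.dirDeriv_mul_step {ψ : E → ℝ} (hψ : IsTest ψ) (n : E) (c : ℝ) (v x : E) :
    _root_.dirDeriv v (fun x => smoothStep (c * ⟪n, x⟫) * ψ x) x =
      smoothStep (c * ⟪n, x⟫) * _root_.dirDeriv v ψ x +
        ψ x * (deriv smoothStep (c * ⟪n, x⟫) * (c * ⟪n, v⟫)) := by
  have h1 : HasFDerivAt (fun x => c * ⟪n, x⟫) (c • innerSL ℝ n) x :=
    (innerSL ℝ n).hasFDerivAt.const_mul c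
  have h2 : HasDerivAt smoothStep (deriv smoothStep (c * ⟪n, x⟫)) (c * ⟪n, x⟫) :=
    (contDiff_step.differentiable (by simp) _).hasDerivAt
  have h3 := (h2.comp_hasFDerivAt x h1).mul (hψ.differentiable x).hasFDerivAt
  have h4 : HasFDerivAt (fun x => smoothStep (c * ⟪n, x⟫) * ψ x) _ x := h3
  rw [_root_.dirDeriv, h4.fderiv]
  simp [_root_.dirDeriv]

lemma tendsto_step_mul {t : ℝ} (ht : t ≠ 0) :
    Filter.Tendsto (fun k : ℕ => smoothStep (((k : ℝ) + 1) * t)) Filter.atTop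
      (nhds (if 0 < t then 1 else 0)) := by
  have hk : Filter.Tendsto (fun k : ℕ => (k : ℝ) + 1) Filter.atTop Filter.atTop :=
    Filter.tendsto_atTop_add_const_right _ _ tendsto_natCast_atTop_atTop
  rcases lt_or_gt_of_ne ht with h | h
  · rw [if_neg h.not_gt]
    refine tendsto_const_nhds.congr' ?_
    filter_upwards [(hk.atTop_mul_const_of_neg h).eventually_le_atBot (-1)] with k hk
    exact (step_of_le hk).symm
  · rw [if_pos h]
    refine tendsto_const_nhds.congr' ?_
    filter_upwards [(hk.atTop_mul_const h).eventually_ge_atTop 1] with k hk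
    exact (step_of_ge hk).symm

lemma eventually_deriv_step_mul_eq_zero {t : ℝ} (ht : t ≠ 0) :
    ∀ᶠ k : ℕ in Filter.atTop, deriv smoothStep (((k : ℝ) + 1) * t) = 0 := by
  have hk : Filter.Tendsto (fun k : ℕ => ((k : ℝ) + 1) * |t|) Filter.atTop Filter.atTop :=
    (Filter.tendsto_atTop_add_const_right _ _ tendsto_natCast_atTop_atTop).atTop_mul_const
      (abs_pos.2 ht)
  filter_upwards [hk.eventually_gt_atTop 1] with k hk
  refine deriv_step_of_lt_abs ?_
  rwa [abs_mul, abs_of_pos (by positivity : (0 : ℝ) < (k : ℝ) + 1)]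

variable [MeasurableSpace E] [BorelSpace E]

lemma measurableSet_inner_pos (n : E) : MeasurableSet {x : E | 0 < ⟪n, x⟫} :=
  (isOpen_lt continuous_const (continuous_const.inner continuous_id)).measurableSet

lemma tendsto_integral_step_mul {n : E} (hn : ‖n‖ = 1) {g : E → ℝ} (hg : Integrable g volume) :
    Filter.Tendsto (fun k : ℕ => ∫ x, smoothStep (((k : ℝ) + 1) * ⟪n, x⟫) * g x) Filter.atTop
      (nhds (∫ x, {x : E | 0 < ⟪n, x⟫}.indicator g x)) := by
  refine tendsto_integral_of_dominated_convergence (fun x => ‖g x‖) (fun k => ?_) hg.norm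
    (fun k => .of_forall fun x => ?_) ?_
  · refine AEStronglyMeasurable.mul (Continuous.aestronglyMeasurable ?_) hg.1
    exact contDiff_step.continuous.comp (by fun_prop)
  · rw [norm_mul]
    exact mul_le_of_le_one_left (norm_nonneg _) (abs_step_le_one _)
  · filter_upwards [ae_inner_ne_zero (n := n) (by rintro rfl; simp at hn)] with x hx
    have := (tendsto_step_mul hx).mul_const (g x)
    convert this using 2
    by_cases h : 0 < ⟪n, x⟫ <;> simp [h]

/-- The commutator of the cutoff with the gradient vanishes on odd functions. -/
lemma tendsto_integral_mul_deriv_step {n : E} (hn : ‖n‖ = 1) {h : E → ℝ}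
    (hh : LocallyIntegrable h volume) (hodd : ∀ x, h (mirror n x) = -h x) {ψ : E → ℝ}
    (hψ : IsTest ψ) (a : ℝ) :
    Filter.Tendsto (fun k : ℕ => ∫ x, h x *
        (ψ x * (deriv smoothStep (((k : ℝ) + 1) * ⟪n, x⟫) * (((k : ℝ) + 1) * a))))
      Filter.atTop (nhds 0) := by
  set S := mirror n with hS
  set g : ℕ → E → ℝ := fun k x => deriv smoothStep (((k : ℝ) + 1) * ⟪n, x⟫) * (((k : ℝ) + 1) * a) with hg
  have hstep : Continuous (deriv smoothStep) := contDiff_step.continuous_deriv (by simp)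
  have hgc : ∀ k, Continuous (g k) := fun k =>
    (hstep.comp (by fun_prop : Continuous fun x => ((k : ℝ) + 1) * ⟪n, x⟫)).mul continuous_const
  have hgS : ∀ k x, g k (S x) = g k x := by
    intro k x
    simp only [hg, hS, inner_mirror hn, mul_neg, deriv_step_neg]
  have hψS := hψ.comp_mirror n
  have hint : ∀ (χ : E → ℝ), IsTest χ → ∀ k, Integrable (fun x => h x * (χ x * g k x)) volume := by
    intro χ hχ k
    exact (hh.integrable_smul_left_of_hasCompactSupport (hχ.continuous.mul (hgc k))
      hχ.hasCompactSupport.mul_right).congr (.of_forall fun x => mul_comm _ _)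
  have hsym : ∀ k, ∫ x, h x * (ψ x * g k x) =
      2⁻¹ * ∫ x, h x * ((ψ x - ψ (S x)) * g k x) := by
    intro k
    have h1 : ∫ x, h x * (ψ x * g k x) = -∫ x, h x * (ψ (S x) * g k x) := by
      rw [← integral_comp_mirror n, ← integral_neg]
      refine integral_congr_ae (.of_forall fun x => ?_)
      dsimp only
      rw [hodd, hgS, neg_mul]
    have h2 : ∫ x, h x * ((ψ x - ψ (S x)) * g k x) =
        (∫ x, h x * (ψ x * g k x)) - ∫ x, h x * (ψ (S x) * g k x) := by
      rw [← integral_sub (hint _ hψ k) (hint _ hψS k)]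
      refine integral_congr_ae (.of_forall fun x => ?_)
      ring
    rw [h2]
    linarith
  obtain ⟨L, hL⟩ := hψ.contDiff.lipschitzWith_of_hasCompactSupport hψ.hasCompactSupport (by simp)
  obtain ⟨M, hM0, hM⟩ := exists_abs_deriv_step_le
  set K := tsupport ψ ∪ tsupport fun x => ψ (S x) with hK
  have hKc : IsCompact K := hψ.hasCompactSupport.isCompact.union hψS.hasCompactSupport.isCompact
  have hz : ∀ x, x ∉ K → ψ x - ψ (S x) = 0 := by
    intro x hx
    rw [hK, Set.mem_union, not_or] at hx
    rw [image_eq_zero_of_notMem_tsupport hx.1,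
      image_eq_zero_of_notMem_tsupport (f := fun x => ψ (S x)) hx.2, sub_zero]
  have hle : ∀ k x, |(ψ x - ψ (S x)) * g k x| ≤ 2 * L * M * |a| := by
    intro k x
    have h1 : |ψ x - ψ (S x)| ≤ L * (2 * |⟪n, x⟫|) := by
      have := hL.dist_le_mul x (S x)
      rwa [dist_eq_norm, dist_eq_norm, norm_sub_mirror hn] at this
    calc |(ψ x - ψ (S x)) * g k x|
        ≤ L * (2 * |⟪n, x⟫|) * |g k x| := by
          rw [abs_mul]
          exact mul_le_mul_of_nonneg_right h1 (abs_nonneg _)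
      _ = 2 * L * |(((k : ℝ) + 1) * ⟪n, x⟫) * deriv smoothStep (((k : ℝ) + 1) * ⟪n, x⟫)| * |a| := by
          simp only [hg, abs_mul]
          ring
      _ ≤ _ := by
          gcongr
          exact hM _
  have hlim : Filter.Tendsto (fun k => ∫ x, h x * ((ψ x - ψ (S x)) * g k x)) Filter.atTop
      (nhds (∫ _ : E, (0 : ℝ))) := by
    refine tendsto_integral_of_dominated_convergence
      (K.indicator fun x => ‖h x‖ * (2 * L * M * |a|)) (fun k => ?_) ?_ (fun k => .of_forall
        fun x => ?_) (.of_forall fun x => ?_)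
    · exact hh.aestronglyMeasurable.mul (Continuous.aestronglyMeasurable
        ((hψ.continuous.sub hψS.continuous).mul (hgc k)))
    · exact (integrable_indicator_iff hKc.measurableSet).2
        ((hh.integrableOn_isCompact hKc).norm.mul_const _)
    · by_cases hx : x ∈ K
      · rw [Set.indicator_of_mem hx, norm_mul]
        exact mul_le_mul_of_nonneg_left (hle k x) (norm_nonneg _)
      · rw [Set.indicator_of_notMem hx, hz x hx]
        simp
    · by_cases hx : ⟪n, x⟫ = 0
      · have : S x = x := by rw [hS, mirror_apply hn, hx]; simp
        simp [this]
      · refine tendsto_const_nhds.congr' ?_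
        filter_upwards [eventually_deriv_step_mul_eq_zero hx] with k hk
        simp [hg, hk]
  have := hlim.const_mul (2⁻¹ : ℝ)
  simp only [integral_zero, mul_zero] at this
  exact this.congr fun k => (hsym k).symm

/-- An odd function with weak gradient may be extended by zero across the mirror. -/
lemma IsPair.indicator_of_odd {p : ℝ} (hp : 1 ≤ p) {n : E} (hn : ‖n‖ = 1) {h : E → ℝ} {H : E → E}
    (hh : IsPair p h H) (hodd : ∀ x, h (_root_.mirror n x) = -h x) :
    IsPair p ({x : E | 0 < ⟪n, x⟫}.indicator h) ({x : E | 0 < ⟪n, x⟫}.indicator H) where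
  locallyIntegrable := hh.locallyIntegrable.indicator (measurableSet_inner_pos n)
  memLp := hh.memLp.indicator (measurableSet_inner_pos n)
  weakGrad ψ hψ v := by
    have hi1 := integrable_mul_isTest hh.locallyIntegrable (hψ.dirDeriv v)
    have hi2 := integrable_inner_const_mul (hh.memLp.locallyIntegrable_ofReal hp)
        hψ.continuous hψ.hasCompactSupport v
    have h1 := tendsto_integral_step_mul hn hi1
    have h2 := tendsto_integral_step_mul hn hi2
    have h3 := tendsto_integral_mul_deriv_step hn hh.locallyIntegrable hodd hψ ⟪n, v⟫
    have e1 : ∀ x, {x : E | 0 < ⟪n, x⟫}.indicator (fun x => h x * dirDeriv v ψ x) x =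
        {x : E | 0 < ⟪n, x⟫}.indicator h x * dirDeriv v ψ x := fun x => by
      by_cases hx : 0 < ⟪n, x⟫ <;> simp [hx]
    have e2 : ∀ x, {x : E | 0 < ⟪n, x⟫}.indicator (fun x => ⟪H x, v⟫ * ψ x) x =
        ⟪{x : E | 0 < ⟪n, x⟫}.indicator H x, v⟫ * ψ x := fun x => by
      by_cases hx : 0 < ⟪n, x⟫ <;> simp [hx]
    simp only [e1] at h1
    simp only [e2] at h2
    have h4 := h1.add h3
    rw [add_zero] at h4
    refine tendsto_nhds_unique h4 (h2.neg.congr fun k => ?_)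
    have h5 := hh.weakGrad _ (hψ.mul_step n ((k : ℝ) + 1)) v
    have h6 : ∫ x, ⟪H x, v⟫ * (smoothStep (((k : ℝ) + 1) * ⟪n, x⟫) * ψ x) =
        ∫ x, smoothStep (((k : ℝ) + 1) * ⟪n, x⟫) * (⟪H x, v⟫ * ψ x) :=
      integral_congr_ae (.of_forall fun x => by ring)
    rw [← h6, ← h5]
    simp only [hψ.dirDeriv_mul_step]
    rw [← integral_add]
    · exact integral_congr_ae (.of_forall fun x => by ring)
    · exact (integrable_mul_isTest hh.locallyIntegrable ((hψ.dirDeriv v).mul_step n _)).congr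
        (.of_forall fun x => by ring)
    · have hstep : Continuous (deriv smoothStep) := contDiff_step.continuous_deriv (by simp)
      refine (hh.locallyIntegrable.integrable_smul_left_of_hasCompactSupport
        (hψ.continuous.mul ((hstep.comp
          (by fun_prop : Continuous fun x => ((k : ℝ) + 1) * ⟪n, x⟫)).mul continuous_const))
        hψ.hasCompactSupport.mul_right).congr (.of_forall fun x => mul_comm _ _)

end Gluing

section Reflection

variable {E : Type*} [NormedAddCommGroup E] [InnerProductSpace ℝ E] [FiniteDimensional ℝ E]
  [MeasurableSpace E] [BorelSpace E]

/-- For data supported in the upper half-space, a whole-space solution transfers between the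
half-spaces by reflection. -/
lemma integral_indicator_inner_mirror {p q : ℝ} (hqp : q.HolderConjugate p) {n : E}
    (hn : ‖n‖ = 1) {f W V : E → E} {φ : E → ℝ} (hf0 : ∀ x, ⟪n, x⟫ ≤ 0 → f x = 0)
    (hW : MemLp W (ENNReal.ofReal q) volume)
    (hsol : ∀ φ V, IsPair p φ V → ∫ x, ⟪W x, V x⟫ = ∫ x, ⟪f x, V x⟫) (h : IsPair p φ V) :
    ∫ x, {x : E | 0 < ⟪n, x⟫}.indicator (fun x => ⟪mirror n (W (mirror n x)), V x⟫) x =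
      ∫ x, {x : E | 0 < ⟪-n, x⟫}.indicator (fun x => ⟪W x, V x⟫) x := by
  set M := {x : E | 0 < ⟪-n, x⟫} with hM
  have hMm : MeasurableSet M := measurableSet_inner_pos (-n)
  have hn' : ‖-n‖ = 1 := by rwa [norm_neg]
  have hodd := IsPair.indicator_of_odd hqp.symm.lt.le hn'
    ((h.mirror n).sub hqp.symm.lt.le h) (fun x => by
      simp only [mirror_neg hn, mirror_mirror]; ring)
  have h0 := hsol _ _ hodd
  have hz : ∀ x, ⟪f x, M.indicator (fun x => mirror n (V (mirror n x)) - V x) x⟫ = 0 := by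
    intro x
    by_cases hx : x ∈ M
    · have : ⟪n, x⟫ ≤ 0 := by
        have : 0 < ⟪-n, x⟫ := hx
        rw [inner_neg_left] at this
        linarith
      rw [hf0 x this, inner_zero_left]
    · rw [Set.indicator_of_notMem hx, inner_zero_right]
  rw [← hM] at h0
  simp only [hz, integral_zero] at h0
  have e1 : ∀ x, ⟪W x, M.indicator (fun x => mirror n (V (mirror n x)) - V x) x⟫ =
      M.indicator (fun x => ⟪W x, mirror n (V (mirror n x))⟫) x -
        M.indicator (fun x => ⟪W x, V x⟫) x := by
    intro x
    by_cases hx : x ∈ M <;> simp [hx, inner_sub_right]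
  simp only [e1] at h0
  rw [integral_sub ((hW.integrable_inner_of_holder hqp (h.mirror n).memLp).indicator hMm)
    ((hW.integrable_inner_of_holder hqp h.memLp).indicator hMm), sub_eq_zero] at h0
  rw [← h0, ← integral_comp_mirror n]
  refine integral_congr_ae (.of_forall fun x => ?_)
  dsimp only
  by_cases hx : x ∈ M
  · have hx' : mirror n x ∈ {x : E | 0 < ⟪n, x⟫} := by
      simpa [hM, inner_mirror hn] using hx
    rw [Set.indicator_of_mem hx, Set.indicator_of_mem hx', mirror_mirror, inner_mirror_left]
  · have hx' : mirror n x ∉ {x : E | 0 < ⟪n, x⟫} := by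
      simpa [hM, inner_mirror hn] using hx
    rw [Set.indicator_of_notMem hx, Set.indicator_of_notMem hx']

/-- Solvability of the two-phase problem for data supported in one half-space. -/
lemma exists_twoPhase_solution_of_halfSpace [Nontrivial E] {p q : ℝ}
    (hqp : q.HolderConjugate p) {a b : ℝ} (ha : 0 < a) (hb : 0 < b) {n : E} (hn : ‖n‖ = 1)
    {α : E → ℝ} (hαa : ∀ x, 0 < ⟪n, x⟫ → α x = a) (hαb : ∀ x, ⟪n, x⟫ < 0 → α x = b) :
    ∃ C : NNReal, ∀ f : E → E, MemLp f (ENNReal.ofReal q) volume →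
      (∀ x, ⟪n, x⟫ ≤ 0 → f x = 0) → ∃ u U, IsPair q u U ∧
        eLpNorm U (ENNReal.ofReal q) volume ≤ C * eLpNorm f (ENNReal.ofReal q) volume ∧
        ∀ φ V, IsPair p φ V → Integrable (fun x => α x * ⟪U x, V x⟫) volume ∧
          ∫ x, α x * ⟪U x, V x⟫ = ∫ x, ⟪f x, V x⟫ := by
  have hq := hqp.lt.le
  have hq1 : 1 ≤ ENNReal.ofReal q := by simpa using hq
  obtain ⟨C, hC⟩ := exists_wholeSpace_solution E hqp
  set c := 2 / (a + b) with hc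
  set κ := (a - b) / (a + b) with hκ
  set P := {x : E | 0 < ⟪n, x⟫} with hP
  set M := {x : E | 0 < ⟪-n, x⟫} with hM
  have hPm : MeasurableSet P := measurableSet_inner_pos n
  have hMm : MeasurableSet M := measurableSet_inner_pos (-n)
  refine ⟨(‖c‖₊ + ‖κ / a‖₊ * 2) * C, fun f hf hf0 => ?_⟩
  obtain ⟨w, W, hw, hWle, hsol⟩ := hC f hf
  have hodd := IsPair.indicator_of_odd hq hn ((hw.mirror n).sub hq hw) (fun x => by
    simp only [mirror_mirror]; ring)
  rw [← hP] at hodd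
  refine ⟨_, _, (hw.const_smul c).add hq (hodd.const_smul (κ / a)), ?_, fun φ V h => ?_⟩
  · have h1 : eLpNorm (fun x => mirror n (W (mirror n x)) - W x) (ENNReal.ofReal q) volume ≤
        2 * eLpNorm W (ENNReal.ofReal q) volume := by
      refine (eLpNorm_sub_le (hw.mirror n).memLp.1 hw.memLp.1 hq1).trans_eq ?_
      rw [eLpNorm_mirror n hw.memLp.1, two_mul]
    refine (eLpNorm_add_le (hw.memLp.1.const_smul c) (hodd.memLp.1.const_smul (κ / a)) hq1).trans ?_
    change eLpNorm (c • W) _ _ + eLpNorm ((κ / a) • P.indicator _) _ _ ≤ _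
    rw [eLpNorm_const_smul, eLpNorm_const_smul]
    calc _ ≤ ‖c‖ₑ * eLpNorm W (ENNReal.ofReal q) volume +
          ‖κ / a‖ₑ * (2 * eLpNorm W (ENNReal.ofReal q) volume) := by
          gcongr
          exact (eLpNorm_indicator_le _).trans h1
      _ = (‖c‖ₑ + ‖κ / a‖ₑ * 2) * eLpNorm W (ENNReal.ofReal q) volume := by ring
      _ ≤ (‖c‖ₑ + ‖κ / a‖ₑ * 2) * (C * eLpNorm f (ENNReal.ofReal q) volume) := by gcongr
      _ = _ := by
        push_cast
        rw [mul_assoc]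
        rfl
  · have e : (fun x => α x * ⟪c • W x + (κ / a) •
          P.indicator (fun x => mirror n (W (mirror n x)) - W x) x, V x⟫) =ᵐ[volume]
        fun x => ⟪W x, V x⟫ + κ * (P.indicator (fun x => ⟪mirror n (W (mirror n x)), V x⟫) x -
          M.indicator (fun x => ⟪W x, V x⟫) x) := by
      filter_upwards [ae_inner_ne_zero (n := n) (by rintro rfl; simp at hn)] with x hx
      rcases lt_or_gt_of_ne hx with hx | hx
      · have h1 : x ∉ P := hx.not_gt
        have h2 : x ∈ M := by simpa [hM] using hx
        rw [hαb x hx, Set.indicator_of_notMem h1, Set.indicator_of_notMem h1,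
          Set.indicator_of_mem h2, smul_zero, add_zero, real_inner_smul_left, hc, hκ]
        field_simp
        ring
      · have h1 : x ∈ P := hx
        have h2 : x ∉ M := by simpa [hM] using hx.le
        rw [hαa x hx, Set.indicator_of_mem h1, Set.indicator_of_mem h1,
          Set.indicator_of_notMem h2, inner_add_left, real_inner_smul_left, real_inner_smul_left,
          inner_sub_left, hc, hκ]
        field_simp
        ring
    have i1 := hw.memLp.integrable_inner_of_holder hqp h.memLp
    have i2 := ((hw.mirror n).memLp.integrable_inner_of_holder hqp h.memLp).indicator hPm
    have i3 := i1.indicator hMm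
    have i4 : Integrable (fun x => κ * (P.indicator (fun x => ⟪mirror n (W (mirror n x)), V x⟫) x -
        M.indicator (fun x => ⟪W x, V x⟫) x)) volume := (i2.sub i3).const_mul κ
    refine ⟨(i1.add i4).congr e.symm, ?_⟩
    rw [integral_congr_ae e, integral_add i1 i4, integral_const_mul,
      integral_sub i2 i3,
      integral_indicator_inner_mirror hqp hn hf0 hw.memLp hsol h, sub_self, mul_zero, add_zero,
      hsol φ V h]

/-- Solvability of the two-phase problem across a hyperplane. -/
theorem exists_twoPhase_solution [Nontrivial E] {p q : ℝ}
    (hqp : q.HolderConjugate p) {a b : ℝ} (ha : 0 < a) (hb : 0 < b) {n : E} (hn : ‖n‖ = 1)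
    {α : E → ℝ} (hαa : ∀ x, 0 < ⟪n, x⟫ → α x = a) (hαb : ∀ x, ⟪n, x⟫ < 0 → α x = b) :
    ∃ C : NNReal, ∀ f : E → E, MemLp f (ENNReal.ofReal q) volume →
      ∃ u U, IsPair q u U ∧
        eLpNorm U (ENNReal.ofReal q) volume ≤ C * eLpNorm f (ENNReal.ofReal q) volume ∧
        ∀ φ V, IsPair p φ V → ∫ x, α x * ⟪U x, V x⟫ = ∫ x, ⟪f x, V x⟫ := by
  have hq := hqp.lt.le
  have hq1 : 1 ≤ ENNReal.ofReal q := by simpa using hq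
  obtain ⟨C, hC⟩ := exists_twoPhase_solution_of_halfSpace hqp ha hb hn hαa hαb
  obtain ⟨D, hD⟩ := exists_twoPhase_solution_of_halfSpace hqp hb ha (n := -n) (α := α)
    (by rwa [norm_neg]) (fun x hx => hαb x (by simpa using hx))
    (fun x hx => hαa x (by simpa using hx))
  refine ⟨C + D, fun f hf => ?_⟩
  have hf1 := hf.indicator (measurableSet_inner_pos n)
  have hf2 := hf.indicator (measurableSet_inner_pos (-n))
  obtain ⟨u, U, hu, hUle, hU⟩ := hC _ hf1 fun x hx =>
    Set.indicator_of_notMem (by simpa using hx) _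
  obtain ⟨v, V, hv, hVle, hV⟩ := hD _ hf2 fun x hx =>
    Set.indicator_of_notMem (by simpa using hx) _
  refine ⟨_, _, hu.add hq hv, ?_, fun φ X h => ?_⟩
  · refine (eLpNorm_add_le hu.memLp.1 hv.memLp.1 hq1).trans ?_
    rw [ENNReal.coe_add, add_mul]
    refine add_le_add (hUle.trans ?_) (hVle.trans ?_)
    · gcongr
      exact eLpNorm_indicator_le _
    · gcongr
      exact eLpNorm_indicator_le _
  · obtain ⟨i1, e1⟩ := hU φ X h
    obtain ⟨i2, e2⟩ := hV φ X h
    simp only [inner_add_left, mul_add]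
    rw [integral_add i1 i2, e1, e2, ← integral_add (hf1.integrable_inner_of_holder hqp h.memLp)
      (hf2.integrable_inner_of_holder hqp h.memLp)]
    refine integral_congr_ae ?_
    filter_upwards [ae_inner_ne_zero (n := n) (by rintro rfl; simp at hn)] with x hx
    rcases lt_or_gt_of_ne hx with hx | hx
    · simp [hx, hx.le]
    · simp [hx, hx.le]

end Reflection

section Coordinates

lemma isGradPair_iff_isPair {N : ℕ} {p : ℝ} (hp : 1 ≤ p) {φ : EuclideanSpace ℝ (Fin N) → ℝ}
    {V : EuclideanSpace ℝ (Fin N) → EuclideanSpace ℝ (Fin N)} :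
    IsGradPair N p φ V ↔ IsPair p φ V := by
  have hs : ∀ (x : EuclideanSpace ℝ (Fin N)) j, ⟪x, EuclideanSpace.single j (1 : ℝ)⟫ = x j :=
    fun x j => by simp [EuclideanSpace.inner_single_right]
  refine ⟨fun h => ⟨h.1, h.2.1, fun ψ hψ v => ?_⟩, fun h => ⟨h.locallyIntegrable, h.memLp,
    fun ψ hψ hc j => ?_⟩⟩
  · have hv : v = ∑ j, v j • EuclideanSpace.single j (1 : ℝ) := by
      simpa using ((EuclideanSpace.basisFun (Fin N) ℝ).sum_repr v).symm
    have e1 : ∀ x, φ x * dirDeriv v ψ x =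
        ∑ j, v j * (φ x * dirDeriv (EuclideanSpace.single j 1) ψ x) := by
      intro x
      conv_lhs => rw [dirDeriv, hv]
      rw [map_sum, Finset.mul_sum]
      refine Finset.sum_congr rfl fun j _ => ?_
      rw [map_smul, smul_eq_mul, dirDeriv]
      ring
    have e2 : ∀ x, ⟪V x, v⟫ * ψ x =
        ∑ j, v j * (⟪V x, EuclideanSpace.single j (1 : ℝ)⟫ * ψ x) := by
      intro x
      conv_lhs => rw [hv]
      rw [inner_sum, Finset.sum_mul]
      refine Finset.sum_congr rfl fun j _ => ?_
      rw [real_inner_smul_right]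
      ring
    simp only [e1, e2]
    rw [integral_finsetSum _ fun j _ => (integrable_mul_isTest h.1 (hψ.dirDeriv _)).const_mul (v j),
      integral_finsetSum _ fun j _ => (integrable_inner_const_mul
        (h.2.1.locallyIntegrable_ofReal hp) hψ.continuous hψ.hasCompactSupport _).const_mul (v j),
      ← Finset.sum_neg_distrib]
    refine Finset.sum_congr rfl fun j _ => ?_
    have := h.2.2 ψ hψ.contDiff hψ.hasCompactSupport j
    simp only [integral_const_mul, dirDeriv, this, mul_neg, hs]
  · simpa only [hs, dirDeriv] using h.weakGrad ψ ⟨hψ, hc⟩ (EuclideanSpace.single j 1)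

end Coordinates

/-- Theorem 3.5, existence part: solvability of the weak two-phase elliptic problem
`(ρ⁻¹∇u, ∇φ) = (f, ∇φ)` across the flat interface `{x_N = 0}`, with the estimate
`‖∇u‖_{L^q} ≤ C ‖f‖_{L^q}`. -/
theorem stmt_13 (N : ℕ) (hN : 1 ≤ N) (q : ℝ) (hq : 1 < q)
    (ρp ρm : ℝ) (hρp : 0 < ρp) (hρm : 0 < ρm) :
    ∃ C : ℝ, 0 < C ∧
      ∀ f : EuclideanSpace ℝ (Fin N) → EuclideanSpace ℝ (Fin N),
        MemLp f (ENNReal.ofReal q) volume →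
        ∃ u U, IsGradPair N q u U ∧
          eLpNorm U (ENNReal.ofReal q) volume ≤
            ENNReal.ofReal C * eLpNorm f (ENNReal.ofReal q) volume ∧
          ∀ φ V, IsGradPair N (q / (q - 1)) φ V →
            (∫ x : EuclideanSpace ℝ (Fin N),
              (if 0 < x ⟨N - 1, by omega⟩ then ρp else ρm)⁻¹ * ⟪U x, V x⟫) =
            ∫ x : EuclideanSpace ℝ (Fin N), ⟪f x, V x⟫ := by
  have hqp : q.HolderConjugate (q / (q - 1)) := .conjExponent hq
  set i : Fin N := ⟨N - 1, by omega⟩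
  have : Nonempty (Fin N) := ⟨i⟩
  have hs : ∀ x : EuclideanSpace ℝ (Fin N), ⟪EuclideanSpace.single i (1 : ℝ), x⟫ = x i :=
    fun x => by simp [EuclideanSpace.inner_single_left]
  obtain ⟨C, hC⟩ := exists_twoPhase_solution hqp (inv_pos.2 hρp) (inv_pos.2 hρm)
    (n := EuclideanSpace.single i (1 : ℝ)) (by simp)
    (α := fun x => (if 0 < x i then ρp else ρm)⁻¹)
    (fun x hx => by rw [hs] at hx; rw [if_pos hx])
    (fun x hx => by rw [hs] at hx; rw [if_neg hx.not_gt])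
  refine ⟨C + 1, by positivity, fun f hf => ?_⟩
  obtain ⟨u, U, hu, hle, hU⟩ := hC f hf
  refine ⟨u, U, (isGradPair_iff_isPair hq.le).2 hu, hle.trans ?_, fun φ V h =>
    hU φ V ((isGradPair_iff_isPair hqp.symm.lt.le).1 h)⟩
  gcongr
  rw [← ENNReal.ofReal_coe_nnreal]
  exact ENNReal.ofReal_le_ofReal (by linarith)
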